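/- Assume n = 3, M is irreducible, ρ(M) = 0, every matrix in M is invertible, and Condition G holds; let v be a Barabanov norm. Then every v-extremal solution x of the linear switched system tends to a periodic solution: there exist T > 0 and a solution y of the switched system with y(t + T) = y(t) for all t ≥ 0 such that ω(x(·)) = {y(t) : t ∈ [0, T]}. -/

import Mathlib

open MeasureTheory Filter Topology RealInnerProductSpace Matrix

noncomputable section

abbrev Vec (n : ℕ) := EuclideanSpace ℝ (Fin n)

def mulE {n : ℕ} (A : Matrix (Fin n) (Fin n) ℝ) (y : Vec n) : Vec n :=
  Matrix.toEuclideanLin A y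

def IsSolutionWith {n : ℕ} (M : Set (Matrix (Fin n) (Fin n) ℝ))
    (A : ℝ → Matrix (Fin n) (Fin n) ℝ) (x : ℝ → Vec n) : Prop :=
  (∀ i j, Measurable fun t => A t i j) ∧ (∀ t, A t ∈ M) ∧
    ContinuousOn x (Set.Ici 0) ∧
    ∀ t ≥ (0:ℝ), x t = x 0 + ∫ s in (0:ℝ)..t, mulE (A s) (x s)

def IsSolution {n : ℕ} (M : Set (Matrix (Fin n) (Fin n) ℝ)) (x : ℝ → Vec n) : Prop :=
  ∃ A, IsSolutionWith M A x

def IsAdjointWith {n : ℕ} (A : ℝ → Matrix (Fin n) (Fin n) ℝ) (l : ℝ → Vec n) : Prop :=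
  ContinuousOn l (Set.Ici 0) ∧
    ∀ t ≥ (0:ℝ), l t = l 0 - ∫ s in (0:ℝ)..t, mulE ((A s)ᵀ) (l s)

def IsNorm {n : ℕ} (v : Vec n → ℝ) : Prop :=
  (∀ x, v x = 0 ↔ x = 0) ∧ (∀ (a : ℝ) (x : Vec n), v (a • x) = |a| * v x) ∧
    ∀ x y, v (x + y) ≤ v x + v y

def IsBarabanov {n : ℕ} (M : Set (Matrix (Fin n) (Fin n) ℝ)) (v : Vec n → ℝ) : Prop :=
  IsNorm v ∧ (∀ x, IsSolution M x → ∀ t ≥ (0:ℝ), v (x t) ≤ v (x 0)) ∧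
    ∀ y : Vec n, ∃ x, IsSolution M x ∧ x 0 = y ∧ ∀ t ≥ (0:ℝ), v (x t) = v y

def IsExtremal {n : ℕ} (M : Set (Matrix (Fin n) (Fin n) ℝ)) (v : Vec n → ℝ)
    (x : ℝ → Vec n) : Prop :=
  IsSolution M x ∧ ∀ t ≥ (0:ℝ), v (x t) = v (x 0)

def subdiff {n : ℕ} (v : Vec n → ℝ) (x : Vec n) : Set (Vec n) :=
  {l | ⟪l, x⟫ = v x ∧ ∀ y, ⟪l, y⟫ ≤ v y}

def MIrreducible {n : ℕ} (M : Set (Matrix (Fin n) (Fin n) ℝ)) : Prop :=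
  ∀ W : Submodule ℝ (Vec n), (∀ A ∈ M, ∀ x ∈ W, mulE A x ∈ W) → W = ⊥ ∨ W = ⊤

def rhoZero {n : ℕ} (M : Set (Matrix (Fin n) (Fin n) ℝ)) : Prop :=
  sSup {r : EReal | ∃ x, IsSolution M x ∧ x 0 ≠ 0 ∧
      r = limsup (fun t => ((Real.log ‖x t‖ / t : ℝ) : EReal)) atTop} = 0

def MaxCondWith {n : ℕ} (M : Set (Matrix (Fin n) (Fin n) ℝ))
    (A : ℝ → Matrix (Fin n) (Fin n) ℝ) (x l : ℝ → Vec n) : Prop :=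
  ∀ᵐ t ∂(volume.restrict (Set.Ici (0:ℝ))),
    ∀ B ∈ M, ⟪l t, mulE B (x t)⟫ ≤ ⟪l t, mulE (A t) (x t)⟫

def ConditionG {n : ℕ} (M : Set (Matrix (Fin n) (Fin n) ℝ)) : Prop :=
  ∀ (x₀ l₀ : Vec n), x₀ ≠ 0 → l₀ ≠ 0 →
  ∀ A₁ A₂ (x₁ x₂ l₁ l₂ : ℝ → Vec n),
    IsSolutionWith M A₁ x₁ → IsSolutionWith M A₂ x₂ →
    IsAdjointWith A₁ l₁ → IsAdjointWith A₂ l₂ →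
    x₁ 0 = x₀ → x₂ 0 = x₀ → l₁ 0 = l₀ → l₂ 0 = l₀ →
    MaxCondWith M A₁ x₁ l₁ → MaxCondWith M A₂ x₂ l₂ →
    ∀ t ≥ (0:ℝ), x₁ t = x₂ t ∧ l₁ t = l₂ t

def omegaLimitSet {n : ℕ} (x : ℝ → Vec n) : Set (Vec n) :=
  {p | ∃ tk : ℕ → ℝ, Tendsto tk atTop atTop ∧ Tendsto (fun k => x (tk k)) atTop (𝓝 p)}

/-- The ratio of the vectors from a point `a` to the end points of a path has a logarithm that
depends continuously on `a` off the path. -/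
theorem exists_continuousOn_log_ratio {ζ : ℝ → ℂ} {t₁ t₂ : ℝ} (h12 : t₁ ≤ t₂)
    (hζ : ContinuousOn ζ (Set.Icc t₁ t₂)) {E : Set ℂ} (hE : IsCompact E)
    (hdisj : Disjoint E (ζ '' Set.Icc t₁ t₂)) :
    ∃ Λ : ℂ → ℂ, ContinuousOn Λ E ∧
      ∀ a ∈ E, Complex.exp (Λ a) = (ζ t₂ - a) / (ζ t₁ - a) := by
  have hcl : IsClosed (ζ '' Set.Icc t₁ t₂) := (isCompact_Icc.image_of_continuousOn hζ).isClosed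
  obtain ⟨r, hr0, hr⟩ := Metric.exists_pos_forall_lt_edist hE hcl hdisj
  have hr' : ∀ a ∈ E, ∀ t ∈ Set.Icc t₁ t₂, (r : ℝ) < ‖ζ t - a‖ := by
    intro a ha t ht
    have h := hr a ha _ (Set.mem_image_of_mem ζ ht)
    rw [edist_nndist, ENNReal.coe_lt_coe] at h
    rw [← dist_eq_norm, dist_comm]
    exact_mod_cast h
  have hne : ∀ a ∈ E, ∀ t ∈ Set.Icc t₁ t₂, ζ t - a ≠ 0 := fun a ha t ht h => by
    have := hr' a ha t ht
    rw [h, norm_zero] at this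
    exact absurd r.coe_nonneg (not_le.2 this)
  have huc := isCompact_Icc.uniformContinuousOn_of_continuous hζ
  obtain ⟨δ, hδ0, hδ⟩ := Metric.uniformContinuousOn_iff.1 huc r (by exact_mod_cast hr0)
  obtain ⟨n, hn⟩ := exists_nat_gt ((t₂ - t₁) / δ)
  have hn0 : (0 : ℝ) < n := lt_of_le_of_lt (div_nonneg (by linarith) hδ0.le) hn
  have hstep : (t₂ - t₁) / n < δ := by
    rw [div_lt_iff₀ hδ0] at hn
    rw [div_lt_iff₀ hn0]; linarith
  have hstep0 : 0 ≤ (t₂ - t₁) / n := div_nonneg (by linarith) hn0.le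
  have hmem : ∀ k : ℕ, k ≤ n → t₁ + k * ((t₂ - t₁) / n) ∈ Set.Icc t₁ t₂ := by
    intro k hk
    have hk' : (k : ℝ) ≤ n := by exact_mod_cast hk
    have h1 : (k : ℝ) * ((t₂ - t₁) / n) ≤ n * ((t₂ - t₁) / n) :=
      mul_le_mul_of_nonneg_right hk' hstep0
    have h2 : (n : ℝ) * ((t₂ - t₁) / n) = t₂ - t₁ := by field_simp
    have h3 : 0 ≤ (k : ℝ) * ((t₂ - t₁) / n) := by positivity
    constructor <;> linarith
  have key : ∀ k : ℕ, k ≤ n → ∃ Λ : ℂ → ℂ, ContinuousOn Λ E ∧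
      ∀ a ∈ E, Complex.exp (Λ a) = (ζ (t₁ + k * ((t₂ - t₁) / n)) - a) / (ζ t₁ - a) := by
    intro k
    induction k with
    | zero =>
      intro _
      refine ⟨fun _ => 0, continuousOn_const, fun a ha => ?_⟩
      have := hne a ha t₁ ⟨le_rfl, h12⟩
      simp [this]
    | succ k ih =>
      intro hk
      obtain ⟨Λ, hΛc, hΛ⟩ := ih (by omega)
      have hm0 := hmem k (by omega)
      have hm1 := hmem (k + 1) hk
      set p := t₁ + k * ((t₂ - t₁) / n)
      set q := t₁ + (k + 1 : ℕ) * ((t₂ - t₁) / n)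
      have hqp : q - p = (t₂ - t₁) / n := by simp only [p, q]; push_cast; ring
      have hd : ‖ζ q - ζ p‖ < r := by
        rw [← dist_eq_norm]
        refine hδ q hm1 p hm0 ?_
        rw [Real.dist_eq, hqp, abs_of_nonneg hstep0]
        exact hstep
      have hslit : ∀ a ∈ E, (ζ q - a) / (ζ p - a) ∈ Complex.slitPlane := by
        intro a ha
        have h0 := hne a ha p hm0
        have : (ζ q - a) / (ζ p - a) = 1 + (ζ q - ζ p) / (ζ p - a) := by field_simp; ring
        rw [this]
        apply Complex.mem_slitPlane_of_norm_lt_one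
        rw [norm_div, div_lt_one (norm_pos_iff.2 h0)]
        exact hd.trans (hr' a ha p hm0)
      refine ⟨fun a => Λ a + Complex.log ((ζ q - a) / (ζ p - a)), ?_, ?_⟩
      · refine hΛc.add (ContinuousOn.clog ?_ hslit)
        exact (continuousOn_const.sub continuousOn_id).div
          (continuousOn_const.sub continuousOn_id) (fun a ha => hne a ha p hm0)
      · intro a ha
        have h0 := hne a ha p hm0
        have h1 := hne a ha q hm1
        have h2 := hne a ha t₁ ⟨le_rfl, h12⟩
        rw [Complex.exp_add, hΛ a ha, Complex.exp_log (div_ne_zero h1 h0)]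
        field_simp
  obtain ⟨Λ, h1, h2⟩ := key n le_rfl
  refine ⟨Λ, h1, fun a ha => ?_⟩
  rw [h2 a ha]
  congr 3
  field_simp
  ring

theorem IsPreconnected.eq_of_forall_mem_range_intCast {X : Type*} [TopologicalSpace X] {D : Set X}
    (hD : IsPreconnected D) {f : X → ℝ} (hf : ContinuousOn f D)
    (hint : ∀ a ∈ D, ∃ n : ℤ, f a = n) {a b : X} (ha : a ∈ D) (hb : b ∈ D) : f a = f b := by
  have main : ∀ a ∈ D, ∀ b ∈ D, f a ≤ f b := by
    intro a ha b hb
    by_contra! hlt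
    obtain ⟨n, hn⟩ := hint a ha
    obtain ⟨m, hm⟩ := hint b hb
    have hmn : m + 1 ≤ n := by
      rw [hn, hm] at hlt
      exact_mod_cast hlt
    have hmn' : (m : ℝ) + 1 ≤ n := by exact_mod_cast hmn
    have := hD.intermediate_value hb ha hf
    obtain ⟨c, hc, hc'⟩ := this (show (m : ℝ) + 1 / 2 ∈ Set.Icc (f b) (f a) from
      ⟨by rw [hm]; linarith, by rw [hn]; linarith⟩)
    obtain ⟨k, hk⟩ := hint c hc
    rw [hc'] at hk
    have h2 : (2 * m + 1 : ℤ) = 2 * k := by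
      have : (2 * m + 1 : ℝ) = 2 * k := by linarith
      exact_mod_cast this
    omega
  exact le_antisymm (main a ha b hb) (main b hb a ha)

/-- A connected set cannot reach a point of a real segment from both sides while avoiding the
segment and a path that joins the end points of the segment. -/
theorem false_of_preconnected_both_sides {ζ : ℝ → ℂ} {t₁ t₂ : ℝ} (h12 : t₁ ≤ t₂)
    (hζ : ContinuousOn ζ (Set.Icc t₁ t₂)) {u₁ u₂ u₃ : ℝ} (h1 : ζ t₁ = u₁) (h2 : ζ t₂ = u₂)
    (h3 : u₁ < u₃ ∧ u₃ < u₂ ∨ u₂ < u₃ ∧ u₃ < u₁)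
    {E D : Set ℂ} (hE : IsCompact E) (hdisj : Disjoint E (ζ '' Set.Icc t₁ t₂))
    (hDE : D ⊆ E) (h3E : (u₃ : ℂ) ∈ E) (hD : IsPreconnected D)
    (hseg : ∀ a ∈ D, a.im = 0 → a.re ∉ Set.uIcc u₁ u₂)
    (hpos : ∃ᶠ a in 𝓝[D] (u₃ : ℂ), 0 < a.im) (hneg : ∃ᶠ a in 𝓝[D] (u₃ : ℂ), a.im < 0) :
    False := by
  obtain ⟨Λ, hΛc, hΛ⟩ := exists_continuousOn_log_ratio h12 hζ hE hdisj
  rw [h1, h2] at hΛ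
  set ρ : ℂ → ℂ := fun a => (u₂ - a) / (u₁ - a) with hρ
  have hne1 : ∀ a ∈ E, (u₁ : ℂ) - a ≠ 0 := by
    intro a ha h
    rw [sub_eq_zero] at h
    exact Set.disjoint_left.1 hdisj ha ⟨t₁, ⟨le_rfl, h12⟩, by rw [h1, h]⟩
  have hne2 : ∀ a ∈ E, (u₂ : ℂ) - a ≠ 0 := by
    intro a ha h
    rw [sub_eq_zero] at h
    exact Set.disjoint_left.1 hdisj ha ⟨t₂, ⟨h12, le_rfl⟩, by rw [h2, h]⟩
  have hρc : ContinuousOn ρ E := (continuousOn_const.sub continuousOn_id).div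
          (continuousOn_const.sub continuousOn_id) hne1
  have hslit : ∀ a ∈ D, ρ a ∈ Complex.slitPlane := by
    intro a ha
    by_contra hns
    rw [Complex.mem_slitPlane_iff_not_le_zero, not_not] at hns
    obtain ⟨hre, him⟩ := Complex.le_def.1 hns
    simp only [Complex.zero_re, Complex.zero_im] at hre him
    have hk : (u₂ : ℂ) - a = ρ a * (u₁ - a) := by
      simp only [hρ]; rw [div_mul_cancel₀ _ (hne1 a (hDE ha))]
    have e1 := congrArg Complex.re hk
    have e2 := congrArg Complex.im hk
    simp only [Complex.sub_re, Complex.sub_im, Complex.mul_re, Complex.mul_im,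
      Complex.ofReal_re, Complex.ofReal_im, him] at e1 e2
    have ha0 : a.im = 0 := by
      have : a.im * (1 - (ρ a).re) = 0 := by linarith
      rcases mul_eq_zero.1 this with h | h
      · exact h
      · linarith
    refine hseg a ha ha0 ?_
    rw [Set.mem_uIcc]
    by_contra! hcon
    rcases le_total u₁ u₂ with h | h
    · rcases lt_or_ge a.re u₁ with h' | h'
      · nlinarith
      · have := hcon.1 h'
        nlinarith
    · rcases lt_or_ge a.re u₂ with h' | h'
      · nlinarith
      · have := hcon.2 h'
        nlinarith
  set f : ℂ → ℝ := fun a => (Λ a - Complex.log (ρ a)).im / (2 * Real.pi) with hf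
  have hfc : ContinuousOn f D := by
    refine ContinuousOn.div_const ?_ _
    exact Complex.continuous_im.comp_continuousOn
      ((hΛc.mono hDE).sub ((hρc.mono hDE).clog hslit))
  have hint : ∀ a ∈ D, ∃ n : ℤ, f a = n := by
    intro a ha
    have hρ0 : ρ a ≠ 0 := div_ne_zero (hne2 a (hDE ha)) (hne1 a (hDE ha))
    have : Complex.exp (Λ a - Complex.log (ρ a)) = 1 := by
      rw [Complex.exp_sub, hΛ a (hDE ha), Complex.exp_log hρ0, div_self hρ0]
    obtain ⟨n, hn⟩ := Complex.exp_eq_one_iff.1 this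
    refine ⟨n, ?_⟩
    simp only [hf, hn]
    have hpi := Real.pi_pos
    simp
  have hconst : ∀ a ∈ D, ∀ b ∈ D, f a = f b := fun a ha b hb =>
    hD.eq_of_forall_mem_range_intCast hfc hint ha hb
  have hDne : D.Nonempty := by
    obtain ⟨a, -, ha⟩ := (hpos.and_eventually self_mem_nhdsWithin).exists
    exact ⟨a, ha⟩
  obtain ⟨a₀, ha₀⟩ := hDne
  have hΛt : Tendsto Λ (𝓝[D] (u₃ : ℂ)) (𝓝 (Λ u₃)) := (hΛc _ h3E).mono_left (nhdsWithin_mono _ hDE)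
  have hρt : Tendsto ρ (𝓝[D] (u₃ : ℂ)) (𝓝 (ρ u₃)) := (hρc _ h3E).mono_left (nhdsWithin_mono _ hDE)
  have hρ3 : ρ u₃ = (((u₂ - u₃) / (u₁ - u₃) : ℝ) : ℂ) := by simp [hρ]
  have hρre : (ρ u₃).re < 0 := by
    rw [hρ3, Complex.ofReal_re]
    rcases h3 with h | h
    · exact div_neg_of_pos_of_neg (by linarith) (by linarith)
    · exact div_neg_of_neg_of_pos (by linarith) (by linarith)
  have hρim : (ρ u₃).im = 0 := by rw [hρ3, Complex.ofReal_im]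
  have himρ : ∀ a ∈ D, (ρ a).im * Complex.normSq (u₁ - a) = a.im * (u₂ - u₁) := by
    intro a ha
    have h0 : Complex.normSq (u₁ - a) ≠ 0 := by
      rw [Ne, Complex.normSq_eq_zero]; exact hne1 a (hDE ha)
    simp only [hρ, Complex.div_im]
    field_simp
    simp
    ring
  have hfim : ∀ a ∈ D, (Λ a).im - Complex.arg (ρ a) = 2 * Real.pi * f a₀ := by
    intro a ha
    rw [hconst a₀ ha₀ a ha]
    have hpi := Real.pi_pos
    simp only [hf, Complex.sub_im, Complex.log_im]
    field_simp
  have hP : (∃ᶠ a in 𝓝[D] (u₃ : ℂ), 0 < (ρ a).im) → (Λ u₃).im - Real.pi = 2 * Real.pi * f a₀ := by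
    intro hfr
    let l := 𝓝[D] (u₃ : ℂ) ⊓ 𝓟 {a | 0 < (ρ a).im}
    have : l.NeBot := frequently_mem_iff_neBot.1 hfr
    have hl : ∀ᶠ a in l, 0 < (ρ a).im := mem_inf_of_right (mem_principal_self _)
    have hl' : ∀ᶠ a in l, a ∈ D := mem_inf_of_left self_mem_nhdsWithin
    have t1 : Tendsto (fun a => Complex.arg (ρ a)) l (𝓝 Real.pi) := by
      refine (Complex.tendsto_arg_nhdsWithin_im_nonneg_of_re_neg_of_im_zero hρre hρim).comp ?_
      exact tendsto_nhdsWithin_iff.2 ⟨hρt.mono_left inf_le_left, hl.mono fun a h => h.le⟩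
    have t2 : Tendsto (fun a => (Λ a).im - Complex.arg (ρ a)) l (𝓝 ((Λ u₃).im - Real.pi)) :=
      ((Complex.continuous_im.tendsto _).comp (hΛt.mono_left inf_le_left)).sub t1
    refine tendsto_nhds_unique (t2.congr' ?_) tendsto_const_nhds
    filter_upwards [hl'] with a ha using hfim a ha
  have hN : (∃ᶠ a in 𝓝[D] (u₃ : ℂ), (ρ a).im < 0) → (Λ u₃).im - -Real.pi = 2 * Real.pi * f a₀ := by
    intro hfr
    let l := 𝓝[D] (u₃ : ℂ) ⊓ 𝓟 {a | (ρ a).im < 0}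
    have : l.NeBot := frequently_mem_iff_neBot.1 hfr
    have hl : ∀ᶠ a in l, (ρ a).im < 0 := mem_inf_of_right (mem_principal_self _)
    have hl' : ∀ᶠ a in l, a ∈ D := mem_inf_of_left self_mem_nhdsWithin
    have t1 : Tendsto (fun a => Complex.arg (ρ a)) l (𝓝 (-Real.pi)) := by
      refine (Complex.tendsto_arg_nhdsWithin_im_neg_of_re_neg_of_im_zero hρre hρim).comp ?_
      exact tendsto_nhdsWithin_iff.2 ⟨hρt.mono_left inf_le_left, hl⟩
    have t2 : Tendsto (fun a => (Λ a).im - Complex.arg (ρ a)) l (𝓝 ((Λ u₃).im - -Real.pi)) :=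
      ((Complex.continuous_im.tendsto _).comp (hΛt.mono_left inf_le_left)).sub t1
    refine tendsto_nhds_unique (t2.congr' ?_) tendsto_const_nhds
    filter_upwards [hl'] with a ha using hfim a ha
  have hmemD : ∀ᶠ a in 𝓝[D] (u₃ : ℂ), a ∈ D := self_mem_nhdsWithin
  have hpi := Real.pi_pos
  have hsgn : ∀ a ∈ D, 0 < Complex.normSq (u₁ - a) := fun a ha =>
    Complex.normSq_pos.2 (hne1 a (hDE ha))
  rcases h3 with h | h
  · have e1 := hP ((hpos.and_eventually hmemD).mono fun a ⟨ha, haD⟩ => by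
      have e := himρ a haD
      have := hsgn a haD
      have h5 : 0 < a.im * (u₂ - u₁) := mul_pos ha (by linarith)
      rw [← e] at h5
      exact pos_of_mul_pos_left h5 this.le)
    have e2 := hN ((hneg.and_eventually hmemD).mono fun a ⟨ha, haD⟩ => by
      have e := himρ a haD
      have := hsgn a haD
      have h5 : a.im * (u₂ - u₁) < 0 := mul_neg_of_neg_of_pos ha (by linarith)
      rw [← e] at h5
      by_contra! hcon
      exact absurd (mul_nonneg hcon this.le) (not_le.2 h5))
    linarith
  · have e1 := hP ((hneg.and_eventually hmemD).mono fun a ⟨ha, haD⟩ => by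
      have e := himρ a haD
      have := hsgn a haD
      have h5 : 0 < a.im * (u₂ - u₁) := mul_pos_of_neg_of_neg ha (by linarith)
      rw [← e] at h5
      exact pos_of_mul_pos_left h5 this.le)
    have e2 := hN ((hpos.and_eventually hmemD).mono fun a ⟨ha, haD⟩ => by
      have e := himρ a haD
      have := hsgn a haD
      have h5 : a.im * (u₂ - u₁) < 0 := mul_neg_of_pos_of_neg ha (by linarith)
      rw [← e] at h5
      by_contra! hcon
      exact absurd (mul_nonneg hcon this.le) (not_le.2 h5))
    linarith

/-- Let an injective path meet a real open interval exactly three times, the last two times from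
below. Then the third meeting point does not lie between the first two. -/
theorem third_crossing_not_between {ζ : ℝ → ℂ} {t₁ t₂ t₃ : ℝ} (h12 : t₁ < t₂) (h23 : t₂ < t₃)
    (hζ : ContinuousOn ζ (Set.Icc t₁ t₃)) (hinj : Set.InjOn ζ (Set.Icc t₁ t₃))
    {α β u₁ u₂ u₃ : ℝ} (hu₁ : u₁ ∈ Set.Ioo α β) (hu₂ : u₂ ∈ Set.Ioo α β)
    (h1 : ζ t₁ = u₁) (h2 : ζ t₂ = u₂) (h3 : ζ t₃ = u₃)
    (hcross : ∀ t ∈ Set.Icc t₁ t₃, (ζ t).im = 0 → (ζ t).re ∈ Set.Ioo α β →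
      t = t₁ ∨ t = t₂ ∨ t = t₃)
    (h2l : ∀ᶠ t in 𝓝[<] t₂, (ζ t).im < 0) (h2r : ∀ᶠ t in 𝓝[>] t₂, 0 < (ζ t).im)
    (h3l : ∀ᶠ t in 𝓝[<] t₃, (ζ t).im < 0) :
    ¬ (u₁ < u₃ ∧ u₃ < u₂ ∨ u₂ < u₃ ∧ u₃ < u₁) := by
  intro hbtw
  obtain ⟨lo, hi, hlo, hhi, h3lo, h3hi, h2lo, h2hi, h1J⟩ : ∃ lo hi : ℝ, α < lo ∧ hi < β ∧
      lo < u₃ ∧ u₃ < hi ∧ lo < u₂ ∧ u₂ < hi ∧ u₁ ∉ Set.Icc lo hi := by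
    obtain ⟨a1, b1⟩ := hu₁
    obtain ⟨a2, b2⟩ := hu₂
    rcases hbtw with h | h
    · refine ⟨(u₁ + u₃) / 2, (u₂ + β) / 2, by linarith, by linarith, by linarith, by linarith,
        by linarith, by linarith, fun h' => ?_⟩
      linarith [h'.1]
    · refine ⟨(α + u₂) / 2, (u₃ + u₁) / 2, by linarith, by linarith, by linarith, by linarith,
        by linarith, by linarith, fun h' => ?_⟩
      linarith [h'.2]
  obtain ⟨l, hl1, hl2, hl⟩ : ∃ l, t₁ ≤ l ∧ l < t₂ ∧ ∀ t ∈ Set.Ioo l t₂, (ζ t).im < 0 := by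
    obtain ⟨l, hl, hl'⟩ := (mem_nhdsLT_iff_exists_Ioo_subset' h12).1 h2l
    refine ⟨max l t₁, le_max_right _ _, max_lt hl h12, fun t ht => hl' ⟨?_, ht.2⟩⟩
    exact (le_max_left _ _).trans_lt ht.1
  have hsub : Set.Icc t₁ l ⊆ Set.Icc t₁ t₃ := Set.Icc_subset_Icc le_rfl (by linarith)
  have hK1 : IsCompact (ζ '' Set.Icc t₁ l) := isCompact_Icc.image_of_continuousOn (hζ.mono hsub)
  have hJ : IsCompact ((fun x : ℝ => (x : ℂ)) '' Set.Icc lo hi) :=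
    isCompact_Icc.image Complex.continuous_ofReal
  have hdis : Disjoint ((fun x : ℝ => (x : ℂ)) '' Set.Icc lo hi) (ζ '' Set.Icc t₁ l) := by
    rw [Set.disjoint_left]
    rintro _ ⟨x, hx, rfl⟩ ⟨t, ht, hte⟩
    have e1 : (ζ t).im = 0 := by rw [hte]; simp
    have e2 : (ζ t).re = x := by rw [hte]; simp
    rcases hcross t (hsub ht) e1 (by rw [e2]; exact ⟨by linarith [hx.1], by linarith [hx.2]⟩)
      with h | h | h
    · rw [h, h1, Complex.ofReal_re] at e2
      exact h1J (e2 ▸ hx)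
    · linarith [ht.2]
    · linarith [ht.2]
  obtain ⟨r, hr0, hr⟩ := Metric.exists_pos_forall_lt_edist hJ hK1.isClosed hdis
  have hr0' : (0 : ℝ) < r := by exact_mod_cast hr0
  have hr' : ∀ x ∈ Set.Icc lo hi, ∀ t ∈ Set.Icc t₁ l, (r : ℝ) < dist (x : ℂ) (ζ t) := by
    intro x hx t ht
    have h := hr _ (Set.mem_image_of_mem _ hx) _ (Set.mem_image_of_mem ζ ht)
    rw [edist_nndist, ENNReal.coe_lt_coe] at h
    exact_mod_cast h
  have hcont2 : Tendsto ζ (𝓝[>] t₂) (𝓝 (u₂ : ℂ)) := by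
    have : ContinuousAt ζ t₂ := (hζ t₂ ⟨h12.le, h23.le⟩).continuousAt (Icc_mem_nhds h12 h23)
    rw [← h2]
    exact this.tendsto.mono_left nhdsWithin_le_nhds
  have hre2 : Tendsto (fun t => (ζ t).re) (𝓝[>] t₂) (𝓝 u₂) := by
    simpa [Function.comp_def] using (Complex.continuous_re.tendsto _).comp hcont2
  have him2 : Tendsto (fun t => (ζ t).im) (𝓝[>] t₂) (𝓝 0) := by
    simpa [Function.comp_def] using (Complex.continuous_im.tendsto _).comp hcont2
  obtain ⟨s, hs0, hslo, hshi, hsr, hs2, hs3⟩ : ∃ s, 0 < (ζ s).im ∧ lo < (ζ s).re ∧ (ζ s).re < hi ∧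
      (ζ s).im < r ∧ t₂ < s ∧ s < t₃ := by
    have hev := h2r.and ((hre2.eventually (lt_mem_nhds h2lo)).and
      ((hre2.eventually (gt_mem_nhds h2hi)).and ((him2.eventually (gt_mem_nhds hr0')).and
        (Ioo_mem_nhdsGT h23))))
    obtain ⟨s, a, b, c, d, e⟩ := hev.exists
    exact ⟨s, a, b, c, d, e.1, e.2⟩
  set γ : ℝ → ℂ := fun τ => (1 - τ : ℝ) * ζ s + (τ : ℝ) * (u₃ : ℂ) with hγ
  have hγc : Continuous γ := by fun_prop
  have hγre : ∀ τ, (γ τ).re = (1 - τ) * (ζ s).re + τ * u₃ := by intro τ; simp [hγ]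
  have hγim : ∀ τ, (γ τ).im = (1 - τ) * (ζ s).im := by intro τ; simp [hγ]
  have hγ0 : γ 0 = ζ s := by simp [hγ]
  have hγ1 : γ 1 = u₃ := by simp [hγ]
  have h32 : u₃ ≠ u₂ := by rcases hbtw with h | h <;> [exact h.2.ne; exact h.1.ne']
  have hE : IsCompact (ζ '' Set.Icc s t₃ ∪ γ '' Set.Icc 0 1) :=
    (isCompact_Icc.image_of_continuousOn (hζ.mono (Set.Icc_subset_Icc (by linarith) le_rfl))).union
      (isCompact_Icc.image hγc)
  have hEd : Disjoint (ζ '' Set.Icc s t₃ ∪ γ '' Set.Icc 0 1) (ζ '' Set.Icc t₁ t₂) := by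
    rw [Set.disjoint_left]
    rintro _ (⟨x, hx, rfl⟩ | ⟨τ, hτ, rfl⟩) ⟨t, ht, hte⟩
    · have := hinj ⟨ht.1, by linarith [ht.2]⟩ ⟨by linarith [hx.1], hx.2⟩ hte
      linarith [ht.2, hx.1]
    · rcases le_or_gt t l with htl | htl
      · have hx : (γ τ).re ∈ Set.Icc lo hi := by
          rw [hγre]
          constructor <;> nlinarith [hτ.1, hτ.2]
        have := hr' _ hx t ⟨ht.1, htl⟩
        rw [hte, Complex.dist_eq_re_im] at this
        simp only [Complex.ofReal_re, Complex.ofReal_im, sub_self, zero_sub, hγim] at this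
        have h4 : √(0 ^ 2 + (-((1 - τ) * (ζ s).im)) ^ 2) = (1 - τ) * (ζ s).im := by
          rw [show (0:ℝ) ^ 2 + (-((1 - τ) * (ζ s).im)) ^ 2 = ((1 - τ) * (ζ s).im) ^ 2 by ring]
          exact Real.sqrt_sq (mul_nonneg (by linarith [hτ.2]) hs0.le)
        rw [h4] at this
        nlinarith [hτ.1, hτ.2]
      · rcases ht.2.lt_or_eq with h | h
        · have h5 := hl t ⟨htl, h⟩
          rw [hte, hγim] at h5
          nlinarith [hτ.2]
        · have e1 := congrArg Complex.im hte
          have e2 := congrArg Complex.re hte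
          rw [h, h2, hγim, Complex.ofReal_im] at e1
          rw [h, h2, hγre, Complex.ofReal_re] at e2
          have : 1 - τ = 0 := by
            rcases mul_eq_zero.1 e1.symm with h | h
            · exact h
            · exact absurd h hs0.ne'
          rw [this, show τ = 1 by linarith] at e2
          exact h32 (by linarith)
  have hIoo : Set.uIcc u₁ u₂ ⊆ Set.Ioo α β := by
    intro x hx
    rw [Set.mem_uIcc] at hx
    rcases hx with h | h
    · exact ⟨hu₁.1.trans_le h.1, h.2.trans_lt hu₂.2⟩
    · exact ⟨hu₂.1.trans_le h.1, h.2.trans_lt hu₁.2⟩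
  refine false_of_preconnected_both_sides (D := ζ '' Set.Ico s t₃ ∪ γ '' Set.Ico 0 1) h12.le
    (hζ.mono (Set.Icc_subset_Icc le_rfl h23.le)) h1 h2 hbtw hE hEd ?_ ?_ ?_ ?_ ?_ ?_
  · exact Set.union_subset_union (Set.image_mono Set.Ico_subset_Icc_self)
      (Set.image_mono Set.Ico_subset_Icc_self)
  · exact Or.inl ⟨t₃, ⟨hs3.le, le_rfl⟩, h3⟩
  · refine IsPreconnected.union (ζ s) ⟨s, ⟨le_rfl, hs3⟩, rfl⟩ ⟨0, by simp, hγ0⟩ ?_ ?_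
    · exact isPreconnected_Ico.image _
        (hζ.mono fun x hx => ⟨by linarith [hx.1], hx.2.le⟩)
    · exact isPreconnected_Ico.image _ hγc.continuousOn
  · rintro _ (⟨x, hx, rfl⟩ | ⟨τ, hτ, rfl⟩) him hre
    · rcases hcross x ⟨by linarith [hx.1], hx.2.le⟩ him (hIoo hre) with h | h | h
      · linarith [hx.1]
      · linarith [hx.1]
      · linarith [hx.2]
    · rw [hγim] at him
      have : 0 < (1 - τ) * (ζ s).im := mul_pos (by linarith [hτ.2]) hs0
      linarith
  · have ht : Tendsto γ (𝓝[<] 1) (𝓝[ζ '' Set.Ico s t₃ ∪ γ '' Set.Ico 0 1] (u₃ : ℂ)) := by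
      refine tendsto_nhdsWithin_iff.2 ⟨?_, ?_⟩
      · rw [← hγ1]; exact (hγc.tendsto 1).mono_left nhdsWithin_le_nhds
      · filter_upwards [Ioo_mem_nhdsLT (show (0 : ℝ) < 1 by norm_num)] with τ hτ
        exact Or.inr ⟨τ, ⟨hτ.1.le, hτ.2⟩, rfl⟩
    refine ht.frequently (Eventually.frequently ?_)
    filter_upwards [Ioo_mem_nhdsLT (show (0 : ℝ) < 1 by norm_num)] with τ hτ
    rw [hγim]
    exact mul_pos (by linarith [hτ.2]) hs0
  · have ht : Tendsto ζ (𝓝[<] t₃) (𝓝[ζ '' Set.Ico s t₃ ∪ γ '' Set.Ico 0 1] (u₃ : ℂ)) := by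
      refine tendsto_nhdsWithin_iff.2 ⟨?_, ?_⟩
      · rw [← h3]
        refine (hζ t₃ ⟨by linarith, le_rfl⟩).mono_left ?_
        refine nhdsWithin_le_iff.2 ?_
        filter_upwards [Ioo_mem_nhdsLT (h12.trans h23)] with τ hτ using ⟨hτ.1.le, hτ.2.le⟩
      · filter_upwards [Ioo_mem_nhdsLT hs3] with τ hτ
        exact Or.inl ⟨τ, ⟨hτ.1.le, hτ.2⟩, rfl⟩
    exact ht.frequently h3l.frequently

/-- Three consecutive crossings, from below, of a real interval by an injective path are
monotonically ordered. -/
theorem crossings_monotone {ζ : ℝ → ℂ} {t₁ t₂ t₃ : ℝ} (h12 : t₁ < t₂) (h23 : t₂ < t₃)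
    (hζ : ContinuousOn ζ (Set.Icc t₁ t₃)) (hinj : Set.InjOn ζ (Set.Icc t₁ t₃))
    {α β u₁ u₂ u₃ : ℝ} (hu₁ : u₁ ∈ Set.Ioo α β) (hu₂ : u₂ ∈ Set.Ioo α β) (hu₃ : u₃ ∈ Set.Ioo α β)
    (h1 : ζ t₁ = u₁) (h2 : ζ t₂ = u₂) (h3 : ζ t₃ = u₃)
    (hcross : ∀ t ∈ Set.Icc t₁ t₃, (ζ t).im = 0 → (ζ t).re ∈ Set.Ioo α β →
      t = t₁ ∨ t = t₂ ∨ t = t₃)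
    (h1r : ∀ᶠ t in 𝓝[>] t₁, 0 < (ζ t).im)
    (h2l : ∀ᶠ t in 𝓝[<] t₂, (ζ t).im < 0) (h2r : ∀ᶠ t in 𝓝[>] t₂, 0 < (ζ t).im)
    (h3l : ∀ᶠ t in 𝓝[<] t₃, (ζ t).im < 0) :
    u₁ < u₂ ∧ u₂ < u₃ ∨ u₃ < u₂ ∧ u₂ < u₁ := by
  have m1 : t₁ ∈ Set.Icc t₁ t₃ := ⟨le_rfl, by linarith⟩
  have m2 : t₂ ∈ Set.Icc t₁ t₃ := ⟨h12.le, h23.le⟩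
  have m3 : t₃ ∈ Set.Icc t₁ t₃ := ⟨by linarith, le_rfl⟩
  have n12 : u₁ ≠ u₂ := fun h => h12.ne (hinj m1 m2 (by rw [h1, h2, h]))
  have n23 : u₂ ≠ u₃ := fun h => h23.ne (hinj m2 m3 (by rw [h2, h3, h]))
  have n13 : u₁ ≠ u₃ := fun h => (h12.trans h23).ne (hinj m1 m3 (by rw [h1, h3, h]))
  have A := third_crossing_not_between h12 h23 hζ hinj hu₁ hu₂ h1 h2 h3 hcross h2l h2r h3l
  have hmap : Set.MapsTo (fun t : ℝ => -t) (Set.Icc (-t₃) (-t₁)) (Set.Icc t₁ t₃) :=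
    fun t ht => ⟨by linarith [ht.2], by linarith [ht.1]⟩
  have B := third_crossing_not_between (ζ := fun t => (starRingEnd ℂ) (ζ (-t)))
    (t₁ := -t₃) (t₂ := -t₂) (t₃ := -t₁) (u₁ := u₃) (u₂ := u₂) (u₃ := u₁) (by linarith) (by linarith)
    (Complex.continuous_conj.comp_continuousOn (hζ.comp continuous_neg.continuousOn hmap))
    (fun a ha b hb hab => by
      have := hinj (hmap ha) (hmap hb) (star_injective hab)
      linarith)
    hu₃ hu₂ (by simp [h3]) (by simp [h2]) (by simp [h1])
    (fun t ht him hre => by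
      have := hcross (-t) (hmap ht) (by simpa using him) (by simpa using hre)
      rcases this with h | h | h
      · right; right; linarith
      · right; left; linarith
      · left; linarith)
    (by
      have : Tendsto (fun t : ℝ => -t) (𝓝[<] (-t₂)) (𝓝[>] t₂) := by
        simpa using tendsto_neg_nhdsLT (a := -t₂)
      filter_upwards [this.eventually h2r] with t ht
      simpa using ht)
    (by
      have : Tendsto (fun t : ℝ => -t) (𝓝[>] (-t₂)) (𝓝[<] t₂) := by
        simpa using tendsto_neg_nhdsGT (a := -t₂)
      filter_upwards [this.eventually h2l] with t ht
      simpa using ht)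
    (by
      have : Tendsto (fun t : ℝ => -t) (𝓝[<] (-t₁)) (𝓝[>] t₁) := by
        simpa using tendsto_neg_nhdsLT (a := -t₁)
      filter_upwards [this.eventually h1r] with t ht
      simpa using ht)
  grind

/-- The crossing times of a real interval by an injective curve that always crosses it from below
form a sequence along which the crossing positions converge. -/
theorem exists_crossing_sequence {ζ : ℝ → ℂ} (hζ : ContinuousOn ζ (Set.Ici 0))
    (hinj : Set.InjOn ζ (Set.Ici 0)) {α β κ : ℝ} (hκ : 0 < κ)
    (hsign : ∀ t ≥ 0, (ζ t).im = 0 → (ζ t).re ∈ Set.Ioo α β → ∀ s ≥ 0, |s - t| < κ →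
      (s < t → (ζ s).im < 0) ∧ (t < s → 0 < (ζ s).im))
    (hunb : ∀ N : ℝ, ∃ t > N, 0 ≤ t ∧ (ζ t).im = 0 ∧ (ζ t).re ∈ Set.Ioo α β) :
    ∃ (s : ℕ → ℝ) (u : ℝ), StrictMono s ∧ Tendsto s atTop atTop ∧
      (∀ n, 0 ≤ s n ∧ (ζ (s n)).im = 0 ∧ (ζ (s n)).re ∈ Set.Ioo α β) ∧
      (∀ t ≥ 0, (ζ t).im = 0 → (ζ t).re ∈ Set.Ioo α β → ∃ n, s n = t) ∧
      Tendsto (fun n => (ζ (s n)).re) atTop (𝓝 u) := by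
  set C : Set ℝ := {t | 0 ≤ t ∧ (ζ t).im = 0 ∧ (ζ t).re ∈ Set.Ioo α β} with hC
  have hgap : ∀ t ∈ C, ∀ t' ∈ C, |t' - t| < κ → t' = t := by
    intro t ht t' ht' h
    have := hsign t ht.1 ht.2.1 ht.2.2 t' ht'.1 h
    rcases lt_trichotomy t' t with h' | h' | h'
    · exact absurd ht'.2.1 (this.1 h').ne
    · exact h'
    · exact absurd ht'.2.1 (this.2 h').ne'
  obtain ⟨D, hD⟩ : ∃ D : Set ℕ, D = (fun t : ℝ => ⌊t / κ⌋₊) '' C := ⟨_, rfl⟩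
  have hDinf : D.Infinite := by
    rw [hD]
    rw [Set.infinite_iff_exists_gt]
    intro a
    obtain ⟨t, ht, htC⟩ := hunb (κ * (a + 1))
    refine ⟨_, ⟨t, htC, rfl⟩, ?_⟩
    rw [← Nat.add_one_le_iff, Nat.le_floor_iff (div_nonneg htC.1 hκ.le), le_div_iff₀ hκ]
    push_cast
    linarith
  have hnth : StrictMono (Nat.nth (· ∈ D)) := Nat.nth_strictMono hDinf
  have hrange : Set.range (Nat.nth (· ∈ D)) = D := Nat.range_nth_of_infinite hDinf
  have hDmem : ∀ n, ∃ t ∈ C, ⌊t / κ⌋₊ = Nat.nth (· ∈ D) n := fun n => by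
    have h1 : Nat.nth (· ∈ D) n ∈ D := hrange.subset (Set.mem_range_self n)
    have h2 : ∀ m ∈ D, ∃ t ∈ C, ⌊t / κ⌋₊ = m := by rw [hD]; exact fun m hm => hm
    exact h2 _ h1
  choose s hsC hs using hDmem
  have hmono : StrictMono s := by
    intro m n hmn
    have h1 := hnth hmn
    rw [← hs m, ← hs n] at h1
    by_contra! hcon
    have : ⌊s n / κ⌋₊ ≤ ⌊s m / κ⌋₊ := Nat.floor_le_floor (by gcongr)
    omega
  have htop : Tendsto s atTop atTop := by
    have h0 : ∀ n : ℕ, (n : ℝ) * κ ≤ s n := by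
      intro n
      have h1 : n ≤ ⌊s n / κ⌋₊ := by rw [hs n]; exact hnth.id_le n
      rw [Nat.le_floor_iff (div_nonneg (hsC n).1 hκ.le), le_div_iff₀ hκ] at h1
      exact h1
    exact tendsto_atTop_mono h0 (tendsto_natCast_atTop_atTop.atTop_mul_const hκ)
  have hall : ∀ t ∈ C, ∃ n, s n = t := by
    intro t ht
    obtain ⟨n, hn⟩ : ∃ n, Nat.nth (· ∈ D) n = ⌊t / κ⌋₊ := by
      have : ⌊t / κ⌋₊ ∈ Set.range (Nat.nth (· ∈ D)) := by
        rw [hrange, hD]; exact ⟨t, ht, rfl⟩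
      exact this
    refine ⟨n, hgap t ht _ (hsC n) ?_⟩
    have e := hs n
    rw [hn] at e
    have a1 := Nat.floor_le (div_nonneg (hsC n).1 hκ.le)
    have a2 := Nat.lt_floor_add_one (s n / κ)
    have a3 := Nat.floor_le (div_nonneg ht.1 hκ.le)
    have a4 := Nat.lt_floor_add_one (t / κ)
    rw [e] at a1 a2
    rw [le_div_iff₀ hκ] at a1 a3
    rw [div_lt_iff₀ hκ] at a2 a4
    rw [abs_lt]
    constructor <;> linarith
  have hval : ∀ n, ζ (s n) = ((ζ (s n)).re : ℂ) := fun n =>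
    Complex.ext (by simp) (by simp [(hsC n).2.1])
  have hbtw : ∀ n, (ζ (s n)).re < (ζ (s (n + 1))).re ∧ (ζ (s (n + 1))).re < (ζ (s (n + 2))).re ∨
      (ζ (s (n + 2))).re < (ζ (s (n + 1))).re ∧ (ζ (s (n + 1))).re < (ζ (s n)).re := by
    intro n
    have l1 : s n < s (n + 1) := hmono (by omega)
    have l2 : s (n + 1) < s (n + 2) := hmono (by omega)
    have hsub : Set.Icc (s n) (s (n + 2)) ⊆ Set.Ici 0 := fun t ht => (hsC n).1.trans ht.1
    have hr : ∀ m, ∀ᶠ t in 𝓝[>] (s m), 0 < (ζ t).im := by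
      intro m
      filter_upwards [Ioo_mem_nhdsGT (show s m < s m + κ by linarith)] with t ht
      refine (hsign (s m) (hsC m).1 (hsC m).2.1 (hsC m).2.2 t ((hsC m).1.trans ht.1.le) ?_).2 ht.1
      rw [abs_lt]; constructor <;> linarith [ht.1, ht.2]
    have hl : ∀ m, ∀ᶠ t in 𝓝[<] (s (m + 1)), (ζ t).im < 0 := by
      intro m
      have hm : s m < s (m + 1) := hmono (by omega)
      filter_upwards [Ioo_mem_nhdsLT (show s (m + 1) - κ < s (m + 1) by linarith),
        Ioo_mem_nhdsLT hm] with t ht ht'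
      refine (hsign _ (hsC (m + 1)).1 (hsC (m + 1)).2.1 (hsC (m + 1)).2.2 t
        ((hsC m).1.trans ht'.1.le) ?_).1 ht.2
      rw [abs_lt]; constructor <;> linarith [ht.1, ht.2]
    refine crossings_monotone l1 l2 (hζ.mono hsub) (hinj.mono hsub) (hsC n).2.2 (hsC _).2.2
      (hsC _).2.2 (hval n) (hval _) (hval _) ?_ (hr n) (hl n) (hr (n + 1)) (hl (n + 1))
    intro t ht h1 h2
    obtain ⟨m, rfl⟩ := hall t ⟨hsub ht, h1, h2⟩
    have b1 : n ≤ m := hmono.le_iff_le.1 ht.1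
    have b2 : m ≤ n + 2 := hmono.le_iff_le.1 ht.2
    have : m = n ∨ m = n + 1 ∨ m = n + 2 := by omega
    rcases this with rfl | rfl | rfl <;> simp
  refine ⟨s, ?_⟩
  suffices h : ∃ u, Tendsto (fun n => (ζ (s n)).re) atTop (𝓝 u) by
    obtain ⟨u, hu⟩ := h
    exact ⟨u, hmono, htop, hsC, fun t h1 h2 h3 => hall t ⟨h1, h2, h3⟩, hu⟩
  rcases hbtw 0 with h0 | h0
  · have : Monotone fun n => (ζ (s n)).re := by
      refine monotone_nat_of_le_succ fun n => le_of_lt ?_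
      induction n with
      | zero => exact h0.1
      | succ n ih => rcases hbtw n with h | h <;> linarith [h.1, h.2]
    exact ⟨_, tendsto_atTop_ciSup this ⟨β, by rintro _ ⟨n, rfl⟩; exact (hsC n).2.2.2.le⟩⟩
  · have : Antitone fun n => (ζ (s n)).re := by
      refine antitone_nat_of_succ_le fun n => le_of_lt ?_
      induction n with
      | zero => exact h0.2
      | succ n ih => rcases hbtw n with h | h <;> linarith [h.1, h.2]
    exact ⟨_, tendsto_atTop_ciInf this ⟨α, by rintro _ ⟨n, rfl⟩; exact (hsC n).2.2.1.le⟩⟩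

/-- A family of equi-Lipschitz forward curves in `N` that is stable under time shifts, determined by
the initial points, and closed under pointwise limits along ultrafilters. -/
structure IsCompactSemiflow {E : Type*} [MetricSpace E] (𝒢 : Set (ℝ → E)) (N : Set E) : Prop where
  mem : ∀ g ∈ 𝒢, ∀ t ≥ (0 : ℝ), g t ∈ N
  shift : ∀ g ∈ 𝒢, ∀ a ≥ (0 : ℝ), (fun t => g (a + t)) ∈ 𝒢
  uniq : ∀ g ∈ 𝒢, ∀ h ∈ 𝒢, g 0 = h 0 → ∀ t ≥ (0 : ℝ), g t = h t
  lip : ∃ L : ℝ, ∀ g ∈ 𝒢, ∀ s ≥ (0 : ℝ), ∀ t ≥ (0 : ℝ), dist (g s) (g t) ≤ L * |s - t|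
  lim : ∀ g : ℕ → ℝ → E, (∀ n, g n ∈ 𝒢) → ∀ 𝒰 : Ultrafilter ℕ,
    ∃ h ∈ 𝒢, ∀ t ≥ (0 : ℝ), Tendsto (fun n => g n t) 𝒰 (𝓝 (h t))

/-- A coordinate `χ` on `N` off the poles `P` such that the curves of the family `𝒢` cross the part
of the real axis over `(α, β)` transversally from below, and such that `g` avoids the poles. -/
structure IsCrossSection {E : Type*} [MetricSpace E] (𝒢 : Set (ℝ → E)) (N : Set E)
    (g : ℝ → E) (p : E) (χ : E → ℂ) (P : Set E) (α β κ : ℝ) : Prop where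
  pos : 0 < κ
  cont : ∀ y ∈ N, y ∉ P → ContinuousAt χ y
  inj : Set.InjOn χ (N \ P)
  avoid : ∀ t ≥ (0 : ℝ), g t ∉ P
  notMem : p ∉ P
  im_eq : (χ p).im = 0
  re_mem : (χ p).re ∈ Set.Ioo α β
  embed : ∀ y : ℕ → E, (∀ n, y n ∈ N \ P) → Tendsto (fun n => χ (y n)) atTop (𝓝 (χ p)) →
    Tendsto y atTop (𝓝 p)
  sign : ∀ h ∈ 𝒢, ∀ t ≥ (0 : ℝ), h t ∉ P → (χ (h t)).im = 0 → (χ (h t)).re ∈ Set.Ioo α β →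
    ∀ s ≥ (0 : ℝ), |s - t| < κ → (s < t → (χ (h s)).im < 0) ∧ (t < s → 0 < (χ (h s)).im)
  hit : ∀ q ∈ N, q ∉ P → (χ q).im = 0 → (χ q).re ∈ Set.Ioo α β → ∀ κ' > (0 : ℝ),
    ∃ U ∈ 𝓝 q, ∀ h ∈ 𝒢, ∀ t ≥ κ', h t ∈ U →
      ∃ s ≥ (0 : ℝ), |s - t| ≤ κ' ∧ h s ∉ P ∧ (χ (h s)).im = 0 ∧ (χ (h s)).re ∈ Set.Ioo α β

namespace IsCompactSemiflow

variable {E : Type*} [MetricSpace E] {𝒢 : Set (ℝ → E)} {N : Set E}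

theorem tendsto_ultrafilter (H : IsCompactSemiflow 𝒢 N) {G : ℕ → ℝ → E} (hG : ∀ n, G n ∈ 𝒢)
    {k : ℝ → E} (hk : k ∈ 𝒢) (𝒰 : Ultrafilter ℕ) (h0 : Tendsto (fun n => G n 0) 𝒰 (𝓝 (k 0)))
    {σ : ℕ → ℝ} (hσ : ∀ n, 0 ≤ σ n) {σ₀ : ℝ} (hσ₀ : 0 ≤ σ₀) (hlim : Tendsto σ 𝒰 (𝓝 σ₀)) :
    Tendsto (fun n => G n (σ n)) 𝒰 (𝓝 (k σ₀)) := by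
  obtain ⟨h, hh, hlimh⟩ := H.lim G hG 𝒰
  have e : h 0 = k 0 := tendsto_nhds_unique (hlimh 0 le_rfl) h0
  rw [← H.uniq h hh k hk e σ₀ hσ₀]
  obtain ⟨L, hL⟩ := H.lip
  have h1 : Tendsto (fun n => L * |σ n - σ₀|) 𝒰 (𝓝 0) := by
    have := ((hlim.sub_const σ₀).abs).const_mul L
    simpa using this
  have h2 : Tendsto (fun n => dist (G n σ₀) (G n (σ n))) 𝒰 (𝓝 0) := by
    refine squeeze_zero (fun n => dist_nonneg) (fun n => ?_) h1
    rw [dist_comm]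
    exact hL _ (hG n) _ (hσ n) _ hσ₀
  exact (tendsto_iff_of_dist h2).1 (hlimh σ₀ hσ₀)

theorem tendsto (H : IsCompactSemiflow 𝒢 N) {G : ℕ → ℝ → E} (hG : ∀ n, G n ∈ 𝒢)
    {k : ℝ → E} (hk : k ∈ 𝒢) {l : Filter ℕ} (h0 : Tendsto (fun n => G n 0) l (𝓝 (k 0)))
    {σ : ℝ} (hσ : 0 ≤ σ) : Tendsto (fun n => G n σ) l (𝓝 (k σ)) := by
  rw [tendsto_iff_ultrafilter]
  intro 𝒰 h𝒰
  exact H.tendsto_ultrafilter hG hk 𝒰 (h0.mono_left h𝒰) (fun _ => hσ) hσ tendsto_const_nhds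

theorem continuousOn (H : IsCompactSemiflow 𝒢 N) {g : ℝ → E} (hg : g ∈ 𝒢) :
    ContinuousOn g (Set.Ici 0) := by
  obtain ⟨L, hL⟩ := H.lip
  refine continuousOn_iff_continuous_domRestrict.2 (LipschitzWith.continuous (K := L.toNNReal) ?_)
  refine LipschitzWith.of_dist_le_mul fun s t => (hL g hg s s.2 t t.2).trans ?_
  rw [Subtype.dist_eq, Real.dist_eq]
  exact mul_le_mul_of_nonneg_right (Real.le_coe_toNNReal L) (abs_nonneg _)

theorem exists_hit_near (H : IsCompactSemiflow 𝒢 N) {g₀ : ℝ → E} {p : E} {χ : E → ℂ} {P : Set E}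
    {α β κ : ℝ} (S : IsCrossSection 𝒢 N g₀ p χ P α β κ) {q : E} (hqN : q ∈ N) (hqP : q ∉ P)
    (hq1 : (χ q).im = 0) (hq2 : (χ q).re ∈ Set.Ioo α β) {g : ℝ → E} (hg : g ∈ 𝒢)
    (hrec : ∀ W ∈ 𝓝 q, ∀ b : ℝ, ∃ t > b, g t ∈ W) {W : Set E} (hW : W ∈ 𝓝 q) (b : ℝ) :
    ∃ t > b, 0 ≤ t ∧ g t ∈ W ∧ g t ∉ P ∧ (χ (g t)).im = 0 ∧ (χ (g t)).re ∈ Set.Ioo α β := by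
  obtain ⟨L, hL⟩ := H.lip
  obtain ⟨ε, hε, hεW⟩ := Metric.mem_nhds_iff.1 hW
  set κ' : ℝ := ε / (2 * (|L| + 1)) with hκ'
  have hL0 : 0 < |L| + 1 := by positivity
  have hκ0 : 0 < κ' := by positivity
  obtain ⟨U, hU, hUh⟩ := S.hit q hqN hqP hq1 hq2 κ' hκ0
  obtain ⟨t, htb, htU⟩ := hrec (U ∩ Metric.ball q (ε / 2))
    (inter_mem hU (Metric.ball_mem_nhds q (by positivity))) (max b 0 + κ')
  have ht0 : κ' ≤ t := by linarith [le_max_right b 0]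
  obtain ⟨s, hs0, hst, hs⟩ := hUh g hg t ht0 htU.1
  refine ⟨s, ?_, hs0, hεW ?_, hs⟩
  · have := (abs_le.1 hst).1
    have := le_max_left b 0
    linarith
  · have h1 := hL g hg s hs0 t (hκ0.le.trans ht0)
    have h2 : dist (g t) q < ε / 2 := htU.2
    have h3 : L * |s - t| ≤ (|L| + 1) * κ' :=
      mul_le_mul ((le_abs_self L).trans (by linarith)) hst (abs_nonneg _) hL0.le
    have h4 : (|L| + 1) * κ' = ε / 2 := by rw [hκ']; field_simp
    rw [Metric.mem_ball]
    linarith [dist_triangle (g s) (g t) q]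

/-- A curve of the family either closes up or returns along a sequence of times with bounded gaps
to a point of a periodic curve. -/
theorem exists_periodic_return (H : IsCompactSemiflow 𝒢 N) {g : ℝ → E} (hg : g ∈ 𝒢)
    (hsec : ∀ k ∈ 𝒢, ∃ χ P α β κ, IsCrossSection 𝒢 N g (k 0) χ P α β κ) :
    ∃ k ∈ 𝒢, ∃ T > (0 : ℝ), (∀ t ≥ (0 : ℝ), k (t + T) = k t) ∧ ∃ (s : ℕ → ℝ) (B : ℝ),
      StrictMono s ∧ Tendsto s atTop atTop ∧ (∀ n, 0 ≤ s n) ∧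
      Tendsto (fun n => g (s n)) atTop (𝓝 (k 0)) ∧ ∀ᶠ n in atTop, s (n + 1) ≤ s n + B := by
  by_cases hinj : Set.InjOn g (Set.Ici 0)
  swap
  · simp only [Set.InjOn, not_forall] at hinj
    obtain ⟨a, ha, b, hb, hab, hne⟩ := hinj
    wlog hlt : a < b generalizing a b
    · exact this b hb a ha hab.symm (Ne.symm hne) (lt_of_le_of_ne (not_lt.1 hlt) (Ne.symm hne))
    have hper : ∀ t ≥ (0 : ℝ), g (a + (t + (b - a))) = g (a + t) := by
      intro t ht
      have := H.uniq _ (H.shift g hg b hb) _ (H.shift g hg a ha) (by simpa using hab.symm) t ht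
      rw [← this]
      congr 1; ring
    have hT : 0 < b - a := by linarith
    have ha' : (0 : ℝ) ≤ a := ha
    have hrep : ∀ n : ℕ, g (a + n * (b - a)) = g a := by
      intro n
      induction n with
      | zero => simp
      | succ n ih =>
        rw [← ih, ← hper (n * (b - a)) (by positivity)]
        push_cast
        congr 1; ring
    refine ⟨_, H.shift g hg a ha, b - a, hT, hper, fun n => a + n * (b - a), b - a, ?_, ?_, ?_, ?_,
      ?_⟩
    · intro m n hmn
      have : (m : ℝ) < n := by exact_mod_cast hmn
      simp only
      nlinarith
    · exact tendsto_atTop_add_const_left _ _ (tendsto_natCast_atTop_atTop.atTop_mul_const hT)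
    · intro n; positivity
    · simp [hrep]
    · refine Eventually.of_forall fun n => ?_
      push_cast
      linarith
  set 𝒰 : Ultrafilter ℕ := hyperfilter ℕ
  have h𝒰 : (𝒰 : Filter ℕ) ≤ atTop := Nat.hyperfilter_le_atTop
  obtain ⟨h, hh, hgh⟩ := H.lim (fun n t => g (n + t)) (fun n => H.shift g hg n n.cast_nonneg) 𝒰
  obtain ⟨k, hk, hhk⟩ := H.lim (fun n t => h (n + t)) (fun n => H.shift h hh n n.cast_nonneg) 𝒰
  obtain ⟨χ, P, α, β, κ, S⟩ := hsec k hk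
  have hrec : ∀ (f : ℝ → E) (τ : ℝ) (q : E), Tendsto (fun n : ℕ => f (n + τ)) 𝒰 (𝓝 q) →
      ∀ W ∈ 𝓝 q, ∀ b : ℝ, ∃ t > b, f t ∈ W := by
    intro f τ q hf W hW b
    have h1 : ∀ᶠ n : ℕ in (𝒰 : Filter ℕ), b < n + τ :=
      h𝒰 ((tendsto_atTop_add_const_right _ τ
        (tendsto_natCast_atTop_atTop (R := ℝ))).eventually_gt_atTop b)
    obtain ⟨n, h2, h3⟩ := (h1.and (hf hW)).exists
    exact ⟨_, h2, h3⟩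
  have hhp := hrec h 0 (k 0) (hhk 0 le_rfl)
  have hgq : ∀ τ ≥ (0 : ℝ), ∀ W ∈ 𝓝 (h τ), ∀ b : ℝ, ∃ t > b, g t ∈ W := fun τ hτ =>
    hrec g τ (h τ) (hgh τ hτ)
  have hkN := H.mem k hk 0 le_rfl
  have hhit := fun W hW b =>
    H.exists_hit_near S hkN S.notMem S.im_eq S.re_mem hh hhp (W := W) hW b
  have hζc : ContinuousOn (fun t => χ (g t)) (Set.Ici 0) := fun t ht =>
    (S.cont _ (H.mem g hg t ht) (S.avoid t ht)).comp_continuousWithinAt (H.continuousOn hg t ht)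
  have hζinj : Set.InjOn (fun t => χ (g t)) (Set.Ici 0) := fun a ha b hb hab =>
    hinj ha hb (S.inj ⟨H.mem g hg a ha, S.avoid a ha⟩ ⟨H.mem g hg b hb, S.avoid b hb⟩ hab)
  have hunb : ∀ b : ℝ, ∃ t > b, 0 ≤ t ∧ (χ (g t)).im = 0 ∧ (χ (g t)).re ∈ Set.Ioo α β := by
    intro b
    obtain ⟨τ, -, hτ0, -, hτP, hτ1, hτ2⟩ := hhit Set.univ univ_mem 0
    obtain ⟨t, htb, ht0, -, -, ht1, ht2⟩ := H.exists_hit_near S (H.mem h hh τ hτ0) hτP hτ1 hτ2 hg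
      (hgq τ hτ0) univ_mem b
    exact ⟨t, htb, ht0, ht1, ht2⟩
  obtain ⟨s, u, hsm, hst, hs, hsall, hsu⟩ := exists_crossing_sequence hζc hζinj S.pos
    (fun t ht h1 h2 => S.sign g hg t ht (S.avoid t ht) h1 h2) hunb
  have hval : ∀ τ ≥ (0 : ℝ), h τ ∉ P → (χ (h τ)).im = 0 → (χ (h τ)).re ∈ Set.Ioo α β →
      (χ (h τ)).re = u := by
    intro τ hτ0 hτP hτ1 hτ2
    by_contra hne
    obtain ⟨A, B, hA, hB, hxA, huB, hAB⟩ := t2_separation hne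
    have hcontre : ContinuousAt (fun y => (χ y).re) (h τ) :=
      Complex.continuous_re.continuousAt.comp (S.cont _ (H.mem h hh τ hτ0) hτP)
    obtain ⟨n₀, hn₀⟩ := eventually_atTop.1 (hsu (hB.mem_nhds huB))
    obtain ⟨t, htb, ht0, htW, -, ht1, ht2⟩ := H.exists_hit_near S (H.mem h hh τ hτ0) hτP hτ1 hτ2
      hg (hgq τ hτ0) (hcontre (hA.mem_nhds hxA)) (s n₀)
    obtain ⟨m, rfl⟩ := hsall t ht0 ht1 ht2
    have hm : n₀ ≤ m := (hsm.lt_iff_lt.1 htb).le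
    exact Set.disjoint_left.1 hAB htW (hn₀ m hm)
  have hp : χ (k 0) = (u : ℂ) := by
    refine Complex.ext ?_ (by simpa using S.im_eq)
    rw [Complex.ofReal_re]
    by_contra hne
    have hcontre : ContinuousAt (fun y => (χ y).re) (k 0) :=
      Complex.continuous_re.continuousAt.comp (S.cont _ hkN S.notMem)
    obtain ⟨τ, -, hτ0, hτW, hτP, hτ1, hτ2⟩ := hhit _ (hcontre.eventually_ne hne) 0
    exact hτW (hval τ hτ0 hτP hτ1 hτ2)
  have hq : ∀ τ ≥ (0 : ℝ), h τ ∉ P → (χ (h τ)).im = 0 → (χ (h τ)).re ∈ Set.Ioo α β →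
      h τ = k 0 := by
    intro τ hτ0 hτP hτ1 hτ2
    refine S.inj ⟨H.mem h hh τ hτ0, hτP⟩ ⟨hkN, S.notMem⟩ ?_
    rw [hp]
    exact Complex.ext (by simpa using hval τ hτ0 hτP hτ1 hτ2) (by simpa using hτ1)
  obtain ⟨τ₁, -, h10, -, h1P, h11, h12⟩ := hhit Set.univ univ_mem 0
  obtain ⟨τ₂, h21, h20, -, h2P, h21', h22⟩ := hhit Set.univ univ_mem τ₁
  have e1 := hq τ₁ h10 h1P h11 h12
  have e2 := hq τ₂ h20 h2P h21' h22
  have hT : 0 < τ₂ - τ₁ := by linarith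
  have hper : ∀ t ≥ (0 : ℝ), k (t + (τ₂ - τ₁)) = k t := by
    intro t ht
    have a1 := H.uniq _ (H.shift h hh τ₁ h10) _ hk (by simpa using e1) (t + (τ₂ - τ₁))
      (by linarith)
    have a2 := H.uniq _ (H.shift h hh τ₂ h20) _ hk (by simpa using e2) t ht
    rw [← a1, ← a2]
    congr 1; ring
  have hgs : Tendsto (fun n => g (s n)) atTop (𝓝 (k 0)) := by
    refine S.embed _ (fun n => ⟨H.mem g hg _ (hs n).1, S.avoid _ (hs n).1⟩) ?_
    rw [hp]
    have : Tendsto (fun n => (((χ (g (s n))).re : ℝ) : ℂ)) atTop (𝓝 (u : ℂ)) :=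
      (Complex.continuous_ofReal.tendsto u).comp hsu
    refine this.congr fun n => Complex.ext (by simp) (by simpa using (hs n).2.1.symm)
  refine ⟨k, hk, τ₂ - τ₁, hT, hper, s, 2 * (τ₂ - τ₁), hsm, hst, fun n => (hs n).1, hgs, ?_⟩
  have hgT : Tendsto (fun n => g (s n + (τ₂ - τ₁))) atTop (𝓝 (k 0)) := by
    have := H.tendsto (fun n => H.shift g hg (s n) (hs n).1) hk (l := atTop) (by simpa using hgs)
      hT.le
    have e : k (τ₂ - τ₁) = k 0 := by simpa using hper 0 le_rfl
    rwa [e] at this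
  obtain ⟨U, hU, hUh⟩ := S.hit (k 0) hkN S.notMem S.im_eq S.re_mem ((τ₂ - τ₁) / 2) (by linarith)
  filter_upwards [hgT hU] with n hn
  obtain ⟨t, ht0, htt, -, ht1, ht2⟩ := hUh g hg _ (by linarith [(hs n).1]) hn
  obtain ⟨m, rfl⟩ := hsall t ht0 ht1 ht2
  have hb := abs_le.1 htt
  have hm : n + 1 ≤ m := hsm.lt_iff_lt.1 (by linarith)
  have := hsm.monotone hm
  linarith

/-- The limit points at infinity of an observable along a curve that returns with bounded gaps to a
periodic curve are the values of the observable on the periodic curve. -/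
theorem limitPoints_eq_image (H : IsCompactSemiflow 𝒢 N) {g k : ℝ → E} (hg : g ∈ 𝒢) (hk : k ∈ 𝒢)
    {T : ℝ} (hT : 0 < T) (hper : ∀ t ≥ (0 : ℝ), k (t + T) = k t) {s : ℕ → ℝ} {B : ℝ}
    (hsm : StrictMono s) (hst : Tendsto s atTop atTop) (hs0 : ∀ n, 0 ≤ s n)
    (hgs : Tendsto (fun n => g (s n)) atTop (𝓝 (k 0)))
    (hB : ∀ᶠ n in atTop, s (n + 1) ≤ s n + B) {X : Type*} [TopologicalSpace X] [T2Space X]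
    {f : E → X} (hf : Continuous f) :
    {q | ∃ t : ℕ → ℝ, Tendsto t atTop atTop ∧ Tendsto (fun n => f (g (t n))) atTop (𝓝 q)} =
      (fun t => f (k t)) '' Set.Icc 0 T := by
  apply Set.Subset.antisymm
  · rintro q ⟨t, ht, htq⟩
    have hdec : ∀ᶠ j in atTop, ∃ n : ℕ,
        ∀ N₀, s N₀ ≤ t j → N₀ ≤ n ∧ s n ≤ t j ∧ t j < s (n + 1) := by
      filter_upwards [ht.eventually_ge_atTop (s 0)] with j hj
      obtain ⟨n₁, hn₁⟩ := (hst.eventually_gt_atTop (t j)).exists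
      have hex : ∃ n, t j < s n := ⟨n₁, hn₁⟩
      classical
      have hpos : Nat.find hex ≠ 0 := fun h0 => by
        have := Nat.find_spec hex
        rw [h0] at this
        linarith
      obtain ⟨n, hn⟩ := Nat.exists_eq_succ_of_ne_zero hpos
      refine ⟨n, fun N₀ hN₀ => ⟨?_, ?_, ?_⟩⟩
      · have := Nat.find_spec hex
        rw [hn] at this
        have := hsm.lt_iff_lt.1 (hN₀.trans_lt this)
        omega
      · exact not_lt.1 (Nat.find_min hex (by omega))
      · have := Nat.find_spec hex
        rwa [hn] at this
    have hdec' : ∀ j, ∃ n : ℕ, (∃ n : ℕ, ∀ N₀, s N₀ ≤ t j → N₀ ≤ n ∧ s n ≤ t j ∧ t j < s (n + 1)) →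
        ∀ N₀, s N₀ ≤ t j → N₀ ≤ n ∧ s n ≤ t j ∧ t j < s (n + 1) := by
      intro j
      by_cases h : ∃ n : ℕ, ∀ N₀, s N₀ ≤ t j → N₀ ≤ n ∧ s n ≤ t j ∧ t j < s (n + 1)
      · exact ⟨h.choose, fun _ => h.choose_spec⟩
      · exact ⟨0, fun h' => absurd h' h⟩
    choose n hn using hdec'
    have hnev : ∀ᶠ j in atTop, ∀ N₀, s N₀ ≤ t j → N₀ ≤ n j ∧ s (n j) ≤ t j ∧ t j < s (n j + 1) := by
      filter_upwards [hdec] with j hj using hn j hj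
    have hntop : Tendsto n atTop atTop := by
      rw [tendsto_atTop]
      intro b
      filter_upwards [hnev, ht.eventually_ge_atTop (s b)] with j hj hb using (hj b hb).1
    have hev : ∀ᶠ j in atTop, s (n j) ≤ t j ∧ t j ≤ s (n j) + B := by
      filter_upwards [hnev, ht.eventually_ge_atTop (s 0), hntop.eventually hB] with j hj h0 hb
      have := hj 0 h0
      exact ⟨this.2.1, this.2.2.le.trans hb⟩
    set σ : ℕ → ℝ := fun j => max 0 (min B (t j - s (n j))) with hσ
    have hσev : ∀ᶠ j in atTop, s (n j) + σ j = t j := by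
      filter_upwards [hev] with j hj
      rw [hσ]
      simp only
      rw [min_eq_right (by linarith), max_eq_right (by linarith)]
      ring
    have hσm : ∀ j, σ j ∈ Set.Icc 0 (max 0 B) := fun j =>
      ⟨le_max_left _ _, max_le_max le_rfl (min_le_left _ _)⟩
    set 𝒰 : Ultrafilter ℕ := hyperfilter ℕ
    have h𝒰 : (𝒰 : Filter ℕ) ≤ atTop := Nat.hyperfilter_le_atTop
    obtain ⟨σ₀, hσ₀, hσlim⟩ := isCompact_Icc.ultrafilter_le_nhds (𝒰.map σ)
      (by rw [Ultrafilter.coe_map]; exact tendsto_principal.2 (Eventually.of_forall hσm))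
    have hlim : Tendsto (fun j => g (s (n j) + σ j)) 𝒰 (𝓝 (k σ₀)) :=
      H.tendsto_ultrafilter (G := fun j t => g (s (n j) + t))
        (fun j => H.shift g hg _ (hs0 _)) hk 𝒰
        (by simpa [Function.comp_def] using (hgs.comp hntop).mono_left h𝒰)
          (fun j => (hσm j).1) hσ₀.1 hσlim
    have hlim2 : Tendsto (fun j => f (g (t j))) 𝒰 (𝓝 (f (k σ₀))) := by
      refine ((hf.tendsto _).comp hlim).congr' ?_
      filter_upwards [h𝒰 hσev] with j hj
      simp [hj]
    have hqe : q = f (k σ₀) := tendsto_nhds_unique (htq.mono_left h𝒰) hlim2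
    have hperm : ∀ m : ℕ, ∀ t ≥ (0 : ℝ), k (t + m * T) = k t := by
      intro m t ht
      induction m with
      | zero => simp
      | succ m ih =>
        rw [← ih, ← hper (t + m * T) (by positivity)]
        push_cast
        congr 1; ring
    have hfl := Nat.floor_le (div_nonneg hσ₀.1 hT.le)
    have hfl2 := Nat.lt_floor_add_one (σ₀ / T)
    rw [le_div_iff₀ hT] at hfl
    rw [div_lt_iff₀ hT] at hfl2
    refine ⟨σ₀ - ⌊σ₀ / T⌋₊ * T, ⟨by linarith, by linarith⟩, ?_⟩
    simp only
    rw [hqe, ← hperm ⌊σ₀ / T⌋₊ (σ₀ - ⌊σ₀ / T⌋₊ * T) (by linarith)]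
    congr 2; ring
  · rintro _ ⟨σ, hσ, rfl⟩
    refine ⟨fun n => s n + σ, tendsto_atTop_add_const_right _ _ hst, ?_⟩
    have := H.tendsto (fun n => H.shift g hg (s n) (hs0 n)) hk (l := atTop) (by simpa using hgs)
      hσ.1
    exact (hf.tendsto _).comp this

end IsCompactSemiflow

section LinearODE

variable {n : ℕ}

theorem mulE_apply (A : Matrix (Fin n) (Fin n) ℝ) (y : Vec n) (i : Fin n) :
    mulE A y i = ∑ j, A i j * y j := by
  simp [mulE, Matrix.toLpLin_apply, Matrix.mulVec, dotProduct]

theorem mulE_eq_sum (A : Matrix (Fin n) (Fin n) ℝ) (y : Vec n) :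
    mulE A y = ∑ i, ∑ j, (A i j * y j) • EuclideanSpace.single i (1 : ℝ) := by
  ext k
  simp [mulE_apply, Pi.single_apply]

theorem mulE_sub (A : Matrix (Fin n) (Fin n) ℝ) (y z : Vec n) :
    mulE A (y - z) = mulE A y - mulE A z := map_sub _ _ _

theorem neg_mulE (A : Matrix (Fin n) (Fin n) ℝ) (y : Vec n) : mulE (-A) y = -mulE A y := by
  ext i; simp [mulE_apply]

theorem sub_mulE (A B : Matrix (Fin n) (Fin n) ℝ) (y : Vec n) :
    mulE (A - B) y = mulE A y - mulE B y := by
  ext i; simp [mulE_apply, sub_mul]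

theorem inner_mulE (A : Matrix (Fin n) (Fin n) ℝ) (l y : Vec n) :
    ⟪l, mulE A y⟫ = ⟪mulE Aᵀ l, y⟫ := by
  simp only [PiLp.inner_apply, mulE_apply, RCLike.inner_apply, conj_trivial,
    Matrix.transpose_apply, Finset.sum_mul, Finset.mul_sum]
  rw [Finset.sum_comm]
  refine Finset.sum_congr rfl fun i _ => Finset.sum_congr rfl fun j _ => by ring

theorem continuous_mulE :
    Continuous fun q : Matrix (Fin n) (Fin n) ℝ × Vec n => mulE q.1 q.2 := by
  simp only [mulE_eq_sum]
  fun_prop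

/-- A measurable matrix function bounded by `L` in operator norm. -/
def IsCoef (L : ℝ) (F : ℝ → Matrix (Fin n) (Fin n) ℝ) : Prop :=
  (∀ i j, Measurable fun t => F t i j) ∧ ∀ t y, ‖mulE (F t) y‖ ≤ L * ‖y‖

/-- `x` solves `x' = F x` on `[0, b]` in integral form. -/
def SolvesOn (F : ℝ → Matrix (Fin n) (Fin n) ℝ) (b : ℝ) (x : ℝ → Vec n) : Prop :=
  ContinuousOn x (Set.Icc 0 b) ∧
    ∀ t ∈ Set.Icc 0 b, x t = x 0 + ∫ s in (0 : ℝ)..t, mulE (F s) (x s)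

variable {L : ℝ} {F : ℝ → Matrix (Fin n) (Fin n) ℝ} {b : ℝ} {x : ℝ → Vec n}

theorem IsCoef.intervalIntegrable (hF : IsCoef L F) {a b : ℝ} (hx : ContinuousOn x (Set.uIcc a b)) :
    IntervalIntegrable (fun s => mulE (F s) (x s)) volume a b := by
  rw [intervalIntegrable_iff]
  obtain ⟨R, hR⟩ := isCompact_uIcc.exists_bound_of_continuousOn hx
  have hL : 0 ≤ |L| := abs_nonneg L
  have : IsFiniteMeasure (volume.restrict (Set.uIoc a b)) := ⟨by simp [Set.uIoc]⟩
  refine Integrable.of_bound ?_ (|L| * R) ?_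
  · simp only [mulE_eq_sum]
    refine Finset.aestronglyMeasurable_fun_sum _ fun i _ =>
      Finset.aestronglyMeasurable_fun_sum _ fun j _ => ?_
    refine AEStronglyMeasurable.smul (AEStronglyMeasurable.mul
      (hF.1 i j).aestronglyMeasurable ?_) aestronglyMeasurable_const
    have : ContinuousOn (fun s => x s j) (Set.uIoc a b) :=
      (EuclideanSpace.proj (𝕜 := ℝ) j).continuous.comp_continuousOn
        (hx.mono Set.uIoc_subset_uIcc)
    exact this.aestronglyMeasurable measurableSet_uIoc
  · refine (ae_restrict_iff' measurableSet_uIoc).2 (Eventually.of_forall fun s hs => ?_)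
    refine (hF.2 s (x s)).trans ?_
    refine mul_le_mul (le_abs_self L) (hR s (Set.uIoc_subset_uIcc hs)) (norm_nonneg _) hL

theorem SolvesOn.sub_eq (hx : SolvesOn F b x) (hF : IsCoef L F) {s t : ℝ} (hs : s ∈ Set.Icc 0 b)
    (ht : t ∈ Set.Icc 0 b) : x t - x s = ∫ r in s..t, mulE (F r) (x r) := by
  have h0 : (0 : ℝ) ∈ Set.Icc 0 b := ⟨le_rfl, hs.1.trans hs.2⟩
  have hi : ∀ {u w : ℝ}, u ∈ Set.Icc 0 b → w ∈ Set.Icc 0 b →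
      IntervalIntegrable (fun r => mulE (F r) (x r)) volume u w := fun hu hw =>
    hF.intervalIntegrable (hx.1.mono (Set.uIcc_subset_Icc hu hw))
  rw [hx.2 t ht, hx.2 s hs, ← intervalIntegral.integral_interval_sub_left (hi h0 ht) (hi h0 hs)]
  abel

theorem SolvesOn.norm_sub_le (hx : SolvesOn F b x) (hF : IsCoef L F) (hL : 0 ≤ L) {R : ℝ}
    (hR : ∀ t ∈ Set.Icc 0 b, ‖x t‖ ≤ R) {s t : ℝ} (hs : s ∈ Set.Icc 0 b)
    (ht : t ∈ Set.Icc 0 b) : ‖x t - x s‖ ≤ L * R * |t - s| := by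
  rw [hx.sub_eq hF hs ht]
  refine intervalIntegral.norm_integral_le_of_norm_le_const fun r hr => ?_
  refine (hF.2 r (x r)).trans (mul_le_mul_of_nonneg_left (hR r ?_) hL)
  exact Set.uIcc_subset_Icc hs ht (Set.uIoc_subset_uIcc hr)

theorem lipschitzOnWith_of_norm_sub_le {E : Type*} [NormedAddCommGroup E] {f : ℝ → E}
    {K : ℝ} {S : Set ℝ} (h : ∀ s ∈ S, ∀ t ∈ S, ‖f t - f s‖ ≤ K * |t - s|) :
    LipschitzOnWith K.toNNReal f S := by
  refine LipschitzOnWith.of_dist_le_mul fun s hs t ht => ?_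
  rw [dist_eq_norm, Real.dist_eq]
  exact (h t ht s hs).trans
    (mul_le_mul_of_nonneg_right (Real.le_coe_toNNReal K) (abs_nonneg _))

theorem SolvesOn.ae_hasDerivAt (hx : SolvesOn F b x) (hF : IsCoef L F) :
    ∀ᵐ t, t ∈ Set.Ioo 0 b → HasDerivAt x (mulE (F t) (x t)) t := by
  rcases lt_or_ge b 0 with hb | hb
  · exact Eventually.of_forall fun t ht => absurd (ht.1.trans ht.2) (not_lt.2 hb.le)
  have hi := hF.intervalIntegrable (a := 0) (b := b) (x := x)
      (by rw [Set.uIcc_of_le hb]; exact hx.1)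
  filter_upwards [hi.ae_hasDerivAt_integral] with t ht htb
  have h1 := ht (Set.mem_uIcc.2 (Or.inl ⟨htb.1.le, htb.2.le⟩)) 0 Set.left_mem_uIcc
  refine (h1.const_add (x 0)).congr_of_eventuallyEq ?_
  filter_upwards [Ioo_mem_nhds htb.1 htb.2] with s hs
  exact hx.2 s ⟨hs.1.le, hs.2.le⟩

theorem eq_of_lipschitzOnWith_of_ae_hasDerivAt {E : Type*} [NormedAddCommGroup E] [NormedSpace ℝ E]
    {f g : ℝ → E} {f' : ℝ → E} {b : ℝ} {K K' : NNReal} (hf : LipschitzOnWith K f (Set.Icc 0 b))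
    (hg : LipschitzOnWith K' g (Set.Icc 0 b))
    (hf' : ∀ᵐ t, t ∈ Set.Ioo 0 b → HasDerivAt f (f' t) t)
    (hg' : ∀ᵐ t, t ∈ Set.Ioo 0 b → HasDerivAt g (f' t) t) (h0 : f 0 = g 0) :
    ∀ t ∈ Set.Icc 0 b, f t = g t := by
  intro t ht
  have hb : 0 ≤ b := ht.1.trans ht.2
  have hu : Set.uIcc 0 b = Set.Icc 0 b := Set.uIcc_of_le hb
  have h1 : AbsolutelyContinuousOnInterval (fun t => f t - g t) 0 b :=
    LipschitzOnWith.absolutelyContinuousOnInterval (by rw [hu]; exact hf.sub hg)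
  obtain ⟨C, hC⟩ := h1.const_of_ae_hasDerivAt_zero (by
    have e0 : ∀ᵐ t : ℝ, t ≠ 0 := by simp [ae_iff]
    have e1 : ∀ᵐ t : ℝ, t ≠ b := by simp [ae_iff]
    filter_upwards [hf', hg', e0, e1] with t h1 h2 h3 h4 h5
    rw [hu] at h5
    have hmem : t ∈ Set.Ioo 0 b := ⟨lt_of_le_of_ne h5.1 h3.symm, lt_of_le_of_ne h5.2 h4⟩
    simpa using (h1 hmem).fun_sub (h2 hmem))
  rw [hu] at hC
  have a0 := hC 0 ⟨le_rfl, hb⟩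
  have a1 := hC t ht
  simp only [h0, sub_self] at a0
  rw [← a0] at a1
  exact sub_eq_zero.1 a1

theorem solvesOn_of_ae_hasDerivAt (hF : IsCoef L F) (hL : 0 ≤ L) {K : NNReal}
    (hx : LipschitzOnWith K x (Set.Icc 0 b))
    (hx' : ∀ᵐ t, t ∈ Set.Ioo 0 b → HasDerivAt x (mulE (F t) (x t)) t) : SolvesOn F b x := by
  refine ⟨hx.continuousOn, fun t ht => ?_⟩
  have hb : 0 ≤ b := ht.1.trans ht.2
  obtain ⟨R, hR⟩ := isCompact_Icc.exists_bound_of_continuousOn hx.continuousOn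
  have hii : ∀ {u w : ℝ}, u ∈ Set.Icc 0 b → w ∈ Set.Icc 0 b →
      IntervalIntegrable (fun r => mulE (F r) (x r)) volume u w := fun hu hw =>
    hF.intervalIntegrable (hx.continuousOn.mono (Set.uIcc_subset_Icc hu hw))
  have h0 : (0 : ℝ) ∈ Set.Icc 0 b := ⟨le_rfl, hb⟩
  refine eq_of_lipschitzOnWith_of_ae_hasDerivAt hx
    (g := fun t => x 0 + ∫ s in (0 : ℝ)..t, mulE (F s) (x s)) (K' := (L * R).toNNReal)
    (f' := fun t => mulE (F t) (x t)) ?_ hx' ?_ (by simp) t ht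
  · refine lipschitzOnWith_of_norm_sub_le fun s hs t ht => ?_
    rw [add_sub_add_left_eq_sub, intervalIntegral.integral_interval_sub_left
      (hii h0 ht) (hii h0 hs)]
    refine intervalIntegral.norm_integral_le_of_norm_le_const fun r hr => ?_
    refine (hF.2 r (x r)).trans (mul_le_mul_of_nonneg_left (hR r ?_) hL)
    exact Set.uIcc_subset_Icc hs ht (Set.uIoc_subset_uIcc hr)
  · filter_upwards [(hii h0 ⟨hb, le_rfl⟩).ae_hasDerivAt_integral] with t ht htb
    exact (ht (Set.mem_uIcc.2 (Or.inl ⟨htb.1.le, htb.2.le⟩)) 0 Set.left_mem_uIcc).const_add (x 0)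

/-- The pairing of a solution with a solution of the adjoint equation is constant. -/
theorem SolvesOn.inner_eq (hx : SolvesOn F b x) (hF : IsCoef L F) (hL : 0 ≤ L) {l : ℝ → Vec n}
    (hl : SolvesOn (fun t => -(F t)ᵀ) b l) {L' : ℝ} (hL' : 0 ≤ L')
    (hF' : IsCoef L' fun t => -(F t)ᵀ) {t : ℝ} (ht : t ∈ Set.Icc 0 b) :
    ⟪l t, x t⟫ = ⟪l 0, x 0⟫ := by
  obtain ⟨R, hR⟩ := isCompact_Icc.exists_bound_of_continuousOn hx.1
  obtain ⟨R', hR'⟩ := isCompact_Icc.exists_bound_of_continuousOn hl.1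
  have h0 : (0 : ℝ) ∈ Set.Icc 0 b := ⟨le_rfl, ht.1.trans ht.2⟩
  refine eq_of_lipschitzOnWith_of_ae_hasDerivAt (f := fun t => ⟪l t, x t⟫)
    (g := fun _ => ⟪l 0, x 0⟫) (f' := fun _ => 0) (K := (L' * R' * R + R' * (L * R)).toNNReal)
    (K' := 0) ?_ ((LipschitzWith.const _).lipschitzOnWith) ?_ ?_ rfl t ht
  · refine lipschitzOnWith_of_norm_sub_le fun s hs t ht => ?_
    have e : ⟪l t, x t⟫ - ⟪l s, x s⟫ = ⟪l t - l s, x t⟫ + ⟪l s, x t - x s⟫ := by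
      rw [inner_sub_left, inner_sub_right]; ring
    have hR0 : 0 ≤ R' := (norm_nonneg _).trans (hR' 0 h0)
    have a1 := hl.norm_sub_le hF' hL' hR' hs ht
    have a2 := hx.norm_sub_le hF hL hR hs ht
    rw [e]
    refine (norm_add_le _ _).trans ?_
    have b1 := (norm_inner_le_norm (𝕜 := ℝ) (l t - l s) (x t)).trans
      (mul_le_mul a1 (hR t ht) (norm_nonneg _) ((norm_nonneg _).trans a1))
    have b2 := (norm_inner_le_norm (𝕜 := ℝ) (l s) (x t - x s)).trans
      (mul_le_mul (hR' s hs) a2 (norm_nonneg _) hR0)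
    calc _ ≤ _ := add_le_add b1 b2
      _ = _ := by ring
  · filter_upwards [hx.ae_hasDerivAt hF, hl.ae_hasDerivAt hF'] with t h1 h2 htb
    have := (h2 htb).inner ℝ (h1 htb)
    rw [neg_mulE, inner_neg_left, inner_mulE, add_neg_cancel] at this
    exact this
  · exact Eventually.of_forall fun t _ => hasDerivAt_const _ _

end LinearODE

section LinearODEExistence

open scoped BoundedContinuousFunction

variable {n : ℕ} {L : ℝ} {F : ℝ → Matrix (Fin n) (Fin n) ℝ}

theorem IsCoef.norm_integral_le (hF : IsCoef L F) (hL : 0 ≤ L) {z : ℝ → Vec n}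
    {c : ℝ} (hc : 0 ≤ c) (hb : ∀ s, ‖z s‖ ≤ c * Real.exp ((2 * L + 1) * s)) {t : ℝ} (ht : 0 ≤ t) :
    ‖∫ s in (0 : ℝ)..t, mulE (F s) (z s)‖ ≤ c / 2 * Real.exp ((2 * L + 1) * t) := by
  have hK : 0 < 2 * L + 1 := by linarith
  have hd : ∀ s ∈ Set.uIcc 0 t, HasDerivAt (fun s => c / 2 * Real.exp ((2 * L + 1) * s))
      (c / 2 * (Real.exp ((2 * L + 1) * s) * (2 * L + 1))) s := by
    intro s _
    refine HasDerivAt.const_mul _ ?_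
    simpa using ((hasDerivAt_id s).const_mul (2 * L + 1)).exp
  have hint : IntervalIntegrable
      (fun s => c / 2 * (Real.exp ((2 * L + 1) * s) * (2 * L + 1))) volume 0 t :=
    Continuous.intervalIntegrable (by fun_prop) _ _
  refine (intervalIntegral.norm_integral_le_of_norm_le ht
    (Eventually.of_forall fun s hs => ?_) hint).trans ?_
  · refine (hF.2 s (z s)).trans ((mul_le_mul_of_nonneg_left (hb s) hL).trans ?_)
    have := mul_nonneg hc (Real.exp_pos ((2 * L + 1) * s)).le
    nlinarith
  · rw [intervalIntegral.integral_eq_sub_of_hasDerivAt hd hint]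
    have := mul_nonneg hc (Real.exp_pos ((2 * L + 1) * 0)).le
    linarith

theorem exists_solvesOn (hF : IsCoef L F) (hL : 0 ≤ L) (y₀ : Vec n) :
    ∃ x : ℝ → Vec n, x 0 = y₀ ∧ ∀ b, SolvesOn F b x := by
  set K := 2 * L + 1 with hK
  have hK0 : 0 < K := by linarith
  set X : (ℝ →ᵇ Vec n) → ℝ → Vec n := fun u s => Real.exp (K * s) • u s with hX
  have hXc : ∀ u, Continuous (X u) := fun u => by
    have := u.continuous
    simp only [hX]; fun_prop
  have hXb : ∀ u s, ‖X u s‖ ≤ ‖u‖ * Real.exp (K * s) := fun u s => by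
    simp only [hX]
    rw [norm_smul, Real.norm_eq_abs, abs_of_pos (Real.exp_pos _), mul_comm]
    exact mul_le_mul_of_nonneg_right (u.norm_coe_le_norm s) (Real.exp_pos _).le
  have hXi : ∀ u a b, IntervalIntegrable (fun s => mulE (F s) (X u s)) volume a b := fun u a b =>
    hF.intervalIntegrable (hXc u).continuousOn
  have hXs : ∀ u w s, X (u - w) s = X u s - X w s := fun u w s => by simp [hX, smul_sub]
  set Φ : (ℝ →ᵇ Vec n) → ℝ → Vec n := fun u t =>
    Real.exp (-(K * max t 0)) • (y₀ + ∫ s in (0 : ℝ)..(max t 0), mulE (F s) (X u s)) with hΦ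
  have hΦc : ∀ u, Continuous (Φ u) := fun u => by
    have h1 := intervalIntegral.continuous_primitive (hXi u) 0
    have h2 : Continuous fun t : ℝ => max t 0 := by fun_prop
    have h3 := h1.comp h2
    simp only [Function.comp_def] at h3
    simp only [hΦ]
    exact (show Continuous fun t : ℝ => Real.exp (-(K * max t 0)) by fun_prop).smul
      (continuous_const.add h3)
  have hI : ∀ u t, 0 ≤ t → ‖Real.exp (-(K * t)) • ∫ s in (0 : ℝ)..t, mulE (F s) (X u s)‖ ≤
      ‖u‖ / 2 := fun u t ht => by
    rw [norm_smul, Real.norm_eq_abs, abs_of_pos (Real.exp_pos _)]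
    have h := hF.norm_integral_le hL (norm_nonneg u) (hXb u) ht
    calc _ ≤ Real.exp (-(K * t)) * (‖u‖ / 2 * Real.exp (K * t)) :=
          mul_le_mul_of_nonneg_left h (Real.exp_pos _).le
      _ = ‖u‖ / 2 := by
          rw [Real.exp_neg]
          have := (Real.exp_pos (K * t)).ne'
          field_simp
  have hΦb : ∀ u t, ‖Φ u t‖ ≤ ‖y₀‖ + ‖u‖ / 2 := fun u t => by
    simp only [hΦ, smul_add]
    refine (norm_add_le _ _).trans (add_le_add ?_ (hI u _ (le_max_right _ _)))
    rw [norm_smul, Real.norm_eq_abs, abs_of_pos (Real.exp_pos _)]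
    refine mul_le_of_le_one_left (norm_nonneg _) (Real.exp_le_one_iff.2 ?_)
    have := mul_nonneg hK0.le (le_max_right t 0)
    linarith
  set Ψ : (ℝ →ᵇ Vec n) → (ℝ →ᵇ Vec n) := fun u =>
    BoundedContinuousFunction.ofNormedAddCommGroup (Φ u) (hΦc u) _ (hΦb u) with hΨ
  have hcon : ContractingWith (1 / 2) Ψ := by
    refine ⟨by rw [← NNReal.coe_lt_coe]; norm_num, LipschitzWith.of_dist_le_mul fun u w => ?_⟩
    rw [BoundedContinuousFunction.dist_le (by positivity)]
    intro t
    have e : Ψ u t - Ψ w t = Real.exp (-(K * max t 0)) •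
        ∫ s in (0 : ℝ)..(max t 0), mulE (F s) (X (u - w) s) := by
      simp only [hΨ, BoundedContinuousFunction.coe_ofNormedAddCommGroup, hΦ, hXs, mulE_sub]
      rw [intervalIntegral.integral_sub (hXi u _ _) (hXi w _ _), ← smul_sub]
      congr 1; abel
    rw [dist_eq_norm, e, dist_eq_norm]
    refine (hI (u - w) _ (le_max_right _ _)).trans (le_of_eq ?_)
    push_cast; ring
  obtain ⟨u, hu⟩ : ∃ u, Ψ u = u := ⟨_, hcon.fixedPoint_isFixedPt⟩
  have hsol : ∀ t ≥ (0 : ℝ), X u t = y₀ + ∫ s in (0 : ℝ)..t, mulE (F s) (X u s) := by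
    intro t ht
    have h1 : u t = Φ u t := by
      conv_lhs => rw [← hu]
      rfl
    conv_lhs => simp only [hX]
    rw [h1]
    simp only [hΦ, max_eq_left ht, smul_smul]
    rw [← Real.exp_add, add_neg_cancel, Real.exp_zero, one_smul]
  have h0 : X u 0 = y₀ := by simpa using hsol 0 le_rfl
  exact ⟨X u, h0, fun b => ⟨(hXc u).continuousOn, fun t ht => by rw [h0]; exact hsol t ht.1⟩⟩

end LinearODEExistence

section LimitODE

variable {n : ℕ}

theorem exists_entry_bound {M : Set (Matrix (Fin n) (Fin n) ℝ)} (hM : IsCompact M) :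
    ∃ C : ℝ, 0 ≤ C ∧ ∀ A ∈ M, ∀ i j, |A i j| ≤ C := by
  have h : ∀ i j, ∃ C : ℝ, ∀ A ∈ M, |A i j| ≤ C := fun i j =>
    hM.exists_bound_of_continuousOn (f := fun A : Matrix (Fin n) (Fin n) ℝ => A i j)
      (by fun_prop)
  choose C hC using h
  refine ⟨∑ i, ∑ j, |C i j|, Finset.sum_nonneg fun i _ => Finset.sum_nonneg fun j _ =>
    abs_nonneg _, fun A hA i j => (hC i j A hA).trans ((le_abs_self _).trans ?_)⟩
  refine (Finset.single_le_sum (f := fun j => |C i j|) (fun j _ => abs_nonneg _)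
    (Finset.mem_univ j)).trans ?_
  exact Finset.single_le_sum (f := fun i => ∑ j, |C i j|)
    (fun i _ => Finset.sum_nonneg fun j _ => abs_nonneg _) (Finset.mem_univ i)

theorem exists_norm_mulE_le {M : Set (Matrix (Fin n) (Fin n) ℝ)} (hM : IsCompact M) :
    ∃ L : ℝ, 0 ≤ L ∧ ∀ A ∈ M, ∀ y, ‖mulE A y‖ ≤ L * ‖y‖ ∧ ‖mulE (-Aᵀ) y‖ ≤ L * ‖y‖ := by
  obtain ⟨C, hC0, hC⟩ := exists_entry_bound hM
  have key : ∀ A : Matrix (Fin n) (Fin n) ℝ, (∀ i j, |A i j| ≤ C) → ∀ y : Vec n,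
      ‖mulE A y‖ ≤ (n * (n * C)) * ‖y‖ := by
    intro A hA y
    rw [mulE_eq_sum]
    have h : ∀ i j, ‖(A i j * y j) • EuclideanSpace.single i (1 : ℝ)‖ ≤ C * ‖y‖ := fun i j => by
      rw [norm_smul, PiLp.norm_single, norm_one, mul_one, norm_mul]
      exact mul_le_mul (hA i j) (PiLp.norm_apply_le y j) (norm_nonneg _) hC0
    calc _ ≤ ∑ i : Fin n, ∑ j : Fin n, C * ‖y‖ :=
          (norm_sum_le _ _).trans (Finset.sum_le_sum fun i _ => (norm_sum_le _ _).trans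
            (Finset.sum_le_sum fun j _ => h i j))
      _ = _ := by simp; ring
  refine ⟨n * (n * C), by positivity, fun A hA y => ⟨key A (hC A hA) y, key _ (fun i j => ?_) y⟩⟩
  simpa using hC A hA j i

theorem mulE_integral {F : ℝ → Matrix (Fin n) (Fin n) ℝ} {s t : ℝ}
    (hF : ∀ i j, IntervalIntegrable (fun r => F r i j) volume s t) (y : Vec n) :
    mulE (Matrix.of fun i j => ∫ r in s..t, F r i j) y = ∫ r in s..t, mulE (F r) y := by
  simp only [mulE_eq_sum]
  have h1 : ∀ i j, IntervalIntegrable (fun r => (F r i j * y j) • EuclideanSpace.single i (1 : ℝ))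
      volume s t := fun i j => by
    have := (hF i j).mul_const (y j)
    exact ⟨Integrable.smul_const this.1 _, Integrable.smul_const this.2 _⟩
  have h2 : ∀ i, IntervalIntegrable
      (fun r => ∑ j, (F r i j * y j) • EuclideanSpace.single i (1 : ℝ)) volume s t := fun i => by
    have := IntervalIntegrable.sum Finset.univ
      (f := fun j r => (F r i j * y j) • EuclideanSpace.single i (1 : ℝ)) fun j _ => h1 i j
    simpa [Finset.sum_fn] using this
  rw [intervalIntegral.integral_finsetSum fun i _ => h2 i]
  refine Finset.sum_congr rfl fun i _ => ?_
  rw [intervalIntegral.integral_finsetSum fun j _ => h1 i j]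
  refine Finset.sum_congr rfl fun j _ => ?_
  rw [intervalIntegral.integral_smul_const, intervalIntegral.integral_mul_const, Matrix.of_apply]

theorem intervalIntegrable_entry {f : ℝ → ℝ} (hf : Measurable f) {C : ℝ} (hC : ∀ t, |f t| ≤ C)
    (a b : ℝ) : IntervalIntegrable f volume a b := by
  rw [intervalIntegrable_iff]
  have : IsFiniteMeasure (volume.restrict (Set.uIoc a b)) := ⟨by simp [Set.uIoc]⟩
  exact Integrable.of_bound hf.aestronglyMeasurable C (Eventually.of_forall hC)

/-- Measurable selections of a compact convex set have weak limits along ultrafilters. -/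
theorem exists_limit_coef {M : Set (Matrix (Fin n) (Fin n) ℝ)} (hne : M.Nonempty)
    (hM : IsCompact M) (hconv : Convex ℝ M) {A : ℕ → ℝ → Matrix (Fin n) (Fin n) ℝ}
    (hmeas : ∀ k i j, Measurable fun t => A k t i j) (hmem : ∀ k t, A k t ∈ M)
    (𝒰 : Ultrafilter ℕ) :
    ∃ B G : ℝ → Matrix (Fin n) (Fin n) ℝ, (∀ i j, Measurable fun t => B t i j) ∧
      (∀ t, B t ∈ M) ∧
      (∀ t i j, Tendsto (fun k => ∫ s in (0 : ℝ)..t, A k s i j) 𝒰 (𝓝 (G t i j))) ∧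
      ∀ᵐ t, ∀ i j, HasDerivAt (fun s => G s i j) (B t i j) t := by
  obtain ⟨C, hC0, hC⟩ := exists_entry_bound hM
  have hC' : ∀ k t i j, |A k t i j| ≤ C := fun k t => hC _ (hmem k t)
  have hint : ∀ k i j a b, IntervalIntegrable (fun s => A k s i j) volume a b := fun k i j a b =>
    intervalIntegrable_entry (hmeas k i j) (fun t => hC' k t i j) a b
  have hnorm : ∀ k i j a b, ‖∫ s in a..b, A k s i j‖ ≤ C * |b - a| := fun k i j a b =>
    intervalIntegral.norm_integral_le_of_norm_le_const fun s _ => hC' k s i j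
  have hex : ∀ t i j, ∃ g, Tendsto (fun k => ∫ s in (0 : ℝ)..t, A k s i j) 𝒰 (𝓝 g) := by
    intro t i j
    obtain ⟨g, -, hg⟩ := (isCompact_closedBall (0 : ℝ) (C * |t - 0|)).ultrafilter_le_nhds
      (𝒰.map fun k => ∫ s in (0 : ℝ)..t, A k s i j) (by
        rw [Ultrafilter.coe_map]
        refine tendsto_principal.2 (Eventually.of_forall fun k => ?_)
        rw [mem_closedBall_zero_iff]
        exact hnorm k i j 0 t)
    exact ⟨g, hg⟩
  choose G hG using hex
  have hGd : ∀ s t i j, Tendsto (fun k => ∫ r in s..t, A k r i j) 𝒰 (𝓝 (G t i j - G s i j)) := by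
    intro s t i j
    refine ((hG t i j).sub (hG s i j)).congr fun k => ?_
    rw [intervalIntegral.integral_interval_sub_left (hint _ _ _ _ _) (hint _ _ _ _ _)]
  have hlip : ∀ i j, LipschitzWith C.toNNReal fun t => G t i j := by
    intro i j
    rw [← lipschitzOnWith_univ]
    refine lipschitzOnWith_of_norm_sub_le fun s _ t _ => ?_
    exact le_of_tendsto (hGd s t i j).norm (Eventually.of_forall fun k => hnorm k i j s t)
  have hdiff : ∀ᵐ t, ∀ i j, DifferentiableAt ℝ (fun s => G s i j) t :=
    ae_all_iff.2 fun i => ae_all_iff.2 fun j => (hlip i j).ae_differentiableAt_real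
  set B₀ : ℝ → Fin n → Fin n → ℝ := fun t i j => deriv (fun s => G s i j) t with hB₀
  have hB₀m : Measurable B₀ := measurable_pi_iff.2 fun i => measurable_pi_iff.2 fun j =>
    measurable_deriv _
  obtain ⟨M', hM'⟩ : ∃ M' : Set (Fin n → Fin n → ℝ), M' = M := ⟨M, rfl⟩
  have hM'cl : IsClosed M' := by rw [hM']; exact IsCompact.isClosed (X := Fin n → Fin n → ℝ) hM
  have hM'cv : Convex ℝ M' := by rw [hM']; exact hconv
  have hAM' : ∀ k t, (A k t : Fin n → Fin n → ℝ) ∈ M' := by rw [hM']; exact hmem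
  have hquot : ∀ t, ∀ h > (0 : ℝ), (fun i j => h⁻¹ * (G (t + h) i j - G t i j)) ∈ M' := by
    intro t h hh
    set Af : ℕ → ℝ → Fin n → Fin n → ℝ := fun k s => A k s with hAf
    have hAfi : ∀ k, IntegrableOn (Af k) (Set.Ioc t (t + h)) volume := fun k => by
      refine Integrable.of_eval fun i => Integrable.of_eval fun j => ?_
      have := hint k i j t (t + h)
      rwa [intervalIntegrable_iff, Set.uIoc_of_le (by linarith)] at this
    have hav : ∀ k, (⨍ s in Set.Ioc t (t + h), Af k s) ∈ M' := fun k =>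
      hM'cv.set_average_mem hM'cl (by simp [hh]) (by simp)
        (Eventually.of_forall fun s => hAM' k s) (hAfi k)
    refine hM'cl.mem_of_tendsto (b := (𝒰 : Filter ℕ))
      (tendsto_pi_nhds.2 fun i => tendsto_pi_nhds.2 fun j => ?_)
      (Eventually.of_forall hav)
    refine ((hGd t (t + h) i j).const_mul h⁻¹).congr fun k => ?_
    rw [setAverage_eq, Pi.smul_apply, Pi.smul_apply, eval_integral fun i => (hAfi k).eval i,
      eval_integral fun j => ((hAfi k).eval i).eval j,
        intervalIntegral.integral_of_le (by linarith)]
    simp [hAf, hh.le]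
  have hBmem : ∀ᵐ t, B₀ t ∈ M' := by
    filter_upwards [hdiff] with t ht
    have hseq : Tendsto (fun m : ℕ => t + 1 / ((m : ℝ) + 1)) atTop (𝓝[≠] t) := by
      refine tendsto_nhdsWithin_iff.2 ⟨?_, Eventually.of_forall fun m => ?_⟩
      · simpa using tendsto_one_div_add_atTop_nhds_zero_nat.const_add t
      · have : (0 : ℝ) < 1 / ((m : ℝ) + 1) := by positivity
        simp only [Set.mem_compl_iff, Set.mem_singleton_iff]
        linarith
    refine hM'cl.mem_of_tendsto (f := fun m : ℕ => fun i j => (1 / ((m : ℝ) + 1))⁻¹ *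
      (G (t + 1 / ((m : ℝ) + 1)) i j - G t i j)) (b := atTop)
      (tendsto_pi_nhds.2 fun i => tendsto_pi_nhds.2 fun j => ?_)
      (Eventually.of_forall fun m => hquot t _ (by positivity))
    have := (hasDerivAt_iff_tendsto_slope.1 (ht i j).hasDerivAt).comp hseq
    refine this.congr fun m => ?_
    simp [slope_def_field, div_eq_inv_mul]
  obtain ⟨A₀, hA₀⟩ := hne
  obtain ⟨A₁, hA₁⟩ : ∃ A₁ : Fin n → Fin n → ℝ, A₁ ∈ M' := ⟨A₀, by rw [hM']; exact hA₀⟩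
  classical
  obtain ⟨B, hBm, hB1, hB2⟩ : ∃ B : ℝ → Fin n → Fin n → ℝ, (∀ i j, Measurable fun t => B t i j) ∧
      (∀ t, B t ∈ M') ∧ ∀ t, B₀ t ∈ M' → B t = B₀ t := by
    refine ⟨fun t => if B₀ t ∈ M' then B₀ t else A₁, fun i j => ?_, fun t => ?_,
      fun t h => if_pos h⟩
    · have : Measurable fun t => if B₀ t ∈ M' then B₀ t else A₁ :=
        Measurable.ite (hB₀m hM'cl.measurableSet) hB₀m measurable_const
      exact (measurable_pi_iff.1 (measurable_pi_iff.1 this i)) j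
    · dsimp only
      split_ifs with h
      · exact h
      · exact hA₁
  refine ⟨B, G, hBm, fun t => ?_, hG, ?_⟩
  · have := hB1 t
    rw [hM'] at this
    exact this
  · filter_upwards [hdiff, hBmem] with t h1 h2 i j
    rw [hB2 t h2]
    exact (h1 i j).hasDerivAt

/-- Limits along ultrafilters of solutions solve the limit equation. -/
theorem solvesOn_limit {F : ℕ → ℝ → Matrix (Fin n) (Fin n) ℝ} {L R C : ℝ} (hL : 0 ≤ L)
    (hF : ∀ k, IsCoef L (F k)) (hC : ∀ k t i j, |F k t i j| ≤ C)
    {F₀ G : ℝ → Matrix (Fin n) (Fin n) ℝ} (hF₀ : IsCoef L F₀) {𝒰 : Ultrafilter ℕ}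
    (hG : ∀ t i j, Tendsto (fun k => ∫ s in (0 : ℝ)..t, F k s i j) 𝒰 (𝓝 (G t i j)))
    (hG' : ∀ᵐ t, ∀ i j, HasDerivAt (fun s => G s i j) (F₀ t i j) t)
    {x : ℕ → ℝ → Vec n} {x₀ : ℝ → Vec n} {b : ℝ}
    (hx : ∀ᶠ k in (𝒰 : Filter ℕ), SolvesOn (F k) b (x k) ∧ ∀ t ∈ Set.Icc 0 b, ‖x k t‖ ≤ R)
    (hlim : ∀ t ∈ Set.Icc 0 b, Tendsto (fun k => x k t) 𝒰 (𝓝 (x₀ t))) : SolvesOn F₀ b x₀ := by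
  have hint : ∀ k i j a b, IntervalIntegrable (fun s => F k s i j) volume a b := fun k i j a b =>
    intervalIntegrable_entry ((hF k).1 i j) (fun t => hC k t i j) a b
  have hlip : ∀ s ∈ Set.Icc 0 b, ∀ t ∈ Set.Icc 0 b, ‖x₀ t - x₀ s‖ ≤ L * R * |t - s| := by
    intro s hs t ht
    refine le_of_tendsto ((hlim t ht).sub (hlim s hs)).norm ?_
    filter_upwards [hx] with k hk using hk.1.norm_sub_le (hF k) hL hk.2 hs ht
  have hquad : ∀ s ∈ Set.Icc 0 b, ∀ t ∈ Set.Icc 0 b,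
      ‖x₀ s - x₀ t - mulE (G s - G t) (x₀ t)‖ ≤ L * (L * R) * |s - t| ^ 2 := by
    intro s hs t ht
    have hmat : Tendsto (fun k => (Matrix.of fun i j => ∫ r in t..s, F k r i j :
        Matrix (Fin n) (Fin n) ℝ)) 𝒰 (𝓝 (G s - G t)) := by
      refine tendsto_pi_nhds.2 fun i => tendsto_pi_nhds.2 fun j => ?_
      refine ((hG s i j).sub (hG t i j)).congr fun k => ?_
      rw [intervalIntegral.integral_interval_sub_left (hint _ _ _ _ _) (hint _ _ _ _ _)]
      rfl
    have hm := (continuous_mulE.tendsto (G s - G t, x₀ t)).comp (hmat.prodMk_nhds (hlim t ht))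
    refine le_of_tendsto (((hlim s hs).sub (hlim t ht)).sub hm).norm ?_
    filter_upwards [hx] with k hk
    have hsub := Set.uIcc_subset_Icc ht hs
    simp only [Function.comp_def]
    rw [mulE_integral fun i j => hint k i j t s, hk.1.sub_eq (hF k) ht hs,
      ← intervalIntegral.integral_sub ((hF k).intervalIntegrable (hk.1.1.mono hsub))
        ((hF k).intervalIntegrable continuousOn_const)]
    have : L * (L * R) * |s - t| ^ 2 = L * (L * R * |s - t|) * |s - t| := by ring
    rw [this]
    refine intervalIntegral.norm_integral_le_of_norm_le_const fun r hr => ?_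
    have hr' := Set.uIoc_subset_uIcc hr
    rw [← mulE_sub]
    refine ((hF k).2 r _).trans (mul_le_mul_of_nonneg_left ?_ hL)
    have hR : 0 ≤ L * R := mul_nonneg hL ((norm_nonneg _).trans (hk.2 t ht))
    refine (hk.1.norm_sub_le (hF k) hL hk.2 ht (hsub hr')).trans
      (mul_le_mul_of_nonneg_left ?_ hR)
    exact Set.abs_sub_left_of_mem_uIcc hr'
  refine solvesOn_of_ae_hasDerivAt hF₀ hL (lipschitzOnWith_of_norm_sub_le hlip) ?_
  filter_upwards [hG'] with t ht htb
  have htI : t ∈ Set.Icc 0 b := ⟨htb.1.le, htb.2.le⟩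
  have h1 : HasDerivAt (fun s => mulE (G s) (x₀ t)) (mulE (F₀ t) (x₀ t)) t := by
    simp only [mulE_eq_sum]
    refine HasDerivAt.fun_sum fun i _ => HasDerivAt.fun_sum fun j _ => ?_
    exact ((ht i j).mul_const _).smul_const _
  have h2 : HasDerivAt (fun s => x₀ s - mulE (G s) (x₀ t)) 0 t := by
    rw [hasDerivAt_iff_isLittleO]
    refine Asymptotics.IsBigO.trans_isLittleO (g := fun s => ‖s - t‖ ^ 2) ?_
      (Asymptotics.isLittleO_pow_sub_sub t one_lt_two)
    refine Asymptotics.IsBigO.of_bound (L * (L * R)) ?_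
    filter_upwards [Ioo_mem_nhds htb.1 htb.2] with s hs
    have := hquad s ⟨hs.1.le, hs.2.le⟩ t htI
    rw [sub_mulE] at this
    rw [smul_zero, sub_zero, norm_pow, norm_norm, Real.norm_eq_abs]
    refine le_trans (le_of_eq ?_) this
    congr 1; abel
  have := h2.add h1
  simp only [zero_add] at this
  refine this.congr_of_eventuallyEq (Eventually.of_forall fun s => ?_)
  simp

end LimitODE

section NormFacts

variable {n : ℕ} {v : Vec n → ℝ}

theorem IsNorm.nonneg (hv : IsNorm v) (x : Vec n) : 0 ≤ v x := by
  have h1 := hv.2.2 x (-x)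
  have h2 : v (-x) = v x := by simpa using hv.2.1 (-1) x
  rw [add_neg_cancel, (hv.1 0).2 rfl, h2] at h1
  linarith

theorem IsNorm.pos (hv : IsNorm v) {x : Vec n} (hx : x ≠ 0) : 0 < v x :=
  lt_of_le_of_ne (hv.nonneg x) fun h => hx ((hv.1 x).1 h.symm)

theorem IsNorm.exists_le (hv : IsNorm v) : ∃ C : ℝ, 0 ≤ C ∧ ∀ x, v x ≤ C * ‖x‖ := by
  refine ⟨∑ i, v (EuclideanSpace.single i 1), Finset.sum_nonneg fun i _ => hv.nonneg _,
    fun x => ?_⟩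
  have hsum : ∀ s : Finset (Fin n), v (∑ i ∈ s, x i • EuclideanSpace.single i (1 : ℝ)) ≤
      ∑ i ∈ s, v (EuclideanSpace.single i 1) * ‖x‖ := by
    intro s
    induction s using Finset.induction_on with
    | empty => simp [(hv.1 0).2 rfl]
    | insert i s hi ih =>
      rw [Finset.sum_insert hi, Finset.sum_insert hi]
      refine (hv.2.2 _ _).trans (add_le_add ?_ ih)
      rw [hv.2.1, mul_comm]
      exact mul_le_mul_of_nonneg_left (PiLp.norm_apply_le x i) (hv.nonneg _)
  have e : x = ∑ i, x i • EuclideanSpace.single i (1 : ℝ) := by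
    ext k
    simp [Pi.single_apply]
  rw [Finset.sum_mul]
  conv_lhs => rw [e]
  exact hsum _

theorem IsNorm.continuous (hv : IsNorm v) : Continuous v := by
  obtain ⟨C, hC0, hC⟩ := hv.exists_le
  refine LipschitzWith.continuous (K := C.toNNReal) (LipschitzWith.of_le_add_mul _ fun x y => ?_)
  have h1 := hv.2.2 y (x - y)
  rw [add_sub_cancel] at h1
  rw [Real.coe_toNNReal _ hC0, dist_eq_norm]
  linarith [hC (x - y)]

theorem IsNorm.exists_ge (hv : IsNorm v) : ∃ C : ℝ, ∀ x, ‖x‖ ≤ C * v x := by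
  rcases subsingleton_or_nontrivial (Vec n) with h | h
  · exact ⟨0, fun x => by simp [Subsingleton.elim x 0]⟩
  obtain ⟨z, hz, hmin⟩ := (isCompact_sphere (0 : Vec n) 1).exists_isMinOn
    (NormedSpace.sphere_nonempty.2 zero_le_one) hv.continuous.continuousOn
  have hz0 : z ≠ 0 := fun h => by simp [h] at hz
  have hvz := hv.pos hz0
  refine ⟨(v z)⁻¹, fun x => ?_⟩
  rcases eq_or_ne x 0 with rfl | hx
  · simp [(hv.1 0).2 rfl]
  have hx' : 0 < ‖x‖ := norm_pos_iff.2 hx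
  have h1 : v z ≤ v (‖x‖⁻¹ • x) := hmin (by simp [norm_smul, hx'.ne'])
  rw [hv.2.1, abs_of_pos (inv_pos.2 hx')] at h1
  rw [inv_mul_eq_div, le_div_iff₀ hvz]
  rw [inv_mul_eq_div, le_div_iff₀ hx'] at h1
  linarith

theorem IsNorm.subdiff_nonempty (hv : IsNorm v) (x : Vec n) : (subdiff v x).Nonempty := by
  rcases eq_or_ne x 0 with rfl | hx
  · exact ⟨0, by simp [(hv.1 0).2 rfl], fun y => by simpa using hv.nonneg y⟩
  obtain ⟨g, hg1, hg2⟩ := exists_extension_of_le_sublinear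
    (LinearPMap.mkSpanSingleton (K := ℝ) x (v x) hx) v
    (fun c hc y => by rw [hv.2.1, abs_of_pos hc]) hv.2.2 (by
      rintro ⟨y, hy⟩
      obtain ⟨c, rfl⟩ := Submodule.mem_span_singleton.1 hy
      rw [LinearPMap.mkSpanSingleton'_apply, hv.2.1, RingHom.id_apply, smul_eq_mul]
      exact mul_le_mul_of_nonneg_right (le_abs_self c) (hv.nonneg x))
  have e : ∀ y, ⟪(InnerProductSpace.toDual ℝ (Vec n)).symm (LinearMap.toContinuousLinearMap g), y⟫
      = g y := fun y => by simp
  refine ⟨_, (e x).trans ?_, fun y => (e y).trans_le (hg2 y)⟩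
  have := hg1 ⟨x, Submodule.mem_span_singleton_self x⟩
  rw [this]
  exact LinearPMap.mkSpanSingleton_apply ℝ ℝ hx (v x)

/-- Unit vectors of `v` together with their subgradients. -/
def unitPairs (v : Vec n → ℝ) : Set (Vec n × Vec n) := {q | v q.1 = 1 ∧ q.2 ∈ subdiff v q.1}

theorem IsNorm.isCompact_unitPairs (hv : IsNorm v) : IsCompact (unitPairs v) := by
  obtain ⟨C, hC0, hC⟩ := hv.exists_le
  obtain ⟨D, hD⟩ := hv.exists_ge
  have hc := hv.continuous
  refine Metric.isCompact_of_isClosed_isBounded ?_ ?_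
  · have : unitPairs v = {q | v q.1 = 1} ∩ ({q | ⟪q.2, q.1⟫ = v q.1} ∩
        ⋂ y, {q | ⟪q.2, y⟫ ≤ v y}) := by
      ext q; simp [unitPairs, subdiff]
    rw [this]
    refine (isClosed_eq (by fun_prop) (by fun_prop)).inter
      ((isClosed_eq (by fun_prop) (by fun_prop)).inter (isClosed_iInter fun y => ?_))
    exact isClosed_le (by fun_prop) (by fun_prop)
  · refine (Metric.isBounded_closedBall (x := (0 : Vec n × Vec n)) (r := max D C)).subset ?_
    rintro ⟨x, m⟩ ⟨h1, h2, h3⟩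
    rw [mem_closedBall_zero_iff, Prod.norm_def]
    refine max_le_max ?_ ?_
    · simpa [show v x = 1 from h1] using hD x
    · have h4 := (h3 m).trans (hC m)
      simp only [real_inner_self_eq_norm_sq] at h4
      rcases (norm_nonneg m).eq_or_lt with h | h
      · simp only [← h]; exact hC0
      · simp only; nlinarith

end NormFacts

section Trajectories

variable {n : ℕ} {M : Set (Matrix (Fin n) (Fin n) ℝ)} {v : Vec n → ℝ}

theorem isSolutionWith_iff {A : ℝ → Matrix (Fin n) (Fin n) ℝ} {x : ℝ → Vec n} :
    IsSolutionWith M A x ↔ (∀ i j, Measurable fun t => A t i j) ∧ (∀ t, A t ∈ M) ∧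
      ∀ b, SolvesOn A b x := by
  refine and_congr_right fun _ => and_congr_right fun _ => ⟨fun h b => ?_, fun h => ⟨?_, ?_⟩⟩
  · exact ⟨h.1.mono Set.Icc_subset_Ici_self, fun t ht => h.2 t ht.1⟩
  · intro t ht
    have ht0 : (0 : ℝ) ≤ t := ht
    refine ((h (t + 1)).1 t ⟨ht, by linarith⟩).mono_of_mem_nhdsWithin ?_
    rw [← Set.Ici_inter_Iic]
    exact inter_mem self_mem_nhdsWithin (mem_nhdsWithin_of_mem_nhds (Iic_mem_nhds (by linarith)))
  · exact fun t ht => (h t).2 t ⟨ht, le_rfl⟩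

theorem isAdjointWith_iff {A : ℝ → Matrix (Fin n) (Fin n) ℝ} {l : ℝ → Vec n} :
    IsAdjointWith A l ↔ ∀ b, SolvesOn (fun t => -(A t)ᵀ) b l := by
  refine ⟨fun h b => ?_, fun h => ⟨?_, ?_⟩⟩
  · refine ⟨h.1.mono Set.Icc_subset_Ici_self, fun t ht => ?_⟩
    rw [h.2 t ht.1, h.2 0 le_rfl]
    simp only [neg_mulE, intervalIntegral.integral_neg, sub_eq_add_neg,
      intervalIntegral.integral_same,
      neg_zero, add_zero]
  · intro t ht
    have ht0 : (0 : ℝ) ≤ t := ht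
    refine ((h (t + 1)).1 t ⟨ht, by linarith⟩).mono_of_mem_nhdsWithin ?_
    rw [← Set.Ici_inter_Iic]
    exact inter_mem self_mem_nhdsWithin (mem_nhdsWithin_of_mem_nhds (Iic_mem_nhds (by linarith)))
  · intro t ht
    have := (h t).2 t ⟨ht, le_rfl⟩
    simpa only [neg_mulE, intervalIntegral.integral_neg, ← sub_eq_add_neg] using this

theorem SolvesOn.shift {L : ℝ} {F : ℝ → Matrix (Fin n) (Fin n) ℝ} (hF : IsCoef L F) {a b : ℝ}
    (ha : 0 ≤ a) {x : ℝ → Vec n} (hx : SolvesOn F (a + b) x) :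
    SolvesOn (fun t => F (a + t)) b fun t => x (a + t) := by
  refine ⟨hx.1.comp (by fun_prop) fun t ht => ⟨by linarith [ht.1], by linarith [ht.2]⟩,
    fun t ht => ?_⟩
  have h1 := hx.sub_eq hF (s := a) (t := a + t) ⟨ha, by linarith [ht.1, ht.2]⟩
    ⟨by linarith [ht.1], by linarith [ht.2]⟩
  dsimp only
  rw [add_zero, intervalIntegral.integral_comp_add_left (fun s => mulE (F s) (x s)), add_zero, ← h1]
  abel

theorem SolvesOn.reverse {L : ℝ} {F : ℝ → Matrix (Fin n) (Fin n) ℝ} (hF : IsCoef L F) {b : ℝ}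
    {x : ℝ → Vec n} (hx : SolvesOn F b x) :
    SolvesOn (fun t => -F (b - t)) b fun t => x (b - t) := by
  refine ⟨hx.1.comp (by fun_prop) fun t ht => ⟨by linarith [ht.2], by linarith [ht.1]⟩,
    fun t ht => ?_⟩
  have h1 := hx.sub_eq hF (s := b - t) (t := b) ⟨by linarith [ht.2], by linarith [ht.1]⟩
    ⟨ht.1.trans ht.2, le_rfl⟩
  simp only [neg_mulE, intervalIntegral.integral_neg]
  rw [sub_zero, intervalIntegral.integral_comp_sub_left (fun s => mulE (F s) (x s)), sub_zero, ← h1]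
  abel

theorem isCoef_of_mem {L : ℝ} (hL : ∀ A ∈ M, ∀ y, ‖mulE A y‖ ≤ L * ‖y‖ ∧ ‖mulE (-Aᵀ) y‖ ≤ L * ‖y‖)
    {A : ℝ → Matrix (Fin n) (Fin n) ℝ} (hA : ∀ i j, Measurable fun t => A t i j)
    (hAM : ∀ t, A t ∈ M) : IsCoef L A ∧ IsCoef L fun t => -(A t)ᵀ :=
  ⟨⟨hA, fun t y => (hL _ (hAM t) y).1⟩, ⟨fun i j => (hA j i).neg, fun t y => (hL _ (hAM t) y).2⟩⟩

/-- Every measurable selection of `M` has a solution through each initial point. -/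
theorem exists_isSolutionWith (hM : IsCompact M) {A : ℝ → Matrix (Fin n) (Fin n) ℝ}
    (hA : ∀ i j, Measurable fun t => A t i j) (hAM : ∀ t, A t ∈ M) (y : Vec n) :
    ∃ x, IsSolutionWith M A x ∧ x 0 = y := by
  obtain ⟨L, hL0, hL⟩ := exists_norm_mulE_le hM
  obtain ⟨x, hx0, hx⟩ := exists_solvesOn (isCoef_of_mem hL hA hAM).1 hL0 y
  exact ⟨x, isSolutionWith_iff.2 ⟨hA, hAM, hx⟩, hx0⟩

theorem inner_mulE_nonpos (hM : IsCompact M) (hv : IsBarabanov M v) {x m : Vec n}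
    (hm : m ∈ subdiff v x) {B : Matrix (Fin n) (Fin n) ℝ} (hB : B ∈ M) : ⟪m, mulE B x⟫ ≤ 0 := by
  obtain ⟨L, hL0, hL⟩ := exists_norm_mulE_le hM
  obtain ⟨Y, hY, hY0⟩ := exists_isSolutionWith hM (A := fun _ => B) (fun i j => measurable_const)
    (fun _ => hB) x
  have hF := (isCoef_of_mem hL (A := fun _ => B) (fun i j => measurable_const) (fun _ => hB)).1
  have hS := (isSolutionWith_iff.1 hY).2.2 1
  obtain ⟨R, hR⟩ := isCompact_Icc.exists_bound_of_continuousOn hS.1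
  have h0 : (0 : ℝ) ∈ Set.Icc (0 : ℝ) 1 := ⟨le_rfl, zero_le_one⟩
  have hR0 : 0 ≤ R := (norm_nonneg _).trans (hR 0 h0)
  have key : ∀ t ∈ Set.Ioo (0 : ℝ) 1, ⟪m, mulE B x⟫ ≤ ‖m‖ * (L * (L * R)) * t := by
    intro t ht
    have htI : t ∈ Set.Icc (0 : ℝ) 1 := ⟨ht.1.le, ht.2.le⟩
    have h1 : ⟪m, Y t⟫ ≤ ⟪m, x⟫ := by
      rw [hm.1, ← hY0]
      exact (hm.2 _).trans (hv.2.1 Y ⟨_, hY⟩ t ht.1.le)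
    have h2 : ‖(Y t - x) - t • mulE B x‖ ≤ L * (L * R) * t * t := by
      have e : (Y t - x) - t • mulE B x = ∫ r in (0 : ℝ)..t, mulE B (Y r - x) := by
        simp only [mulE_sub]
        rw [intervalIntegral.integral_sub
          (hF.intervalIntegrable (hS.1.mono (Set.uIcc_subset_Icc h0 htI)))
          (Continuous.intervalIntegrable continuous_const _ _), ← hS.sub_eq hF h0 htI, hY0]
        simp
      have h3 := intervalIntegral.norm_integral_le_of_norm_le_const (a := 0) (b := t)
        (f := fun r => mulE B (Y r - x)) (C := L * (L * R) * t) (fun r hr => by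
          rw [Set.uIoc_of_le ht.1.le] at hr
          refine ((hL B hB _).1).trans ?_
          rw [mul_assoc L]
          refine mul_le_mul_of_nonneg_left ?_ hL0
          have := hS.norm_sub_le hF hL0 hR h0 (t := r) ⟨hr.1.le, hr.2.trans ht.2.le⟩
          rw [hY0, sub_zero, abs_of_pos hr.1] at this
          exact this.trans (mul_le_mul_of_nonneg_left hr.2 (mul_nonneg hL0 hR0)))
      rwa [← e, sub_zero, abs_of_pos ht.1] at h3
    have h4 := (abs_le.1 ((abs_real_inner_le_norm m _).trans
      (mul_le_mul_of_nonneg_left h2 (norm_nonneg m)))).1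
    rw [inner_sub_right, inner_sub_right, inner_smul_right] at h4
    have h5 : t * ⟪m, mulE B x⟫ ≤ t * (‖m‖ * (L * (L * R)) * t) := by linarith
    exact le_of_mul_le_mul_left h5 ht.1
  have hlim : Tendsto (fun t : ℝ => ‖m‖ * (L * (L * R)) * t) (𝓝[>] 0) (𝓝 0) := by
    have : Tendsto (fun t : ℝ => ‖m‖ * (L * (L * R)) * t) (𝓝 0) (𝓝 (‖m‖ * (L * (L * R)) * 0)) :=
      Continuous.tendsto (by fun_prop) 0
    rw [mul_zero] at this
    exact this.mono_left nhdsWithin_le_nhds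
  refine ge_of_tendsto hlim ?_
  filter_upwards [Ioo_mem_nhdsGT (zero_lt_one (α := ℝ))] with t ht using key t ht

/-- Solutions on the unit sphere of `v` with an adjoint solution formed by subgradients. -/
def extremalPairs (M : Set (Matrix (Fin n) (Fin n) ℝ)) (v : Vec n → ℝ) :
    Set (ℝ → Vec n × Vec n) :=
  {g | ∃ A, IsSolutionWith M A (fun t => (g t).1) ∧ IsAdjointWith A (fun t => (g t).2) ∧
    ∀ t ≥ (0 : ℝ), g t ∈ unitPairs v}

theorem ae_inner_mulE_eq_zero (hM : IsCompact M) {A : ℝ → Matrix (Fin n) (Fin n) ℝ}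
    {g : ℝ → Vec n × Vec n} (hx : IsSolutionWith M A (fun t => (g t).1))
    (hg : ∀ t ≥ (0 : ℝ), g t ∈ unitPairs v) :
    ∀ᵐ t, 0 < t → ⟪(g t).2, mulE (A t) (g t).1⟫ = 0 := by
  obtain ⟨L, hL0, hL⟩ := exists_norm_mulE_le hM
  obtain ⟨hA, hAM, hS⟩ := isSolutionWith_iff.1 hx
  have hF := (isCoef_of_mem hL hA hAM).1
  have hae : ∀ᵐ t, ∀ k : ℕ, t ∈ Set.Ioo 0 (k : ℝ) →
      HasDerivAt (fun t => (g t).1) (mulE (A t) (g t).1) t :=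
    ae_all_iff.2 fun k => (hS k).ae_hasDerivAt hF
  filter_upwards [hae] with t ht ht0
  obtain ⟨k, hk⟩ := exists_nat_gt t
  have hd := ht k ⟨ht0, hk⟩
  have hd2 : HasDerivAt (fun s => ⟪(g t).2, (g s).1⟫) ⟪(g t).2, mulE (A t) (g t).1⟫ t := by
    simpa using (hasDerivAt_const t (g t).2).inner ℝ hd
  refine IsLocalMax.hasDerivAt_eq_zero ?_ hd2
  filter_upwards [Ioi_mem_nhds ht0] with s hs
  have h1 := hg t ht0.le
  have h2 := hg s (le_of_lt hs)
  rw [h1.2.1, h1.1, ← h2.1]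
  exact h1.2.2 _

theorem maxCondWith_of_mem (hM : IsCompact M) (hv : IsBarabanov M v)
    {A : ℝ → Matrix (Fin n) (Fin n) ℝ}
    {g : ℝ → Vec n × Vec n} (hx : IsSolutionWith M A (fun t => (g t).1))
    (hg : ∀ t ≥ (0 : ℝ), g t ∈ unitPairs v) :
    MaxCondWith M A (fun t => (g t).1) fun t => (g t).2 := by
  refine (ae_restrict_iff' measurableSet_Ici).2 ?_
  have e0 : ∀ᵐ t : ℝ, t ≠ 0 := by simp [ae_iff]
  filter_upwards [ae_inner_mulE_eq_zero hM hx hg, e0] with t h1 h2 h3 B hB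
  rw [h1 (lt_of_le_of_ne h3 h2.symm)]
  exact inner_mulE_nonpos hM hv (hg t h3).2 hB

theorem exists_limit_mem_extremalPairs (hne : M.Nonempty) (hM : IsCompact M) (hconv : Convex ℝ M)
    (hv : IsNorm v) {A : ℕ → ℝ → Matrix (Fin n) (Fin n) ℝ}
    (hA : ∀ k i j, Measurable fun t => A k t i j) (hAM : ∀ k t, A k t ∈ M) (𝒰 : Ultrafilter ℕ)
    {g : ℕ → ℝ → Vec n × Vec n}
    (hg : ∀ b ≥ (0 : ℝ), ∀ᶠ k in (𝒰 : Filter ℕ), SolvesOn (A k) b (fun t => (g k t).1) ∧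
      SolvesOn (fun t => -(A k t)ᵀ) b (fun t => (g k t).2) ∧
      ∀ t ∈ Set.Icc 0 b, g k t ∈ unitPairs v) :
    ∃ h ∈ extremalPairs M v, ∀ t ≥ (0 : ℝ), Tendsto (fun k => g k t) 𝒰 (𝓝 (h t)) := by
  obtain ⟨L, hL0, hL⟩ := exists_norm_mulE_le hM
  obtain ⟨C, hC0, hC⟩ := exists_entry_bound hM
  obtain ⟨R, hR⟩ := hv.isCompact_unitPairs.isBounded.exists_norm_le
  obtain ⟨B, G, hB, hBM, hG, hG'⟩ := exists_limit_coef hne hM hconv hA hAM 𝒰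
  have hlim : ∀ t, ∃ q, 0 ≤ t → q ∈ unitPairs v ∧ Tendsto (fun k => g k t) 𝒰 (𝓝 q) := by
    intro t
    rcases lt_or_ge t 0 with ht | ht
    · exact ⟨0, fun h => absurd h (not_le.2 ht)⟩
    obtain ⟨q, hq, hq'⟩ := hv.isCompact_unitPairs.ultrafilter_le_nhds (𝒰.map fun k => g k t) (by
      rw [Ultrafilter.coe_map]
      refine tendsto_principal.2 ?_
      filter_upwards [hg t ht] with k hk using hk.2.2 t ⟨ht, le_rfl⟩)
    exact ⟨q, fun _ => ⟨hq, hq'⟩⟩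
  choose h hh using hlim
  refine ⟨h, ⟨B, isSolutionWith_iff.2 ⟨hB, hBM, fun b => ?_⟩, isAdjointWith_iff.2 fun b => ?_,
    fun t ht => (hh t ht).1⟩, fun t ht => (hh t ht).2⟩
  · rcases lt_or_ge b 0 with hb | hb
    · rw [SolvesOn, Set.Icc_eq_empty (not_le.2 hb)]; simp
    refine solvesOn_limit (R := R) hL0 (fun k => (isCoef_of_mem hL (hA k) (hAM k)).1)
      (fun k t => hC _ (hAM k t)) (isCoef_of_mem hL hB hBM).1 hG hG'
      (x := fun k t => (g k t).1) ?_ fun t ht => (hh t ht.1).2.fst_nhds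
    filter_upwards [hg b hb] with k hk
    exact ⟨hk.1, fun t ht => (norm_fst_le _).trans (hR _ (hk.2.2 t ht))⟩
  · rcases lt_or_ge b 0 with hb | hb
    · rw [SolvesOn, Set.Icc_eq_empty (not_le.2 hb)]; simp
    refine solvesOn_limit (R := R) (C := C) (G := fun t => -(G t)ᵀ) hL0
      (fun k => (isCoef_of_mem hL (hA k) (hAM k)).2)
      (fun k t i j => ?_) (isCoef_of_mem hL hB hBM).2 (fun t i j => ?_) ?_
      (x := fun k t => (g k t).2) ?_ fun t ht => (hh t ht.1).2.snd_nhds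
    · simpa using hC _ (hAM k t) j i
    · simpa using (hG t j i).neg
    · filter_upwards [hG'] with t ht i j
      exact (ht j i).neg
    · filter_upwards [hg b hb] with k hk
      exact ⟨hk.2.1, fun t ht => (norm_snd_le _).trans (hR _ (hk.2.2 t ht))⟩

theorem isCompactSemiflow_extremalPairs (hne : M.Nonempty) (hM : IsCompact M)
    (hconv : Convex ℝ M) (hv : IsBarabanov M v) (hG : ConditionG M) :
    IsCompactSemiflow (extremalPairs M v) (unitPairs v) where
  mem := fun g ⟨_, _, _, hg⟩ t ht => hg t ht
  shift := by
    rintro g ⟨A, h1, h2, h3⟩ a ha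
    obtain ⟨L, hL0, hL⟩ := exists_norm_mulE_le hM
    obtain ⟨hA, hAM, hS⟩ := isSolutionWith_iff.1 h1
    obtain ⟨hF, hF'⟩ := isCoef_of_mem hL hA hAM
    refine ⟨fun t => A (a + t), isSolutionWith_iff.2 ⟨fun i j => ?_, fun t => hAM _, fun b => ?_⟩,
      isAdjointWith_iff.2 fun b => ?_, fun t ht => h3 _ (add_nonneg ha ht)⟩
    · exact (hA i j).comp (measurable_const_add a)
    · exact (hS (a + b)).shift hF ha
    · exact (isAdjointWith_iff.1 h2 (a + b)).shift hF' ha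
  uniq := by
    rintro g ⟨A, h1, h2, h3⟩ g' ⟨A', h1', h2', h3'⟩ h0 t ht
    have hx0 : (g 0).1 ≠ 0 := fun h => by
      have := (h3 0 le_rfl).1
      rw [h, (hv.1.1 0).2 rfl] at this
      exact zero_ne_one this
    have hl0 : (g 0).2 ≠ 0 := fun h => by
      have := (h3 0 le_rfl).2.1
      rw [h, (h3 0 le_rfl).1, inner_zero_left] at this
      exact zero_ne_one this
    have := hG (g 0).1 (g 0).2 hx0 hl0 A A' _ _ _ _ h1 h1' h2 h2' rfl (by rw [h0]) rfl (by rw [h0])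
      (maxCondWith_of_mem hM hv h1 h3) (maxCondWith_of_mem hM hv h1' h3') t ht
    exact Prod.ext this.1 this.2
  lip := by
    obtain ⟨L, hL0, hL⟩ := exists_norm_mulE_le hM
    obtain ⟨R, hR⟩ := hv.1.isCompact_unitPairs.isBounded.exists_norm_le
    refine ⟨L * R, ?_⟩
    rintro g ⟨A, h1, h2, h3⟩ s hs t ht
    obtain ⟨hA, hAM, hS⟩ := isSolutionWith_iff.1 h1
    obtain ⟨hF, hF'⟩ := isCoef_of_mem hL hA hAM
    have hs' : s ∈ Set.Icc 0 (max s t) := ⟨hs, le_max_left _ _⟩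
    have ht' : t ∈ Set.Icc 0 (max s t) := ⟨ht, le_max_right _ _⟩
    rw [dist_eq_norm, Prod.norm_def]
    refine max_le ?_ ?_
    · exact (hS (max s t)).norm_sub_le hF hL0
        (fun r hr => (norm_fst_le _).trans (hR _ (h3 r hr.1))) ht' hs'
    · exact (isAdjointWith_iff.1 h2 (max s t)).norm_sub_le hF' hL0
        (fun r hr => (norm_snd_le _).trans (hR _ (h3 r hr.1))) ht' hs'
  lim := by
    intro g hg 𝒰
    choose A h1 h2 h3 using hg
    refine exists_limit_mem_extremalPairs hne hM hconv hv.1 (A := A)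
      (fun k => (isSolutionWith_iff.1 (h1 k)).1) (fun k => (isSolutionWith_iff.1 (h1 k)).2.1) 𝒰
      fun b hb => Eventually.of_forall fun k => ⟨(isSolutionWith_iff.1 (h1 k)).2.2 b,
        isAdjointWith_iff.1 (h2 k) b, fun t ht => h3 k t ht.1⟩

theorem exists_adjoint_on (hM : IsCompact M) (hv : IsBarabanov M v)
    {A : ℝ → Matrix (Fin n) (Fin n) ℝ} {x : ℝ → Vec n} (hx : IsSolutionWith M A x)
    (hx1 : ∀ t ≥ (0 : ℝ), v (x t) = 1) {T : ℝ} (hT : 0 ≤ T) :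
    ∃ l, SolvesOn (fun t => -(A t)ᵀ) T l ∧ ∀ t ∈ Set.Icc 0 T, l t ∈ subdiff v (x t) := by
  obtain ⟨L, hL0, hL⟩ := exists_norm_mulE_le hM
  obtain ⟨hA, hAM, hS⟩ := isSolutionWith_iff.1 hx
  obtain ⟨hF, hF'⟩ := isCoef_of_mem hL hA hAM
  obtain ⟨lT, hlT⟩ := hv.1.subdiff_nonempty (x T)
  have hFr : IsCoef L fun t => (A (T - t))ᵀ := by
    refine ⟨fun i j => (hA j i).comp (measurable_const_sub T), fun t y => ?_⟩
    have := (hL _ (hAM (T - t)) y).2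
    rwa [neg_mulE, norm_neg] at this
  obtain ⟨m, hm0, hm⟩ := exists_solvesOn hFr hL0 lT
  have hl := (hm T).reverse hFr
  simp only [sub_sub_cancel] at hl
  have hlTe : m (T - T) = lT := by rw [sub_self, hm0]
  have hTT : T ∈ Set.Icc 0 T := ⟨hT, le_rfl⟩
  refine ⟨_, hl, fun t ht => ⟨?_, fun y => ?_⟩⟩
  · have e1 := (hS T).inner_eq hF hL0 hl hL0 hF' ht
    have e2 := (hS T).inner_eq hF hL0 hl hL0 hF' hTT
    rw [e1, ← e2, hlTe, hlT.1, hx1 t ht.1, hx1 T hT]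
  · have hAt : ∀ i j, Measurable fun s => A (t + s) i j := fun i j =>
      (hA i j).comp (measurable_const_add t)
    obtain ⟨Y, hY, hY0⟩ := exists_isSolutionWith hM hAt (fun s => hAM (t + s)) y
    obtain ⟨hFt, hFt'⟩ := isCoef_of_mem hL hAt fun s => hAM (t + s)
    have hl' : SolvesOn (fun s => -(A s)ᵀ) (t + (T - t)) fun s => m (T - s) := by
      rwa [add_sub_cancel]
    have e := ((isSolutionWith_iff.1 hY).2.2 (T - t)).inner_eq hFt hL0 (hl'.shift hF' ht.1) hL0 hFt'
      (t := T - t) ⟨by linarith [ht.2], le_rfl⟩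
    simp only [add_sub_cancel, add_zero, hY0, hlTe] at e
    rw [← e, ← hY0]
    exact (hlT.2 _).trans (hv.2.1 Y ⟨_, hY⟩ _ (by linarith [ht.2]))

/-- An extremal solution has an adjoint solution formed by subgradients of the norm. -/
theorem exists_mem_extremalPairs (hne : M.Nonempty) (hM : IsCompact M) (hconv : Convex ℝ M)
    (hv : IsBarabanov M v) {x : ℝ → Vec n} (hx : IsSolution M x)
    (hx1 : ∀ t ≥ (0 : ℝ), v (x t) = 1) :
    ∃ g ∈ extremalPairs M v, ∀ t ≥ (0 : ℝ), (g t).1 = x t := by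
  obtain ⟨A, hA⟩ := hx
  choose l hl hl' using fun k : ℕ => exists_adjoint_on hM hv hA hx1 (T := k) k.cast_nonneg
  set 𝒰 : Ultrafilter ℕ := hyperfilter ℕ
  have h𝒰 : (𝒰 : Filter ℕ) ≤ atTop := Nat.hyperfilter_le_atTop
  obtain ⟨h, hh, hlim⟩ := exists_limit_mem_extremalPairs hne hM hconv hv.1 (A := fun _ => A)
    (fun _ => hA.1) (fun _ => hA.2.1) 𝒰 (g := fun k t => (x t, l k t)) (fun b hb => by
      filter_upwards [h𝒰 (tendsto_natCast_atTop_atTop.eventually_ge_atTop b)] with k hk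
      have hsub : Set.Icc 0 b ⊆ Set.Icc 0 (k : ℝ) := Set.Icc_subset_Icc le_rfl hk
      exact ⟨(isSolutionWith_iff.1 hA).2.2 b,
        ⟨(hl k).1.mono hsub, fun t ht => (hl k).2 t (hsub ht)⟩,
        fun t ht => ⟨hx1 t ht.1, hl' k t (hsub ht)⟩⟩)
  exact ⟨h, hh, fun t ht => tendsto_nhds_unique (hlim t ht).fst_nhds tendsto_const_nhds⟩

end Trajectories

section Stereographic

variable {E : Type*} [MetricSpace E] {𝒢 : Set (ℝ → E)} {N : Set E} {a b c : E → ℝ} {p : E}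

/-- Stereographic projection from the ray spanned by `(1, 0, 0)`. -/
def stereo (a b c : ℝ) : ℂ :=
  ⟨b / (√(a ^ 2 + b ^ 2 + c ^ 2) - a), c / (√(a ^ 2 + b ^ 2 + c ^ 2) - a)⟩

theorem le_sqrt_sum_sq (a b c : ℝ) : a ≤ √(a ^ 2 + b ^ 2 + c ^ 2) :=
  Real.le_sqrt_of_sq_le (by nlinarith [sq_nonneg b, sq_nonneg c])

theorem sqrt_sub_mul_add (a b c : ℝ) :
    (√(a ^ 2 + b ^ 2 + c ^ 2) - a) * (√(a ^ 2 + b ^ 2 + c ^ 2) + a) = b ^ 2 + c ^ 2 := by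
  have := Real.sq_sqrt (show 0 ≤ a ^ 2 + b ^ 2 + c ^ 2 by positivity)
  linear_combination this

theorem stereo_normSq {a b c : ℝ} (h : √(a ^ 2 + b ^ 2 + c ^ 2) ≠ a) :
    (√(a ^ 2 + b ^ 2 + c ^ 2) - a) * ((stereo a b c).re ^ 2 + (stereo a b c).im ^ 2) =
      √(a ^ 2 + b ^ 2 + c ^ 2) + a := by
  have h1 : √(a ^ 2 + b ^ 2 + c ^ 2) - a ≠ 0 := sub_ne_zero.2 h
  have h2 := sqrt_sub_mul_add a b c
  simp only [stereo]
  field_simp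
  linarith

theorem stereo_inj {a b c a' b' c' : ℝ} (h : √(a ^ 2 + b ^ 2 + c ^ 2) ≠ a)
    (h' : √(a' ^ 2 + b' ^ 2 + c' ^ 2) ≠ a') (e : stereo a b c = stereo a' b' c') :
    ∃ r > 0, a = r * a' ∧ b = r * b' ∧ c = r * c' := by
  have h1 : 0 < √(a ^ 2 + b ^ 2 + c ^ 2) - a :=
    sub_pos.2 (lt_of_le_of_ne (le_sqrt_sum_sq a b c) h.symm)
  have h1' : 0 < √(a' ^ 2 + b' ^ 2 + c' ^ 2) - a' :=
    sub_pos.2 (lt_of_le_of_ne (le_sqrt_sum_sq a' b' c') h'.symm)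
  have h2 := stereo_normSq h
  have h2' := stereo_normSq h'
  have e1 : b / (√(a ^ 2 + b ^ 2 + c ^ 2) - a) = b' / (√(a' ^ 2 + b' ^ 2 + c' ^ 2) - a') :=
    congrArg Complex.re e
  have e2 : c / (√(a ^ 2 + b ^ 2 + c ^ 2) - a) = c' / (√(a' ^ 2 + b' ^ 2 + c' ^ 2) - a') :=
    congrArg Complex.im e
  rw [e] at h2
  set D := √(a ^ 2 + b ^ 2 + c ^ 2) - a with hD
  set D' := √(a' ^ 2 + b' ^ 2 + c' ^ 2) - a' with hD'
  set S := (stereo a' b' c').re ^ 2 + (stereo a' b' c').im ^ 2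
  refine ⟨D / D', by positivity, ?_, ?_, ?_⟩
  · have k1 : 2 * a = D * (S - 1) := by rw [mul_sub, h2]; ring
    have k2 : 2 * a' = D' * (S - 1) := by rw [mul_sub, h2']; ring
    have : D * (2 * a') = D' * (2 * a) := by rw [k1, k2]; ring
    field_simp
    linarith
  · rw [div_eq_div_iff h1.ne' h1'.ne'] at e1
    field_simp
    linarith
  · rw [div_eq_div_iff h1.ne' h1'.ne'] at e2
    field_simp
    linarith

theorem stereo_im_eq_zero {a b c : ℝ} (h : √(a ^ 2 + b ^ 2 + c ^ 2) ≠ a) :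
    (stereo a b c).im = 0 ↔ c = 0 := by
  simp [stereo, div_eq_zero_iff, sub_ne_zero.2 h]

theorem eq_zero_of_sqrt_eq {a b c : ℝ} (h : √(a ^ 2 + b ^ 2 + c ^ 2) = a) : b = 0 ∧ c = 0 := by
  have := sqrt_sub_mul_add a b c
  rw [h, sub_self, zero_mul] at this
  constructor <;> nlinarith [sq_nonneg b, sq_nonneg c]

theorem stereo_im_pos {a b c : ℝ} (hc : 0 < c) : 0 < (stereo a b c).im := by
  have h1 : 0 < √(a ^ 2 + b ^ 2 + c ^ 2) - a :=
    sub_pos.2 (lt_of_le_of_ne (le_sqrt_sum_sq a b c) fun h => hc.ne' (eq_zero_of_sqrt_eq h.symm).2)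
  exact div_pos hc h1

theorem stereo_im_neg {a b c : ℝ} (hc : c < 0) : (stereo a b c).im < 0 := by
  have h1 : 0 < √(a ^ 2 + b ^ 2 + c ^ 2) - a :=
    sub_pos.2 (lt_of_le_of_ne (le_sqrt_sum_sq a b c) fun h => hc.ne (eq_zero_of_sqrt_eq h.symm).2)
  exact div_neg_of_neg_of_pos hc h1

/-- Points of the real axis far to the left project from rays close to the pole. -/
theorem abs_lt_of_stereo_re_lt {a b η : ℝ} (hη : 0 < η) (hη1 : η ≤ 1)
    (h : √(a ^ 2 + b ^ 2 + 0 ^ 2) ≠ a) (hre : (stereo a b 0).re < -(4 / η)) :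
    0 < a ∧ |b| ≤ 2 / 3 * η * a := by
  have h1 : 0 < √(a ^ 2 + b ^ 2 + 0 ^ 2) - a :=
    sub_pos.2 (lt_of_le_of_ne (le_sqrt_sum_sq a b 0) h.symm)
  have h2 := stereo_normSq h
  have h3 : b = (stereo a b 0).re * (√(a ^ 2 + b ^ 2 + 0 ^ 2) - a) := by
    simp only [stereo]; field_simp
  have h4 : (stereo a b 0).im = 0 := (stereo_im_eq_zero h).2 rfl
  have h5 : √(a ^ 2 + b ^ 2 + 0 ^ 2) ≤ |a| + |b| :=
    Real.sqrt_le_iff.2 ⟨by positivity, by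
      nlinarith [sq_abs a, sq_abs b, abs_nonneg a, abs_nonneg b,
        mul_nonneg (abs_nonneg a) (abs_nonneg b)]⟩
  rw [h4] at h2
  set R := (stereo a b 0).re
  set D := √(a ^ 2 + b ^ 2 + 0 ^ 2) - a
  have h4η : 4 ≤ 4 / η := by rw [le_div_iff₀ hη]; linarith
  have hR : R < -4 := by linarith
  have hb : b < 0 := by rw [h3]; nlinarith
  have ha : 0 < a := by
    have : D * (R ^ 2 - 1) = 2 * a := by
      linear_combination h2
    nlinarith [mul_pos h1 (show 0 < R ^ 2 - 1 by nlinarith)]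
  rw [abs_of_pos ha, abs_of_neg hb] at h5
  have h6 : -b * (4 / η) ≤ 2 * a - b := by
    have : -b * (-R) = √(a ^ 2 + b ^ 2 + 0 ^ 2) + a := by
      rw [← h2]; nth_rewrite 1 [h3]; ring
    nlinarith
  refine ⟨ha, ?_⟩
  rw [abs_of_neg hb]
  rw [mul_div_assoc', div_le_iff₀ hη] at h6
  nlinarith [mul_nonneg (neg_pos.2 hb).le (sub_nonneg.2 hη1)]

theorem stereo_neg_re {τ η : ℝ} (hτ : 0 < τ) (hη : τ < η / 3) :
    √((1 : ℝ) ^ 2 + (-τ) ^ 2 + 0 ^ 2) ≠ 1 ∧ (stereo 1 (-τ) 0).re < -(4 / η) := by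
  have h : √((1 : ℝ) ^ 2 + (-τ) ^ 2 + 0 ^ 2) ≠ 1 := fun h => by
    have := (eq_zero_of_sqrt_eq h).1
    linarith
  refine ⟨h, ?_⟩
  have h1 : 0 < √((1 : ℝ) ^ 2 + (-τ) ^ 2 + 0 ^ 2) - 1 :=
    sub_pos.2 (lt_of_le_of_ne (le_sqrt_sum_sq _ _ _) h.symm)
  have h2 : √((1 : ℝ) ^ 2 + (-τ) ^ 2 + 0 ^ 2) ≤ 1 + τ ^ 2 / 2 :=
    Real.sqrt_le_iff.2 ⟨by positivity, by nlinarith [sq_nonneg (τ ^ 2)]⟩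
  have hη0 : 0 < η := by linarith
  simp only [stereo]
  rw [div_lt_iff₀ h1]
  have : 4 / η * (√((1 : ℝ) ^ 2 + (-τ) ^ 2 + 0 ^ 2) - 1) ≤ 4 / η * (τ ^ 2 / 2) :=
    mul_le_mul_of_nonneg_left (by linarith) (by positivity)
  have h3 : 4 / η * (τ ^ 2 / 2) < τ := by
    rw [div_mul_eq_mul_div, div_lt_iff₀ hη0]; nlinarith
  linarith

theorem countable_of_separated {S : Set ℝ} {κ : ℝ} (hκ : 0 < κ)
    (h : ∀ s ∈ S, ∀ t ∈ S, |s - t| < κ → s = t) : S.Countable := by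
  have : Set.InjOn (fun s => ⌊s / κ⌋) S := by
    intro s hs t ht e
    refine h s hs t ht ?_
    have := Int.abs_sub_lt_one_of_floor_eq_floor e
    rwa [← sub_div, abs_div, abs_of_pos hκ, div_lt_one hκ] at this
  exact Set.countable_of_injective_of_countable_image this (Set.to_countable _)

theorem exists_isCrossSection (H : IsCompactSemiflow 𝒢 N) (hN : IsCompact N)
    (ha : Continuous a) (hb : Continuous b) (hc : Continuous c) (hp : p ∈ N)
    (hap : a p = 1) (hbp : b p = 0) (hcp : c p = 0)
    (hray : ∀ q ∈ N, ∀ q' ∈ N, ∀ r > 0, a q = r * a q' → b q = r * b q' → c q = r * c q' → q = q')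
    (h0 : ∀ q ∈ N, a q = 0 → b q = 0 → c q ≠ 0) {δ r : ℝ} (hδ : 0 < δ) (hr : 0 < r)
    (hrate : ∀ h ∈ 𝒢, ∀ s ≥ 0, ∀ t ≥ s, (∀ u ∈ Set.Icc s t, dist (h u) p ≤ r) →
      δ * (t - s) ≤ c (h t) - c (h s))
    {g : ℝ → E} (hg : g ∈ 𝒢) :
    ∃ χ P α β κ, IsCrossSection 𝒢 N g p χ P α β κ := by
  obtain ⟨L, hL⟩ := H.lip
  have hLip : ∀ h ∈ 𝒢, ∀ s ≥ (0 : ℝ), ∀ t ≥ (0 : ℝ), dist (h s) (h t) ≤ (|L| + 1) * |s - t| :=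
    fun h hh s hs t ht => (hL h hh s hs t ht).trans
      (mul_le_mul_of_nonneg_right (by linarith [le_abs_self L]) (abs_nonneg _))
  have hL1 : 0 < |L| + 1 := by positivity
  -- the section lies close to `p`
  obtain ⟨η, hη, hη1, hηr⟩ : ∃ η > (0 : ℝ), η ≤ 1 ∧ ∀ q ∈ N, c q = 0 → 0 < a q →
      |b q| < η * a q → dist q p < r / 2 := by
    by_contra! hcon
    choose q hqN hqc hqa hqb hqd using fun k : ℕ =>
      hcon (1 / ((k : ℝ) + 1)) (by positivity)
        (by rw [div_le_one (by positivity)]; linarith [k.cast_nonneg (α := ℝ)])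
    obtain ⟨y, hy, φ, hφ, hlim⟩ := hN.tendsto_subseq hqN
    have l1 : Tendsto (fun k => 1 / ((φ k : ℝ) + 1) * a (q (φ k))) atTop (𝓝 (0 * a y)) :=
      (tendsto_one_div_add_atTop_nhds_zero_nat.comp hφ.tendsto_atTop).mul
        ((ha.tendsto y).comp hlim)
    have l2 : |b y| ≤ 0 := by
      rw [zero_mul] at l1
      exact le_of_tendsto_of_tendsto' ((hb.tendsto y).comp hlim).abs l1 fun k => (hqb _).le
    have l3 : c y = 0 := tendsto_nhds_unique ((hc.tendsto y).comp hlim)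
      (by simp only [Function.comp_def, hqc]; exact tendsto_const_nhds)
    have l4 : 0 ≤ a y := ge_of_tendsto' ((ha.tendsto y).comp hlim) fun k => (hqa _).le
    have l5 : r / 2 ≤ dist y p :=
      ge_of_tendsto' (hlim.dist tendsto_const_nhds) fun k => hqd _
    have l6 : b y = 0 := abs_nonpos_iff.1 l2
    have l7 : 0 < a y := lt_of_le_of_ne l4 fun h => h0 y hy h.symm l6 l3
    have : y = p := hray y hy p hp (a y) l7 (by rw [hap, mul_one]) (by rw [hbp, l6, mul_zero])
      (by rw [hcp, l3, mul_zero])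
    rw [this, dist_self] at l5
    linarith
  set κ := r / 2 / (|L| + 1) with hκdef
  have hκ : 0 < κ := by positivity
  have hclose : ∀ h ∈ 𝒢, ∀ t ≥ (0 : ℝ), dist (h t) p < r / 2 → ∀ u ≥ (0 : ℝ), |u - t| < κ →
      dist (h u) p ≤ r := by
    intro h hh t ht hd u hu hut
    have h1 := hLip h hh u hu t ht
    have h2 : (|L| + 1) * |u - t| ≤ r / 2 := by
      rw [hκdef, lt_div_iff₀ hL1] at hut; linarith
    linarith [dist_triangle (h u) (h t) p]
  have hsign : ∀ h ∈ 𝒢, ∀ t ≥ (0 : ℝ), dist (h t) p < r / 2 → c (h t) = 0 → ∀ s ≥ (0 : ℝ),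
      |s - t| < κ → (s < t → c (h s) < 0) ∧ (t < s → 0 < c (h s)) := by
    intro h hh t ht hd hct s hs hst
    refine ⟨fun hlt => ?_, fun hlt => ?_⟩
    · have := hrate h hh s hs t hlt.le fun u hu => hclose h hh t ht hd u (hs.trans hu.1) (by
        rw [abs_sub_comm, abs_of_nonneg (by linarith [hu.2])]
        rw [abs_sub_comm, abs_of_pos (by linarith)] at hst
        linarith [hu.1])
      nlinarith
    · have := hrate h hh t ht s hlt.le fun u hu => hclose h hh t ht hd u (ht.le.trans hu.1) (by
        rw [abs_of_nonneg (by linarith [hu.1])]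
        rw [abs_of_pos (by linarith)] at hst
        linarith [hu.2])
      nlinarith
  -- the pole
  obtain ⟨τ, hτ, hτη, hτg⟩ : ∃ τ > 0, τ < η / 3 ∧
      ∀ t ≥ (0 : ℝ), c (g t) = 0 → 0 < a (g t) → b (g t) ≠ τ * a (g t) := by
    set S : Set ℝ := {t | 0 ≤ t ∧ c (g t) = 0 ∧ dist (g t) p < r / 2}
    have hS : S.Countable := countable_of_separated hκ fun s hs t ht hst => by
      by_contra hne
      have := hsign g hg t ht.1 ht.2.2 ht.2.1 s hs.1 hst
      rcases lt_or_gt_of_ne hne with hlt | hlt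
      · exact (this.1 hlt).ne hs.2.1
      · exact (this.2 hlt).ne' hs.2.1
    obtain ⟨τ, hτ, hτ'⟩ := ((hS.image fun t => b (g t) / a (g t)).dense_compl ℝ).exists_between
      (show (0 : ℝ) < η / 3 by positivity)
    refine ⟨τ, hτ'.1, hτ'.2, fun t ht hct hat e => hτ ⟨t, ⟨ht, hct, ?_⟩, ?_⟩⟩
    · refine hηr _ (H.mem g hg t ht) hct hat ?_
      rw [e, abs_of_pos (mul_pos hτ'.1 hat)]
      exact mul_lt_mul_of_pos_right (by linarith [hτ'.2]) hat
    · simp only [e]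
      field_simp
  have hτ3 := stereo_neg_re hτ hτη
  set b' : E → ℝ := fun q => b q - τ * a q with hb'def
  have hb' : Continuous b' := by fun_prop
  set ρ : E → ℝ := fun q => √(a q ^ 2 + b' q ^ 2 + c q ^ 2) with hρdef
  have hρ : Continuous ρ := by fun_prop
  set χ : E → ℂ := fun q => stereo (a q) (b' q) (c q) with hχdef
  set P : Set E := {q | ρ q = a q} with hPdef
  have hPc : IsClosed P := isClosed_eq hρ ha
  have hχc : ∀ q, q ∉ P → ContinuousAt χ q := by
    intro q hq
    have hne : ρ q - a q ≠ 0 := sub_ne_zero.2 hq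
    have e : χ = fun q => ((b' q / (ρ q - a q) : ℝ) : ℂ) + ((c q / (ρ q - a q) : ℝ) : ℂ) *
        Complex.I := by
      funext q
      exact (Complex.re_add_im (χ q)).symm
    rw [e]
    refine ContinuousAt.add ?_ (ContinuousAt.mul ?_ continuousAt_const)
    · exact Complex.continuous_ofReal.continuousAt.comp
        (hb'.continuousAt.div (hρ.sub ha).continuousAt hne)
    · exact Complex.continuous_ofReal.continuousAt.comp
        (hc.continuousAt.div (hρ.sub ha).continuousAt hne)
  have hinj : Set.InjOn χ (N \ P) := by
    rintro q ⟨hq, hqP⟩ q' ⟨hq', hqP'⟩ e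
    obtain ⟨k, hk, e1, e2, e3⟩ := stereo_inj hqP hqP' e
    refine hray q hq q' hq' k hk e1 ?_ e3
    simp only [hb'def] at e2
    rw [e1] at e2
    linarith
  have hb'p : b' p = -τ := by simp [hb'def, hap, hbp]
  have hpP : p ∉ P := by
    change √(a p ^ 2 + b' p ^ 2 + c p ^ 2) ≠ a p
    rw [hap, hb'p, hcp]
    exact hτ3.1
  have him : ∀ q, q ∉ P → ((χ q).im = 0 ↔ c q = 0) := fun q hq => stereo_im_eq_zero hq
  have hsec : ∀ q ∈ N, q ∉ P → c q = 0 → (χ q).re < -(4 / η) → dist q p < r / 2 := by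
    intro q hq hqP hqc hre
    have hqP' : √(a q ^ 2 + b' q ^ 2 + 0 ^ 2) ≠ a q := by rw [← hqc]; exact hqP
    have hre' : (stereo (a q) (b' q) 0).re < -(4 / η) := by rw [← hqc]; exact hre
    obtain ⟨h1, h2⟩ := abs_lt_of_stereo_re_lt hη hη1 hqP' hre'
    refine hηr q hq hqc h1 ?_
    have h3 : |b q| ≤ |b' q| + τ * a q := by
      have := abs_add_le (b' q) (τ * a q)
      rw [abs_of_pos (mul_pos hτ h1)] at this
      simpa [hb'def] using this
    nlinarith
  refine ⟨χ, P, (χ p).re - 1, -(4 / η), κ, hκ, fun q _ hq => hχc q hq, hinj, ?_, hpP,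
    (him p hpP).2 hcp, ⟨by linarith, ?_⟩, ?_, ?_, ?_⟩
  · intro t ht htP
    have h1 := eq_zero_of_sqrt_eq htP
    have h2 : 0 ≤ a (g t) := by rw [← show ρ (g t) = a (g t) from htP]; exact Real.sqrt_nonneg _
    have h3 : b (g t) = τ * a (g t) := by have := h1.1; simp only [hb'def] at this; linarith
    rcases h2.eq_or_lt with h4 | h4
    · exact h0 _ (H.mem g hg t ht) h4.symm (by rw [h3, ← h4, mul_zero]) h1.2
    · exact hτg t ht h1.2 h4 h3
  · change (stereo (a p) (b' p) (c p)).re < _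
    rw [hap, hb'p, hcp]
    exact hτ3.2
  · intro y hy hlim
    rw [tendsto_iff_ultrafilter]
    intro 𝒰 h𝒰
    obtain ⟨q, hq, hq'⟩ := hN.ultrafilter_le_nhds (𝒰.map y) (by
      rw [Ultrafilter.coe_map]
      exact tendsto_principal.2 (Eventually.of_forall fun k => (hy k).1))
    have hyq : Tendsto y 𝒰 (𝓝 q) := hq'
    have hlim' := hlim.mono_left h𝒰
    have hqP : q ∉ P := by
      intro hqP
      have l1 : Tendsto (fun k => (ρ (y k) - a (y k)) * ((χ (y k)).re ^ 2 + (χ (y k)).im ^ 2)) 𝒰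
          (𝓝 ((ρ q - a q) * ((χ p).re ^ 2 + (χ p).im ^ 2))) :=
        (((hρ.tendsto q).comp hyq).sub ((ha.tendsto q).comp hyq)).mul
          ((((Complex.continuous_re.tendsto _).comp hlim').pow 2).add
            (((Complex.continuous_im.tendsto _).comp hlim').pow 2))
      have l2 : Tendsto (fun k => ρ (y k) + a (y k)) 𝒰 (𝓝 (ρ q + a q)) :=
        ((hρ.tendsto q).comp hyq).add ((ha.tendsto q).comp hyq)
      have l3 := tendsto_nhds_unique (l1.congr fun k => stereo_normSq (hy k).2) l2
      have l4 : ρ q = a q := hqP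
      have l5 := eq_zero_of_sqrt_eq l4
      rw [l4, sub_self, zero_mul] at l3
      have l6 : a q = 0 := by linarith
      refine h0 q hq l6 ?_ l5.2
      have := l5.1
      simp only [hb'def, l6] at this
      linarith
    have e : χ q = χ p := tendsto_nhds_unique ((hχc q hqP).tendsto.comp hyq) hlim'
    rwa [← hinj ⟨hq, hqP⟩ ⟨hp, hpP⟩ e]
  · intro h hh t ht htP h1 h2 s hs hst
    have hct := (him _ htP).1 h1
    have := hsign h hh t ht (hsec _ (H.mem h hh t ht) htP hct h2.2) hct s hs hst
    exact ⟨fun hlt => stereo_im_neg (this.1 hlt), fun hlt => stereo_im_pos (this.2 hlt)⟩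
  · intro q hq hqP h1 h2 κ' hκ'
    have hqc := (him _ hqP).1 h1
    have hd := hsec q hq hqP hqc h2.2
    have hV : {y | y ∉ P ∧ (χ y).re ∈ Set.Ioo ((χ p).re - 1) (-(4 / η))} ∈ 𝓝 q := by
      refine inter_mem (hPc.isOpen_compl.mem_nhds hqP) ?_
      exact ((Complex.continuous_re.continuousAt).comp (hχc q hqP)).preimage_mem_nhds
        (Ioo_mem_nhds h2.1 h2.2)
    obtain ⟨ε, hε, hεV⟩ := Metric.mem_nhds_iff.1 hV
    obtain ⟨σ, hσ, hσκ, hσε, hσr⟩ : ∃ σ > (0 : ℝ), σ ≤ κ' ∧ (|L| + 1) * σ ≤ ε / 2 ∧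
        (|L| + 1) * σ ≤ r / 4 := by
      refine ⟨min κ' (min (ε / 2 / (|L| + 1)) (r / 4 / (|L| + 1))), by positivity,
        min_le_left _ _, ?_, ?_⟩
      · rw [mul_comm, ← le_div_iff₀ hL1]
        exact (min_le_right _ _).trans (min_le_left _ _)
      · rw [mul_comm, ← le_div_iff₀ hL1]
        exact (min_le_right _ _).trans (min_le_right _ _)
    refine ⟨{y | |c y| < δ * σ} ∩ Metric.ball q (min (ε / 2) (r / 4)),
      inter_mem ?_ (Metric.ball_mem_nhds _ (by positivity)), ?_⟩
    · refine (isOpen_lt (by fun_prop) continuous_const).mem_nhds ?_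
      change |c q| < δ * σ
      rw [hqc, abs_zero]
      positivity
    · rintro h hh t ht ⟨hU1, hU2⟩
      rw [Metric.mem_ball] at hU2
      have hU3 := hU2.trans_le (min_le_left _ _)
      have hU4 := hU2.trans_le (min_le_right _ _)
      have hnear : ∀ u ∈ Set.Icc (t - σ) (t + σ), 0 ≤ u ∧ |u - t| ≤ σ ∧
          dist (h u) (h t) ≤ (|L| + 1) * σ := by
        intro u hu
        have h5 : 0 ≤ u := by linarith [hu.1]
        have h6 : |u - t| ≤ σ := abs_le.2 ⟨by linarith [hu.1], by linarith [hu.2]⟩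
        exact ⟨h5, h6, (hLip h hh u h5 t (hκ'.le.trans ht)).trans
          (mul_le_mul_of_nonneg_left h6 hL1.le)⟩
      have hnear' : ∀ u ∈ Set.Icc (t - σ) (t + σ), dist (h u) p ≤ r := fun u hu => by
        linarith [(hnear u hu).2.2, dist_triangle (h u) (h t) p, dist_triangle (h t) q p]
      have ht0 : 0 ≤ t - σ := by linarith
      have r1 := hrate h hh (t - σ) ht0 t (by linarith) fun u hu =>
        hnear' u ⟨hu.1, by linarith [hu.2]⟩
      have r2 := hrate h hh t (by linarith) (t + σ) (by linarith) fun u hu =>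
        hnear' u ⟨by linarith [hu.1], hu.2⟩
      have hU1' := abs_lt.1 (show |c (h t)| < δ * σ from hU1)
      have hcont : ContinuousOn (fun u => c (h u)) (Set.Icc (t - σ) (t + σ)) :=
        hc.comp_continuousOn ((H.continuousOn hh).mono fun u hu => (hnear u hu).1)
      obtain ⟨s, hs, hs0⟩ := intermediate_value_Icc (by linarith : t - σ ≤ t + σ) hcont
        (show (0 : ℝ) ∈ Set.Icc (c (h (t - σ))) (c (h (t + σ))) from ⟨by linarith, by linarith⟩)
      have hsV := hεV (show h s ∈ Metric.ball q ε by
        rw [Metric.mem_ball]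
        linarith [(hnear s hs).2.2, dist_triangle (h s) (h t) q])
      exact ⟨s, (hnear s hs).1, (hnear s hs).2.1.trans hσκ, hsV.1, (him _ hsV.1).2 hs0, hsV.2⟩

end Stereographic

section Coordinates

variable {n : ℕ} {M : Set (Matrix (Fin n) (Fin n) ℝ)} {v : Vec n → ℝ}

theorem Continuous.mulE {X : Type*} [TopologicalSpace X] {f : X → Matrix (Fin n) (Fin n) ℝ}
    {g : X → Vec n} (hf : Continuous f) (hg : Continuous g) :
    Continuous fun x => mulE (f x) (g x) :=
  continuous_mulE.comp (hf.prodMk hg)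

theorem exists_ne_zero_inner_eq_zero (x y : Vec 3) :
    ∃ w : Vec 3, w ≠ 0 ∧ ⟪x, w⟫ = 0 ∧ ⟪y, w⟫ = 0 := by
  have h : (Submodule.span ℝ {x, y})ᗮ ≠ ⊥ := by
    intro h
    have h1 := Submodule.finrank_add_finrank_orthogonal (Submodule.span ℝ {x, y})
    have h2 : Module.finrank ℝ (Submodule.span ℝ {x, y}) ≤ 2 := by
      classical
      have := finrank_span_finset_le_card (R := ℝ) ({x, y} : Finset (Vec 3))
      rw [Finset.coe_pair] at this
      exact this.trans Finset.card_le_two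
    rw [h, finrank_bot, finrank_euclideanSpace_fin] at h1
    omega
  obtain ⟨w, hw, hw0⟩ := Submodule.exists_mem_ne_zero_of_ne_bot h
  rw [Submodule.mem_orthogonal] at hw
  exact ⟨w, hw0, hw x (Submodule.subset_span (by simp)), hw y (Submodule.subset_span (by simp))⟩

theorem eq_zero_of_inner_eq_zero {x y w z : Vec 3} (hx : x ≠ 0) (hy : y ≠ 0) (hw : w ≠ 0)
    (hxy : ⟪x, y⟫ = 0) (hxw : ⟪x, w⟫ = 0) (hyw : ⟪y, w⟫ = 0)
    (h1 : ⟪x, z⟫ = 0) (h2 : ⟪y, z⟫ = 0) (h3 : ⟪w, z⟫ = 0) : z = 0 := by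
  by_contra hz
  have hl : LinearIndependent ℝ ![x, y, w, z] := by
    refine linearIndependent_of_ne_zero_of_inner_eq_zero (fun i => ?_) fun i j hij => ?_
    · fin_cases i <;> simpa
    · fin_cases i <;> fin_cases j <;> first | exact absurd rfl hij | skip
      all_goals first | (simpa using ‹_›) | (rw [real_inner_comm]; simpa using ‹_›)
  have := hl.fintype_card_le_finrank
  rw [finrank_euclideanSpace_fin, Fintype.card_fin] at this
  omega

theorem mulE_ne_zero {A : Matrix (Fin n) (Fin n) ℝ} (hA : IsUnit A) {x : Vec n} (hx : x ≠ 0) :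
    mulE A x ≠ 0 := by
  intro h
  refine hx (WithLp.ofLp_injective 2 (Matrix.mulVec_injective_iff_isUnit.2 hA ?_))
  have : A *ᵥ WithLp.ofLp x = WithLp.ofLp (mulE A x) := rfl
  rw [this, h]
  simp

/-- The points `x + ε m` with `m` a subgradient at `x` determine the rays of unit pairs. -/
theorem eq_of_add_smul_eq {ε r : ℝ} (hε : 0 < ε) {q q' : Vec n × Vec n}
    (hq : q ∈ unitPairs v) (hq' : q' ∈ unitPairs v)
    (h : q.1 + ε • q.2 = r • (q'.1 + ε • q'.2)) (hr : 0 < r) : q = q' := by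
  obtain ⟨x, m⟩ := q
  obtain ⟨x', m'⟩ := q'
  obtain ⟨h1, h2, h3⟩ := hq
  obtain ⟨h1', h2', h3'⟩ := hq'
  simp only at h1 h2 h3 h1' h2' h3' h
  have e : x - r • x' = -ε • (m - r • m') := by
    have : x - r • x' = (x + ε • m) - ε • m - r • x' := by abel
    rw [this, h]
    module
  have e1 : ⟪m - r • m', x - r • x'⟫ = 1 - r * ⟪m, x'⟫ - r * ⟪m', x⟫ + r ^ 2 := by
    simp only [inner_sub_left, inner_sub_right, inner_smul_left, inner_smul_right, conj_trivial,
      h2, h2', h1, h1']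
    ring
  have e2 := e1
  rw [e, inner_smul_right, real_inner_self_eq_norm_sq] at e2
  have h4 := h3 x'
  have h4' := h3' x
  rw [h1'] at h4
  rw [h1] at h4'
  have h5 : (1 - r) ^ 2 ≤ -ε * ‖m - r • m'‖ ^ 2 := by nlinarith
  have h6 : 0 ≤ ε * ‖m - r • m'‖ ^ 2 := by positivity
  have h7 : r = 1 := by nlinarith
  have h8 : ε * ‖m - r • m'‖ ^ 2 = 0 := le_antisymm (by nlinarith [sq_nonneg (1 - r)]) h6
  have h9 : m - r • m' = 0 := by
    rcases mul_eq_zero.1 h8 with h | h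
    · exact absurd h hε.ne'
    · exact norm_eq_zero.1 (pow_eq_zero_iff two_ne_zero |>.1 h)
  rw [h9, smul_zero] at e
  rw [h7, one_smul, sub_eq_zero] at h9 e
  exact Prod.ext e h9

/-- A covector that is positive on the velocities at `x₀` annihilated by the subgradient `m₀`. -/
theorem exists_transversal (hM : IsCompact M) (hconv : Convex ℝ M) (hinv : ∀ A ∈ M, IsUnit A)
    {x₀ m₀ : Vec n} (hx₀ : x₀ ≠ 0) (h1 : ⟪m₀, x₀⟫ = 1) :
    ∃ w : Vec n, ∃ δ > 0, ⟪w, x₀⟫ = 0 ∧ ∀ A ∈ M, ⟪m₀, mulE A x₀⟫ = 0 → δ < ⟪w, mulE A x₀⟫ := by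
  have hc1 : Continuous fun A : Matrix (Fin n) (Fin n) ℝ => mulE A x₀ :=
    Continuous.mulE continuous_id continuous_const
  have hlin : ∀ (a b : ℝ) (A B : Matrix (Fin n) (Fin n) ℝ),
      mulE (a • A + b • B) x₀ = a • mulE A x₀ + b • mulE B x₀ := by
    intro a b A B
    ext i
    simp [mulE_apply, add_mul, Finset.sum_add_distrib, Finset.mul_sum, mul_assoc]
  have hcl : IsClosed {A : Matrix (Fin n) (Fin n) ℝ | ⟪m₀, mulE A x₀⟫ = 0} :=
    isClosed_eq (Continuous.inner continuous_const hc1) continuous_const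
  set U : Set (Vec n) := (fun A => mulE A x₀) '' (M ∩ {A | ⟪m₀, mulE A x₀⟫ = 0})
  have hUc : IsCompact U := (hM.inter_right hcl).image hc1
  have hUconv : Convex ℝ U := by
    rintro _ ⟨A, ⟨hA, hA'⟩, rfl⟩ _ ⟨B, ⟨hB, hB'⟩, rfl⟩ a b ha hb hab
    refine ⟨a • A + b • B, ⟨hconv hA hB ha hb hab, ?_⟩, hlin _ _ _ _⟩
    change ⟪m₀, mulE A x₀⟫ = 0 at hA'
    change ⟪m₀, mulE B x₀⟫ = 0 at hB'
    change ⟪m₀, mulE (a • A + b • B) x₀⟫ = 0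
    rw [hlin, inner_add_right, inner_smul_right, inner_smul_right, hA', hB']
    simp
  have hU0 : (0 : Vec n) ∉ U := by
    rintro ⟨A, ⟨hA, -⟩, h⟩
    exact mulE_ne_zero (hinv A hA) hx₀ h
  obtain ⟨f, u, hu0, hu⟩ := geometric_hahn_banach_point_closed hUconv hUc.isClosed hU0
  rw [map_zero] at hu0
  set w := (InnerProductSpace.toDual ℝ (Vec n)).symm f
  have hw : ∀ y, ⟪w, y⟫ = f y := fun y => by simp [w]
  refine ⟨w - ⟪w, x₀⟫ • m₀, u, hu0, ?_, fun A hA hA' => ?_⟩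
  · rw [inner_sub_left, inner_smul_left, h1]; simp
  · rw [inner_sub_left, inner_smul_left, hA', mul_zero, sub_zero, hw]
    exact hu _ ⟨A, ⟨hA, hA'⟩, rfl⟩

theorem exists_coordinate (hM : IsCompact M) {x₀ m₀ w : Vec n} {δ : ℝ} (hw0 : w ≠ 0)
    (h1 : ⟪m₀, x₀⟫ = 1) (hw : ⟪w, x₀⟫ = 0)
    (hδ : ∀ A ∈ M, ⟪m₀, mulE A x₀⟫ = 0 → δ < ⟪w, mulE A x₀⟫) :
    ∃ ε > (0 : ℝ), ∃ r > (0 : ℝ), ∃ w' : Vec n, w' ≠ 0 ∧ ⟪w', x₀ + ε • m₀⟫ = 0 ∧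
      ∀ q : Vec n × Vec n, dist q (x₀, m₀) ≤ r → ∀ A ∈ M, ⟪q.2, mulE A q.1⟫ = 0 →
        δ ≤ ⟪w', mulE A q.1 - ε • mulE Aᵀ q.2⟫ := by
  obtain ⟨W, hWc, hW0, hWz⟩ : ∃ W : ℝ → Vec n, ContinuousAt W 0 ∧ W 0 = w ∧
      ∀ ε > 0, ⟪W ε, x₀ + ε • m₀⟫ = 0 := by
    have hd : ContinuousAt (fun ε : ℝ => ε * ⟪w, m₀⟫ / (1 + ε * ‖m₀‖ ^ 2)) 0 :=
      ContinuousAt.div (by fun_prop) (by fun_prop) (by simp)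
    refine ⟨fun ε => w - (ε * ⟪w, m₀⟫ / (1 + ε * ‖m₀‖ ^ 2)) • m₀,
      continuousAt_const.sub (hd.smul continuousAt_const), by simp, fun ε hε => ?_⟩
    have h2 : (1 : ℝ) + ε * ‖m₀‖ ^ 2 ≠ 0 := by positivity
    simp only [inner_sub_left, inner_add_right, inner_smul_left, inner_smul_right,
      conj_trivial, h1, hw, real_inner_self_eq_norm_sq]
    field_simp
    ring
  have hT : Continuous fun A : Matrix (Fin n) (Fin n) ℝ => Aᵀ := by fun_prop
  have key : ∀ᶠ z : ℝ × (Vec n × Vec n) in 𝓝 (0, (x₀, m₀)), ∀ A ∈ M, ⟪z.2.2, mulE A z.2.1⟫ = 0 →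
      δ ≤ ⟪W z.1, mulE A z.2.1 - z.1 • mulE Aᵀ z.2.2⟫ := by
    refine hM.eventually_forall_of_forall_eventually fun A hA => ?_
    have c1 : Continuous fun z : (ℝ × (Vec n × Vec n)) × Matrix (Fin n) (Fin n) ℝ =>
        mulE z.2 z.1.2.1 :=
      Continuous.mulE continuous_snd (by fun_prop)
    have c2 : Continuous fun z : (ℝ × (Vec n × Vec n)) × Matrix (Fin n) (Fin n) ℝ =>
        mulE z.2ᵀ z.1.2.2 :=
      Continuous.mulE (hT.comp continuous_snd) (by fun_prop)
    by_cases hA0 : ⟪m₀, mulE A x₀⟫ = 0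
    · have cW : ContinuousAt (fun z : (ℝ × (Vec n × Vec n)) × Matrix (Fin n) (Fin n) ℝ =>
          W z.1.1) ((0, (x₀, m₀)), A) :=
        hWc.comp_of_eq (continuous_fst.comp continuous_fst).continuousAt rfl
      have c3 := cW.inner (𝕜 := ℝ) (c1.sub (Continuous.smul
        (continuous_fst.comp continuous_fst) c2)).continuousAt
      have h3 : δ < ⟪W 0, mulE A x₀ - (0 : ℝ) • mulE Aᵀ m₀⟫ := by
        rw [hW0, zero_smul, sub_zero]
        exact hδ A hA hA0
      filter_upwards [c3.eventually_const_lt h3] with z hz _ using hz.le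
    · have c3 : Continuous (fun z : (ℝ × (Vec n × Vec n)) × Matrix (Fin n) (Fin n) ℝ =>
          ⟪z.1.2.2, mulE z.2 z.1.2.1⟫) := Continuous.inner (by fun_prop) c1
      filter_upwards [c3.continuousAt.eventually_ne hA0] with z hz h using absurd h hz
  have key2 : ∀ᶠ z : ℝ × (Vec n × Vec n) in 𝓝 (0, (x₀, m₀)), W z.1 ≠ 0 :=
    (hWc.comp_of_eq continuous_fst.continuousAt rfl).eventually_ne (by simpa [hW0] using hw0)
  obtain ⟨r, hr, hball⟩ := Metric.mem_nhds_iff.1 (key.and key2)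
  have hmem : ∀ q : Vec n × Vec n, dist q (x₀, m₀) ≤ r / 2 →
      (r / 2, q) ∈ Metric.ball ((0 : ℝ), (x₀, m₀)) r := by
    intro q hq
    rw [Metric.mem_ball, Prod.dist_eq]
    refine max_lt ?_ (by simp only; linarith)
    rw [Real.dist_eq, sub_zero, abs_of_pos (by positivity)]
    linarith
  refine ⟨r / 2, by positivity, r / 2, by positivity, W (r / 2),
    (hball (hmem (x₀, m₀) (by rw [dist_self]; positivity))).2, hWz _ (by positivity),
    fun q hq A hA hA' => (hball (hmem q hq)).1 A hA hA'⟩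

theorem le_inner_sub_of_mem_extremalPairs (hM : IsCompact M) {p : Vec n × Vec n} {w : Vec n}
    {ε δ r : ℝ} (hw : ∀ q : Vec n × Vec n, dist q p ≤ r → ∀ A ∈ M, ⟪q.2, mulE A q.1⟫ = 0 →
        δ ≤ ⟪w, mulE A q.1 - ε • mulE Aᵀ q.2⟫)
    {h : ℝ → Vec n × Vec n} (hh : h ∈ extremalPairs M v) {s t : ℝ} (hs : 0 ≤ s) (hst : s ≤ t)
    (hd : ∀ u ∈ Set.Icc s t, dist (h u) p ≤ r) :
    δ * (t - s) ≤ ⟪w, (h t).1 + ε • (h t).2⟫ - ⟪w, (h s).1 + ε • (h s).2⟫ := by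
  obtain ⟨A, h1, h2, h3⟩ := hh
  obtain ⟨L, hL0, hL⟩ := exists_norm_mulE_le hM
  obtain ⟨hA, hAM, hS⟩ := isSolutionWith_iff.1 h1
  obtain ⟨hF, hF'⟩ := isCoef_of_mem hL hA hAM
  have hS' := isAdjointWith_iff.1 h2
  have hsub : Set.uIcc s t ⊆ Set.Icc 0 t := by
    rw [Set.uIcc_of_le hst]; exact Set.Icc_subset_Icc hs le_rfl
  have i1 := hF.intervalIntegrable ((hS t).1.mono hsub)
  have i2 := hF'.intervalIntegrable ((hS' t).1.mono hsub)
  have e1 := (hS t).sub_eq hF (s := s) (t := t) ⟨hs, hst⟩ ⟨hs.trans hst, le_rfl⟩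
  have e2 := (hS' t).sub_eq hF' (s := s) (t := t) ⟨hs, hst⟩ ⟨hs.trans hst, le_rfl⟩
  have i3 := i1.add (i2.smul ε)
  have e3 : ⟪w, (h t).1 + ε • (h t).2⟫ - ⟪w, (h s).1 + ε • (h s).2⟫ =
      ∫ u in s..t, ⟪w, mulE (A u) (h u).1 + ε • mulE (-(A u)ᵀ) (h u).2⟫ := by
    have := (innerSL ℝ w).intervalIntegral_comp_comm i3
    simp only [innerSL_apply_apply, Pi.smul_apply] at this
    have e4 := intervalIntegral.integral_add i1 (i2.smul ε)
    simp only [Pi.smul_apply] at e4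
    rw [this, e4, intervalIntegral.integral_smul, ← e1, ← e2, ← inner_sub_right]
    congr 1
    module
  rw [e3]
  have i4 : IntervalIntegrable (fun u => ⟪w, mulE (A u) (h u).1 + ε • mulE (-(A u)ᵀ) (h u).2⟫)
      volume s t := by
    rw [intervalIntegrable_iff] at i3 ⊢
    exact (innerSL ℝ w).integrable_comp i3
  calc δ * (t - s) = ∫ _ in s..t, δ := by simp [mul_comm]
    _ ≤ _ := by
      refine intervalIntegral.integral_mono_ae_restrict hst
        (Continuous.intervalIntegrable continuous_const _ _) i4 ?_
      refine (ae_restrict_iff' measurableSet_Icc).2 ?_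
      have e0 : ∀ᵐ u : ℝ, u ≠ 0 := by simp [ae_iff]
      filter_upwards [ae_inner_mulE_eq_zero hM h1 h3, e0] with u hu hu0 hus
      have := hw (h u) (hd u hus) (A u) (hAM u) (hu (lt_of_le_of_ne (hs.trans hus.1) hu0.symm))
      rwa [neg_mulE, smul_neg, ← sub_eq_add_neg]

end Coordinates

theorem exists_isCrossSection_extremalPairs {M : Set (Matrix (Fin 3) (Fin 3) ℝ)}
    {v : Vec 3 → ℝ} (hne : M.Nonempty) (hM : IsCompact M) (hconv : Convex ℝ M)
    (hinv : ∀ A ∈ M, IsUnit A) (hv : IsBarabanov M v) (hG : ConditionG M)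
    {g k : ℝ → Vec 3 × Vec 3} (hg : g ∈ extremalPairs M v) (hk : k ∈ extremalPairs M v) :
    ∃ χ P α β κ, IsCrossSection (extremalPairs M v) (unitPairs v) g (k 0) χ P α β κ := by
  have H := isCompactSemiflow_extremalPairs hne hM hconv hv hG
  have hp := H.mem k hk 0 le_rfl
  generalize k 0 = p at hp ⊢
  obtain ⟨x₀, m₀⟩ := p
  obtain ⟨hx1, hm1, hm2⟩ := id hp
  change v x₀ = 1 at hx1
  change ⟪m₀, x₀⟫ = v x₀ at hm1
  rw [hx1] at hm1
  have hx₀ : x₀ ≠ 0 := fun h => by rw [h, inner_zero_right] at hm1; exact zero_ne_one hm1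
  obtain ⟨w, δ, hδ, hw0, hw, hwδ⟩ : ∃ w : Vec 3, ∃ δ > (0 : ℝ), w ≠ 0 ∧ ⟪w, x₀⟫ = 0 ∧
      ∀ A ∈ M, ⟪m₀, mulE A x₀⟫ = 0 → δ < ⟪w, mulE A x₀⟫ := by
    obtain ⟨w, δ, hδ, hw, hwδ⟩ := exists_transversal hM hconv hinv hx₀ hm1
    by_cases hU : ∃ A ∈ M, ⟪m₀, mulE A x₀⟫ = 0
    · obtain ⟨A, hA, hA'⟩ := hU
      refine ⟨w, δ, hδ, fun h => ?_, hw, hwδ⟩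
      have := hwδ A hA hA'
      rw [h, inner_zero_left] at this
      linarith
    · obtain ⟨w', h1, h2, -⟩ := exists_ne_zero_inner_eq_zero x₀ x₀
      exact ⟨w', 1, one_pos, h1, by rw [real_inner_comm, h2], fun A hA h => absurd ⟨A, hA, h⟩ hU⟩
  obtain ⟨ε, hε, r, hr, w', hw'0, hw'z, hw'δ⟩ := exists_coordinate hM hw0 hm1 hw hwδ
  set z₀ := x₀ + ε • m₀ with hz₀
  have hpos : ∀ q ∈ unitPairs v, q.1 + ε • q.2 ≠ 0 := by
    intro q hq h
    have : ⟪q.2, q.1 + ε • q.2⟫ = 1 + ε * ‖q.2‖ ^ 2 := by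
      rw [inner_add_right, inner_smul_right, hq.2.1, hq.1, real_inner_self_eq_norm_sq]
    rw [h, inner_zero_right] at this
    nlinarith [mul_nonneg hε.le (sq_nonneg ‖q.2‖)]
  have hz₀0 : z₀ ≠ 0 := hpos _ hp
  have hz₀n : (‖z₀‖ ^ 2) ≠ 0 := by simpa using hz₀0
  obtain ⟨y, hy0, hy1, hy2⟩ := exists_ne_zero_inner_eq_zero z₀ w'
  have hzero : ∀ z : Vec 3, ⟪z₀, z⟫ = 0 → ⟪y, z⟫ = 0 → ⟪w', z⟫ = 0 → z = 0 := fun z h1 h2 h3 =>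
    eq_zero_of_inner_eq_zero hz₀0 hy0 hw'0 hy1 (by rw [real_inner_comm, hw'z])
      (by rw [real_inner_comm, hy2]) h1 h2 h3
  have hrate : ∀ h ∈ extremalPairs M v, ∀ s ≥ (0 : ℝ), ∀ t ≥ s,
      (∀ u ∈ Set.Icc s t, dist (h u) (x₀, m₀) ≤ r) →
      δ * (t - s) ≤ ⟪w', (h t).1 + ε • (h t).2⟫ - ⟪w', (h s).1 + ε • (h s).2⟫ :=
    fun h hh s hs t ht hd => le_inner_sub_of_mem_extremalPairs hM hw'δ hh hs ht hd
  set a : Vec 3 × Vec 3 → ℝ := fun q => ⟪z₀, q.1 + ε • q.2⟫ / ‖z₀‖ ^ 2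
  set b : Vec 3 × Vec 3 → ℝ := fun q => ⟪y, q.1 + ε • q.2⟫
  set c : Vec 3 × Vec 3 → ℝ := fun q => ⟪w', q.1 + ε • q.2⟫
  have ha : Continuous a := by fun_prop
  have hb : Continuous b := by fun_prop
  have hc : Continuous c := by fun_prop
  have hap : a (x₀, m₀) = 1 := by
    simp only [a, ← hz₀]
    rw [real_inner_self_eq_norm_sq, div_self hz₀n]
  have hbp : b (x₀, m₀) = 0 := by
    simp only [b, ← hz₀]
    rw [real_inner_comm, hy1]
  refine exists_isCrossSection H hv.1.isCompact_unitPairs ha hb hc hp hap hbp hw'z ?_ ?_ hδ hr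
    hrate hg
  · intro q hq q' hq' R hR e1 e2 e3
    simp only [a, b, c] at e1 e2 e3
    refine eq_of_add_smul_eq hε hq hq' (r := R) (sub_eq_zero.1 (hzero _ ?_ ?_ ?_)) hR
    · rw [inner_sub_right, inner_smul_right, sub_eq_zero]
      field_simp at e1
      exact e1
    · rw [inner_sub_right, inner_smul_right, sub_eq_zero, e2]
    · rw [inner_sub_right, inner_smul_right, sub_eq_zero, e3]
  · intro q hq e1 e2 e3
    exact hpos q hq (hzero _ ((div_eq_zero_iff.1 e1).resolve_right hz₀n) e2 e3)

theorem IsBarabanov.smul {n : ℕ} {M : Set (Matrix (Fin n) (Fin n) ℝ)} {v : Vec n → ℝ}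
    (hv : IsBarabanov M v) {r : ℝ} (hr : 0 < r) : IsBarabanov M fun x => r * v x := by
  refine ⟨⟨fun x => ?_, fun a x => ?_, fun x y => ?_⟩, fun x hx t ht => ?_, fun y => ?_⟩
  · rw [mul_eq_zero, or_iff_right hr.ne', hv.1.1]
  · simp only [hv.1.2.1]; ring
  · rw [← mul_add]; exact mul_le_mul_of_nonneg_left (hv.1.2.2 x y) hr.le
  · exact mul_le_mul_of_nonneg_left (hv.2.1 x hx t ht) hr.le
  · obtain ⟨x, hx, hx0, h⟩ := hv.2.2 y
    exact ⟨x, hx, hx0, fun t ht => by simp only [h t ht]⟩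

theorem omegaLimitSet_congr {n : ℕ} {x y : ℝ → Vec n} (h : ∀ t ≥ (0 : ℝ), x t = y t) :
    omegaLimitSet x = omegaLimitSet y := by
  ext q
  refine exists_congr fun s => and_congr_right fun hs => tendsto_congr' ?_
  filter_upwards [hs.eventually_ge_atTop 0] with k hk using h _ hk

theorem stmt13 (M : Set (Matrix (Fin 3) (Fin 3) ℝ))
    (hne : M.Nonempty) (hcpt : IsCompact M) (hconv : Convex ℝ M)
    (hirr : MIrreducible M) (hrho : rhoZero M) (hinv : ∀ A ∈ M, IsUnit A)
    (hG : ConditionG M)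
    (v : Vec 3 → ℝ) (hv : IsBarabanov M v)
    (x : ℝ → Vec 3) (hx : IsExtremal M v x) :
    ∃ T > (0:ℝ), ∃ y : ℝ → Vec 3, IsSolution M y ∧
      (∀ t ≥ (0:ℝ), y (t + T) = y t) ∧ omegaLimitSet x = y '' Set.Icc 0 T := by
  rcases eq_or_ne (x 0) 0 with h0 | h0
  · have hx0 : ∀ t ≥ (0 : ℝ), x t = 0 := fun t ht => by
      rw [← hv.1.1, hx.2 t ht, hv.1.1, h0]
    refine ⟨1, one_pos, x, hx.1, fun t ht => by rw [hx0 t ht, hx0 _ (by linarith)], ?_⟩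
    have e : x '' Set.Icc 0 1 = {0} := by
      rw [Set.eq_singleton_iff_unique_mem]
      refine ⟨⟨0, by simp, h0⟩, ?_⟩
      rintro _ ⟨t, ht, rfl⟩
      exact hx0 t ht.1
    rw [e, omegaLimitSet_congr (y := fun _ => 0) hx0, Set.eq_singleton_iff_unique_mem]
    exact ⟨⟨fun k => k, tendsto_natCast_atTop_atTop, tendsto_const_nhds⟩,
      fun q ⟨s, _, hs⟩ => tendsto_nhds_unique hs tendsto_const_nhds⟩
  have hr : 0 < v (x 0) := hv.1.pos h0
  have hw := hv.smul (inv_pos.2 hr)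
  obtain ⟨g, hg, hgx⟩ := exists_mem_extremalPairs hne hcpt hconv hw hx.1 fun t ht => by
    rw [hx.2 t ht, inv_mul_cancel₀ hr.ne']
  have H := isCompactSemiflow_extremalPairs hne hcpt hconv hw hG
  obtain ⟨k, hk, T, hT, hper, s, B, h1, h2, h3, h4, h5⟩ := H.exists_periodic_return hg fun k hk =>
    exists_isCrossSection_extremalPairs hne hcpt hconv hinv hw hG hg hk
  refine ⟨T, hT, fun t => (k t).1, ?_, fun t ht => congrArg Prod.fst (hper t ht), ?_⟩
  · obtain ⟨A, hA, -⟩ := hk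
    exact ⟨A, hA⟩
  · rw [omegaLimitSet_congr (y := fun t => (g t).1) fun t ht => (hgx t ht).symm]
    exact H.limitPoints_eq_image hg hk hT hper h1 h2 h3 h4 h5 continuous_fst
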